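/- Let d ∈ ℕ, ρ ≥ 1, p > d, C̃₀ > 0 and x₀ ∈ ℝ^d. Assume Σ̃ = σ̃σ̃ᵀ with Σ̃(x) ≥ I_d/C̃₀ and σ̃ Lipschitz continuous with Lipschitz constant C̃₀, and assume there exist Ã₁, Ã₂, Ã₃ ≥ 1 such that ‖r̃‖_{L^∞(B₂(x₀))} ≤ Ã₁, ‖b̃‖_{L^∞(B₂(x₀))} ≤ Ã₂ and ‖σ̃‖_{L^∞(B₂(x₀))} ≤ Ã₃. Let ṽ be a C², bounded classical solution on B₂(x₀) of ρṽ(x) − r̃(x) − b̃(x)·Dṽ(x) − (1/2)tr(Σ̃(x)D²ṽ(x)) = 0. Then there exists C = C(C̃₀, p, d) > 0, independent of Ã₁, Ã₂, Ã₃, ρ and x₀, such that ‖ṽ‖_{W^{2,p}(B₁(x₀))} ≤ C[Ã₁ + (Ã₂² + Ã₃^{4+2d/p} + ρ)·‖ṽ‖_{L^∞(B₂(x₀))}]. -/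

import Mathlib

open MeasureTheory Real Metric
noncomputable section

/-- First-order partial derivative `∂v/∂xᵢ`. -/
def pd1 (d : ℕ) (v : EuclideanSpace ℝ (Fin d) → ℝ) (x : EuclideanSpace ℝ (Fin d))
    (i : Fin d) : ℝ :=
  fderiv ℝ v x (EuclideanSpace.single i 1)

/-- Second-order partial derivative `∂²v/∂xᵢ∂xⱼ`. -/
def pd2 (d : ℕ) (v : EuclideanSpace ℝ (Fin d) → ℝ) (x : EuclideanSpace ℝ (Fin d))
    (i j : Fin d) : ℝ :=
  fderiv ℝ (fun y => fderiv ℝ v y (EuclideanSpace.single j 1)) x (EuclideanSpace.single i 1)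

/-- Euclidean space of dimension `d`. -/
abbrev Euc (d : ℕ) := EuclideanSpace ℝ (Fin d)

section InteriorEstimate

variable {d : ℕ}

/-- The partial derivative operator `∂ᵢ`. -/
def dd (i : Fin d) (f : Euc d → ℝ) (x : Euc d) : ℝ := fderiv ℝ f x (EuclideanSpace.single i 1)

/-- The convolution `k ⋆ h`. -/
def conv (k h : Euc d → ℝ) (x : Euc d) : ℝ := ∫ t, k t * h (x - t)

lemma conv_eq (k h : Euc d → ℝ) :
    conv k h = convolution k h (ContinuousLinearMap.mul ℝ ℝ) volume := rfl

lemma conv_swap (k h : Euc d → ℝ) (x : Euc d) : conv k h x = ∫ t, k (x - t) * h t := by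
  rw [conv_eq, convolution_eq_swap]; rfl

lemma conv_integrable {k h : Euc d → ℝ} (hk : Continuous k) (hh : Continuous h)
    (hc : HasCompactSupport h) (x : Euc d) : Integrable (fun t => k t * h (x - t)) := by
  have := hc.convolutionExists_right (ContinuousLinearMap.mul ℝ ℝ) (μ := volume)
    (f := k) (hk.locallyIntegrable) hh
  exact this x

lemma conv_integrable_swap {k h : Euc d → ℝ} (hk : Continuous k) (hh : Continuous h)
    (hc : HasCompactSupport h) (x : Euc d) : Integrable (fun t => k (x - t) * h t) := by
  have := (conv_integrable hk hh hc x).comp_sub_left x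
  simpa using this

lemma conv_continuous {k h : Euc d → ℝ} (hk : Continuous k) (hh : Continuous h)
    (hc : HasCompactSupport h) : Continuous (conv k h) :=
  hc.continuous_convolution_right (ContinuousLinearMap.mul ℝ ℝ) hk.locallyIntegrable hh

lemma conv_contDiff {k h : Euc d → ℝ} {n : ℕ∞} (hk : Continuous k) (hh : ContDiff ℝ n h)
    (hc : HasCompactSupport h) : ContDiff ℝ n (conv k h) :=
  hc.contDiff_convolution_right (ContinuousLinearMap.mul ℝ ℝ) hk.locallyIntegrable hh

lemma dd_continuous {h : Euc d → ℝ} (hh : ContDiff ℝ 1 h) (i : Fin d) : Continuous (dd i h) :=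
  (hh.continuous_fderiv one_ne_zero).clm_apply continuous_const

lemma dd_contDiff {h : Euc d → ℝ} {n m : ℕ∞} (hh : ContDiff ℝ n h) (hm : m + 1 ≤ n) (i : Fin d) :
    ContDiff ℝ m (dd i h) :=
  (hh.fderiv_right (m := m) (by exact_mod_cast hm)).clm_apply contDiff_const

lemma dd_hasCompactSupport {h : Euc d → ℝ} (hc : HasCompactSupport h) (i : Fin d) :
    HasCompactSupport (dd i h) :=
  (hc.fderiv_apply ℝ _)

lemma dd_conv {k h : Euc d → ℝ} (hk : Continuous k) (hh : ContDiff ℝ 1 h)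
    (hc : HasCompactSupport h) (i : Fin d) : dd i (conv k h) = conv k (dd i h) := by
  funext x
  have h1 := hc.hasFDerivAt_convolution_right (ContinuousLinearMap.mul ℝ ℝ) (μ := volume)
    hk.locallyIntegrable hh x
  have h2 := h1.fderiv
  change fderiv ℝ (convolution k h (ContinuousLinearMap.mul ℝ ℝ) volume) x _ = _
  rw [h2, convolution_precompR_apply (ContinuousLinearMap.mul ℝ ℝ) hk.locallyIntegrable
    (hc.fderiv ℝ) (hh.continuous_fderiv one_ne_zero)]
  rfl

lemma integral_mul_dd {k h : Euc d → ℝ} (hk : ContDiff ℝ 1 k) (hh : ContDiff ℝ 1 h)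
    (i : Fin d) (h1 : Integrable (fun x => dd i k x * h x))
    (h2 : Integrable (fun x => k x * dd i h x)) (h3 : Integrable (fun x => k x * h x)) :
    ∫ x, k x * dd i h x = - ∫ x, dd i k x * h x :=
  integral_mul_fderiv_eq_neg_fderiv_mul_of_integrable h1 h2 h3
    (fun x _ => hk.differentiable one_ne_zero x) (fun x _ => hh.differentiable one_ne_zero x)

lemma conv_dd {k h : Euc d → ℝ} (hk : ContDiff ℝ 1 k) (hh : ContDiff ℝ 1 h)
    (hc : HasCompactSupport h) (i : Fin d) : conv k (dd i h) = conv (dd i k) h := by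
  funext x
  have hk' : ContDiff ℝ 1 (fun t => k (x - t)) := hk.comp (contDiff_const.sub contDiff_id)
  have key : ∀ t, dd i (fun t => k (x - t)) t = - dd i k (x - t) := by
    intro t
    have h1 : HasFDerivAt (fun t => k (x - t)) ((fderiv ℝ k (x - t)).comp
        (-ContinuousLinearMap.id ℝ (Euc d))) t := by
      have h0 := (hk.differentiable one_ne_zero (x - t)).hasFDerivAt
      exact h0.comp t ((hasFDerivAt_id t).const_sub x)
    unfold dd
    rw [h1.fderiv]; simp
  rw [conv_swap, conv_swap, integral_mul_dd hk' hh i]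
  · simp [key, integral_neg]
  · simp only [key, neg_mul]
    exact (conv_integrable_swap (dd_continuous hk i) hh.continuous hc x).neg
  · exact conv_integrable_swap hk.continuous (dd_continuous hh i) (dd_hasCompactSupport hc i) x
  · exact conv_integrable_swap hk.continuous hh.continuous hc x

lemma conv_add_right {k h h' : Euc d → ℝ} (hk : Continuous k) (hh : Continuous h)
    (hc : HasCompactSupport h) (hh' : Continuous h') (hc' : HasCompactSupport h') (x : Euc d) :
    conv k (fun y => h y + h' y) x = conv k h x + conv k h' x := by
  unfold conv
  rw [← integral_add (conv_integrable hk hh hc x) (conv_integrable hk hh' hc' x)]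
  simp [mul_add]

lemma conv_sum_left {ι : Type*} (s : Finset ι) {k : ι → Euc d → ℝ} {h : Euc d → ℝ}
    (hk : ∀ i, Continuous (k i)) (hh : Continuous h) (hc : HasCompactSupport h) (x : Euc d) :
    conv (fun y => ∑ i ∈ s, k i y) h x = ∑ i ∈ s, conv (k i) h x := by
  unfold conv
  rw [← integral_finsetSum s (fun i _ => conv_integrable (hk i) hh hc x)]
  simp [Finset.sum_mul]

lemma conv_sum_right {ι : Type*} (s : Finset ι) {k : Euc d → ℝ} {h : ι → Euc d → ℝ}
    (hk : Continuous k) (hh : ∀ i, Continuous (h i)) (hc : ∀ i, HasCompactSupport (h i))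
    (x : Euc d) : conv k (fun y => ∑ i ∈ s, h i y) x = ∑ i ∈ s, conv k (h i) x := by
  unfold conv
  rw [← integral_finsetSum s (fun i _ => conv_integrable hk (hh i) (hc i) x)]
  simp [Finset.mul_sum]

lemma dd_comm {f : Euc d → ℝ} (hf : ContDiff ℝ 2 f) (i j : Fin d) :
    dd i (dd j f) = dd j (dd i f) := by
  funext x
  have hs : IsSymmSndFDerivAt ℝ f x := hf.contDiffAt.isSymmSndFDerivAt (by simp)
  have hd : DifferentiableAt ℝ (fderiv ℝ f) x :=
    (hf.fderiv_right (m := 1) (by norm_num)).differentiable one_ne_zero x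
  have : ∀ a b : Fin d, dd a (dd b f) x =
      fderiv ℝ (fderiv ℝ f) x (EuclideanSpace.single a 1) (EuclideanSpace.single b 1) := by
    intro a b
    unfold dd
    rw [fderiv_clm_apply hd (differentiableAt_const _)]
    simp
  rw [this, this]
  exact hs _ _

lemma dd_mul {f g : Euc d → ℝ} (hf : ContDiff ℝ 1 f) (hg : ContDiff ℝ 1 g) (i : Fin d)
    (x : Euc d) : dd i (fun y => f y * g y) x = dd i f x * g x + f x * dd i g x := by
  unfold dd
  rw [fderiv_fun_mul (hf.differentiable one_ne_zero x) (hg.differentiable one_ne_zero x)]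
  simp; ring

lemma dd_sub {f g : Euc d → ℝ} (hf : ContDiff ℝ 1 f) (hg : ContDiff ℝ 1 g) (i : Fin d)
    (x : Euc d) : dd i (fun y => f y - g y) x = dd i f x - dd i g x := by
  unfold dd
  rw [fderiv_fun_sub (hf.differentiable one_ne_zero x) (hg.differentiable one_ne_zero x)]
  simp

lemma dd_const_mul {f : Euc d → ℝ} (hf : ContDiff ℝ 1 f) (c : ℝ) (i : Fin d)
    (x : Euc d) : dd i (fun y => c * f y) x = c * dd i f x := by
  unfold dd
  rw [fderiv_const_mul (hf.differentiable one_ne_zero x)]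
  simp

lemma contDiff_coord {n : WithTop ℕ∞} (i : Fin d) : ContDiff ℝ n (fun x : Euc d => x i) := by
  fun_prop

lemma dd_coord (i k : Fin d) (x : Euc d) :
    dd k (fun y => y i) x = if i = k then 1 else 0 := by
  unfold dd
  have : HasFDerivAt (fun y : Euc d => y i) (EuclideanSpace.proj i : Euc d →L[ℝ] ℝ) x :=
    (EuclideanSpace.proj i : Euc d →L[ℝ] ℝ).hasFDerivAt
  rw [this.fderiv]
  simp

lemma abs_coord_le (x : Euc d) (i : Fin d) : |x i| ≤ ‖x‖ := by
  simpa using PiLp.norm_apply_le x i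

/-- The regularised distance to the origin. -/
def sreg (ε : ℝ) (x : Euc d) : ℝ := √(‖x‖ ^ 2 + ε ^ 2)

lemma sreg_pos {ε : ℝ} (hε : 0 < ε) (x : Euc d) : 0 < sreg ε x := by
  unfold sreg; positivity

lemma norm_le_sreg (ε : ℝ) (x : Euc d) : ‖x‖ ≤ sreg ε x :=
  Real.le_sqrt_of_sq_le (by nlinarith [sq_nonneg ε])

lemma sreg_sq (ε : ℝ) (x : Euc d) : sreg ε x ^ 2 = ‖x‖ ^ 2 + ε ^ 2 :=
  Real.sq_sqrt (by positivity)

/-- Negative powers of the regularised distance. -/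
def phi (ε : ℝ) (m : ℕ) (x : Euc d) : ℝ := (sreg ε x ^ m)⁻¹

lemma phi_pos {ε : ℝ} (hε : 0 < ε) (m : ℕ) (x : Euc d) : 0 < phi ε m x := by
  have := sreg_pos hε x
  unfold phi; positivity

lemma sreg_contDiff {ε : ℝ} (hε : 0 < ε) {n : WithTop ℕ∞} :
    ContDiff ℝ n (sreg ε : Euc d → ℝ) := by
  unfold sreg
  apply ContDiff.sqrt
  · exact (contDiff_norm_sq ℝ).add contDiff_const
  · intro x; positivity

lemma phi_contDiff {ε : ℝ} (hε : 0 < ε) (m : ℕ) {n : WithTop ℕ∞} :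
    ContDiff ℝ n (phi ε m : Euc d → ℝ) := by
  unfold phi
  exact ((sreg_contDiff hε).pow m).inv (fun x => (pow_pos (sreg_pos hε x) m).ne')

lemma dd_sreg {ε : ℝ} (hε : 0 < ε) (k : Fin d) (x : Euc d) :
    dd k (sreg ε) x = x k / sreg ε x := by
  have h1 : HasFDerivAt (fun y : Euc d => ‖y‖ ^ 2 + ε ^ 2) (2 • innerSL ℝ x) x := by
    have := (hasStrictFDerivAt_norm_sq x).hasFDerivAt
    exact this.add_const _
  have h2 := h1.sqrt (by positivity)
  unfold dd
  have h3 : fderiv ℝ (sreg ε) x = _ := h2.fderiv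
  rw [h3]
  have := sreg_pos hε x
  simp [sreg]
  field_simp
  simp [EuclideanSpace.inner_single_right]

lemma dd_phi {ε : ℝ} (hε : 0 < ε) (m : ℕ) (k : Fin d) (x : Euc d) :
    dd k (phi ε m) x = - m * x k * phi ε (m + 2) x := by
  have hs := sreg_pos hε x
  have h1 : HasFDerivAt (sreg ε) (fderiv ℝ (sreg ε) x) x :=
    ((sreg_contDiff hε (n := 1)).differentiable one_ne_zero x).hasFDerivAt
  have h2 : HasDerivAt (fun t : ℝ => (t ^ m)⁻¹) (-(m * sreg ε x ^ (m - 1)) / (sreg ε x ^ m) ^ 2)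
      (sreg ε x) := (hasDerivAt_pow m _).inv (pow_pos hs m).ne'
  have h3 := h2.comp_hasFDerivAt x h1
  have h4 : fderiv ℝ (phi ε m) x = _ := h3.fderiv
  have h5 : fderiv ℝ (sreg ε) x (EuclideanSpace.single k 1) = x k / sreg ε x := dd_sreg hε k x
  unfold dd
  rw [h4]
  simp only [smul_apply, h5, phi, smul_eq_mul]
  rcases m with _ | m
  · simp
  · simp only [Nat.add_sub_cancel]
    field_simp
    ring

/-- The regularised gradient of the fundamental solution of the Laplacian (up to a constant). -/
def ker1 (ε : ℝ) (i : Fin d) (x : Euc d) : ℝ := x i * phi ε d x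

/-- The regularised Hessian of the fundamental solution of the Laplacian (up to a constant). -/
def ker2 (ε : ℝ) (i j : Fin d) (x : Euc d) : ℝ :=
  (if i = j then 1 else 0) * phi ε d x - d * (x i * x j * phi ε (d + 2) x)

/-- The trace of `ker2`, an approximate identity up to a constant. -/
def kerP (d : ℕ) (ε : ℝ) (x : Euc d) : ℝ := d * ε ^ 2 * phi ε (d + 2) x

lemma ker1_contDiff {ε : ℝ} (hε : 0 < ε) (i : Fin d) {n : WithTop ℕ∞} :
    ContDiff ℝ n (ker1 ε i) :=
  (contDiff_coord i).mul (phi_contDiff hε d)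

lemma ker2_contDiff {ε : ℝ} (hε : 0 < ε) (i j : Fin d) {n : WithTop ℕ∞} :
    ContDiff ℝ n (ker2 ε i j) :=
  (contDiff_const.mul (phi_contDiff hε d)).sub
    (contDiff_const.mul (((contDiff_coord i).mul (contDiff_coord j)).mul (phi_contDiff hε _)))

lemma kerP_contDiff {ε : ℝ} (hε : 0 < ε) {n : WithTop ℕ∞} : ContDiff ℝ n (kerP d ε) :=
  contDiff_const.mul (phi_contDiff hε _)

lemma dd_ker1 {ε : ℝ} (hε : 0 < ε) (i j : Fin d) : dd j (ker1 ε i) = ker2 ε i j := by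
  funext x
  unfold ker1
  rw [dd_mul (contDiff_coord i) (phi_contDiff hε d), dd_coord, dd_phi hε]
  unfold ker2
  ring

lemma ker2_symm (ε : ℝ) (i j : Fin d) : ker2 ε i j = ker2 ε j i := by
  funext x
  unfold ker2
  simp only [eq_comm (a := i) (b := j)]
  ring

lemma sum_ker2 {ε : ℝ} (hε : 0 < ε) (x : Euc d) : ∑ k, ker2 ε k k x = kerP d ε x := by
  have hs := sreg_pos hε x
  have h1 : phi ε d x = sreg ε x ^ 2 * phi ε (d + 2) x := by
    unfold phi; field_simp; ring
  have h2 : ∑ k, x k * x k = ‖x‖ ^ 2 := by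
    rw [EuclideanSpace.norm_sq_eq]; simp [sq]
  unfold ker2 kerP
  rw [Finset.sum_sub_distrib, ← Finset.mul_sum, ← Finset.sum_mul, ← Finset.sum_mul, h2]
  simp only [if_true, Finset.sum_const, Finset.card_univ, Fintype.card_fin, nsmul_eq_mul]
  rw [h1, sreg_sq]; ring

lemma dd_ker2 {ε : ℝ} (hε : 0 < ε) (i j k : Fin d) (x : Euc d) : dd k (ker2 ε i j) x =
    - d * ((if i = j then 1 else 0) * x k + (if i = k then 1 else 0) * x j
      + (if j = k then 1 else 0) * x i) * phi ε (d + 2) x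
    + d * (d + 2) * (x i * x j * x k) * phi ε (d + 4) x := by
  unfold ker2
  have c1 := contDiff_coord (d := d) (n := 1) i
  have c2 := contDiff_coord (d := d) (n := 1) j
  rw [dd_sub (contDiff_const.mul (phi_contDiff hε d))
    (contDiff_const.mul ((c1.mul c2).mul (phi_contDiff hε _))),
    dd_const_mul (phi_contDiff hε d), dd_const_mul ((c1.mul c2).mul (phi_contDiff hε _)),
    dd_mul (c1.mul c2) (phi_contDiff hε _), dd_mul c1 c2, dd_coord, dd_coord, dd_phi hε,
    dd_phi hε]
  push_cast
  ring

lemma dd_ker2_symm {ε : ℝ} (hε : 0 < ε) (i j k : Fin d) :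
    dd k (ker2 ε i j) = dd i (ker2 ε k j) := by
  funext x
  rw [dd_ker2 hε, dd_ker2 hε]
  simp only [eq_comm (a := k) (b := j), eq_comm (a := k) (b := i), eq_comm (a := i) (b := j)]
  ring

lemma phi_mul_sreg {ε : ℝ} (hε : 0 < ε) (m : ℕ) (x : Euc d) :
    phi ε m x = sreg ε x * phi ε (m + 1) x := by
  have hs := sreg_pos hε x
  unfold phi; field_simp; ring

lemma abs_ker1_le {ε : ℝ} (hε : 0 < ε) (hd : 1 ≤ d) (i : Fin d) (x : Euc d) :
    |ker1 ε i x| ≤ phi ε (d - 1) x := by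
  obtain ⟨m, rfl⟩ : ∃ m, d = m + 1 := ⟨d - 1, by omega⟩
  unfold ker1
  rw [abs_mul, abs_of_pos (phi_pos hε _ _), Nat.add_sub_cancel, phi_mul_sreg hε m]
  exact mul_le_mul_of_nonneg_right ((abs_coord_le x i).trans (norm_le_sreg ε x))
    (phi_pos hε _ _).le

lemma abs_ker2_le {ε : ℝ} (hε : 0 < ε) (i j : Fin d) (x : Euc d) :
    |ker2 ε i j x| ≤ (1 + d) * phi ε d x := by
  have hi := (abs_coord_le x i).trans (norm_le_sreg ε x)
  have hj := (abs_coord_le x j).trans (norm_le_sreg ε x)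
  have h0 := phi_pos hε (d + 2) x
  have h1 : phi ε d x = sreg ε x * sreg ε x * phi ε (d + 2) x := by
    rw [phi_mul_sreg hε, phi_mul_sreg hε]; ring
  unfold ker2
  refine (abs_sub _ _).trans ?_
  rw [abs_mul, abs_mul, abs_mul, abs_mul, abs_of_pos (phi_pos hε _ _), abs_of_pos h0,
    Nat.abs_cast]
  have h2 : |(if i = j then (1 : ℝ) else 0)| ≤ 1 := by split_ifs <;> simp
  have h3 : |x i| * |x j| * phi ε (d + 2) x ≤ phi ε d x := by
    rw [h1]; gcongr; exact (sreg_pos hε x).le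
  have h4 := phi_pos hε d x
  nlinarith [mul_le_mul_of_nonneg_right h2 h4.le, mul_le_mul_of_nonneg_left h3 (Nat.cast_nonneg (α := ℝ) d)]

lemma abs_dd_ker2_le {ε : ℝ} (hε : 0 < ε) (i j k : Fin d) (x : Euc d) :
    |dd k (ker2 ε i j) x| ≤ (d * 3 + d * (d + 2)) * phi ε (d + 1) x := by
  have hs := (sreg_pos hε x).le
  have h0 := phi_pos hε (d + 2) x
  have h0' := phi_pos hε (d + 4) x
  have hb : ∀ l, |x l| ≤ sreg ε x := fun l => (abs_coord_le x l).trans (norm_le_sreg ε x)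
  have h1 : phi ε (d + 1) x = sreg ε x * phi ε (d + 2) x := phi_mul_sreg hε _ _
  have h1' : phi ε (d + 1) x = sreg ε x * sreg ε x * sreg ε x * phi ε (d + 4) x := by
    rw [phi_mul_sreg hε, phi_mul_sreg hε, phi_mul_sreg hε]; ring
  rw [dd_ker2 hε]
  have e : ∀ a b l : Fin d, |(if a = b then (1 : ℝ) else 0) * x l| ≤ sreg ε x := by
    intro a b l
    split_ifs
    · simpa using hb l
    · simpa using hs
  refine (abs_add_le _ _).trans ?_
  rw [add_mul]
  apply add_le_add
  · rw [abs_mul, abs_mul, abs_of_pos h0, abs_neg, Nat.abs_cast, h1, mul_assoc, mul_assoc (d : ℝ)]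
    apply mul_le_mul_of_nonneg_left _ (Nat.cast_nonneg d)
    rw [← mul_assoc]
    apply mul_le_mul_of_nonneg_right _ h0.le
    refine (abs_add_le _ _).trans ?_
    refine (add_le_add (abs_add_le _ _) le_rfl).trans ?_
    linarith [e i j k, e i k j, e j k i]
  · rw [abs_mul, abs_mul, abs_of_pos h0', h1', abs_of_nonneg (by positivity : (0:ℝ) ≤ d * (d + 2)),
      mul_assoc (_ * _ : ℝ)]
    apply mul_le_mul_of_nonneg_left _ (by positivity)
    apply mul_le_mul_of_nonneg_right _ h0'.le
    rw [abs_mul, abs_mul]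
    gcongr <;> apply hb

/-- Polynomially decaying weight. -/
def jap (m : ℕ) (x : Euc d) : ℝ := ((1 + ‖x‖) ^ m)⁻¹

lemma jap_pos (m : ℕ) (x : Euc d) : 0 < jap m x := by unfold jap; positivity

lemma jap_mul (m n : ℕ) (x : Euc d) : jap m x * jap n x = jap (m + n) x := by
  unfold jap; rw [← mul_inv, pow_add]

lemma integrable_jap {m : ℕ} (hm : d < m) : Integrable (jap m : Euc d → ℝ) := by
  have := integrable_one_add_norm (E := Euc d) (μ := volume) (r := m)
    (by simpa using hm)
  refine this.congr (Filter.Eventually.of_forall fun x => ?_)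
  simp only [jap]
  rw [Real.rpow_neg (by positivity), Real.rpow_natCast]

lemma integrable_of_le_jap {f : Euc d → ℝ} (hf : Continuous f) {m : ℕ} (hm : d < m) {A : ℝ}
    (h : ∀ x, |f x| ≤ A * jap m x) : Integrable f :=
  ((integrable_jap hm).const_mul A).mono' hf.aestronglyMeasurable (Filter.Eventually.of_forall h)

lemma exists_phi_le_jap {ε : ℝ} (hε : 0 < ε) (m : ℕ) :
    ∃ A, 0 ≤ A ∧ ∀ x : Euc d, phi ε m x ≤ A * jap m x := by
  refine ⟨((min 1 ε / 2) ^ m)⁻¹, by positivity, fun x => ?_⟩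
  unfold phi jap
  rw [← mul_inv, ← mul_pow]
  have h1 := norm_le_sreg ε x
  have h2 : ε ≤ sreg ε x := Real.le_sqrt_of_sq_le (by nlinarith [sq_nonneg ‖x‖])
  have h3 : min 1 ε / 2 * (1 + ‖x‖) ≤ sreg ε x := by
    nlinarith [min_le_left 1 ε, min_le_right 1 ε, norm_nonneg x, lt_min one_pos hε]
  have : 0 < min 1 ε := lt_min one_pos hε
  gcongr

lemma exists_conv_le_jap {k h : Euc d → ℝ} {m : ℕ} (hh : Continuous h)
    (hc : HasCompactSupport h) (hk : ∃ A, 0 ≤ A ∧ ∀ x, |k x| ≤ A * jap m x) :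
    ∃ A, 0 ≤ A ∧ ∀ x, |conv k h x| ≤ A * jap m x := by
  obtain ⟨A, hA, hk⟩ := hk
  refine ⟨A * ∫ t, (1 + ‖t‖) ^ m * |h t|, ?_, fun x => ?_⟩
  · exact mul_nonneg hA (integral_nonneg fun t => by positivity)
  have hi : Integrable fun t => (1 + ‖t‖) ^ m * |h t| := by
    apply Continuous.integrable_of_hasCompactSupport
    · fun_prop
    · exact HasCompactSupport.mul_left hc.norm
  rw [conv_swap]
  calc |∫ t, k (x - t) * h t| ≤ ∫ t, A * jap m x * ((1 + ‖t‖) ^ m * |h t|) := by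
        rw [← Real.norm_eq_abs]
        apply norm_integral_le_of_norm_le (hi.const_mul _)
        refine Filter.Eventually.of_forall fun t => ?_
        rw [Real.norm_eq_abs, abs_mul]
        have h1 : jap m (x - t) ≤ jap m x * (1 + ‖t‖) ^ m := by
          unfold jap
          rw [inv_mul_eq_div, inv_le_comm₀ (by positivity) (by positivity), inv_div,
            div_le_iff₀ (by positivity), ← mul_pow]
          have := norm_sub_norm_le x t
          gcongr
          nlinarith [norm_nonneg t, norm_nonneg (x - t)]
        calc |k (x - t)| * |h t| ≤ A * jap m (x - t) * |h t| := by gcongr; exact hk _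
          _ ≤ A * (jap m x * (1 + ‖t‖) ^ m) * |h t| := by gcongr
          _ = _ := by ring
    _ = _ := by rw [integral_const_mul]; ring

/-- The total mass of `kerP`. -/
def massP (d : ℕ) : ℝ := ∫ x, kerP d 1 x

lemma kerP_nonneg {ε : ℝ} (hε : 0 < ε) (x : Euc d) : 0 ≤ kerP d ε x := by
  have := phi_pos hε (d + 2) x
  unfold kerP; positivity

lemma kerP_integrable {ε : ℝ} (hε : 0 < ε) : Integrable (kerP d ε) := by
  obtain ⟨A, hA, h⟩ := exists_phi_le_jap (d := d) hε (d + 2)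
  refine integrable_of_le_jap (kerP_contDiff hε (n := 1)).continuous (m := d + 2) (by omega)
    (A := d * ε ^ 2 * A) fun x => ?_
  rw [abs_of_nonneg (kerP_nonneg hε x)]
  unfold kerP
  rw [mul_assoc _ A]
  gcongr; exact h x

lemma kerP_scale {ε : ℝ} (hε : 0 < ε) (x : Euc d) :
    kerP d ε x = (ε⁻¹) ^ d * kerP d 1 (ε⁻¹ • x) := by
  have h : sreg 1 (ε⁻¹ • x) = ε⁻¹ * sreg ε x := by
    unfold sreg
    rw [norm_smul, ← Real.sqrt_sq (inv_pos.2 hε).le, ← Real.sqrt_mul (by positivity)]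
    congr 1
    rw [Real.sqrt_sq (inv_pos.2 hε).le]
    simp only [norm_inv, Real.norm_eq_abs, abs_of_pos hε]
    field_simp
  have := sreg_pos hε x
  unfold kerP phi
  rw [h, mul_pow, pow_add ε⁻¹]
  field_simp

lemma integral_kerP {ε : ℝ} (hε : 0 < ε) : ∫ x, kerP d ε x = massP d := by
  simp_rw [kerP_scale hε]
  rw [integral_const_mul, Measure.integral_comp_smul, massP, smul_eq_mul, ← mul_assoc]
  have : 0 < (ε⁻¹) ^ d := by positivity
  rw [finrank_euclideanSpace, Fintype.card_fin, abs_of_pos (inv_pos.2 this),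
    mul_inv_cancel₀ this.ne', one_mul]

lemma massP_pos (hd : 1 ≤ d) : 0 < massP d := by
  unfold massP
  rw [integral_pos_iff_support_of_nonneg (kerP_nonneg one_pos) (kerP_integrable one_pos)]
  have : Function.support (kerP d 1) = Set.univ := by
    ext x
    have h := phi_pos one_pos (d + 2) x
    have hd' : (0 : ℝ) < d := by exact_mod_cast hd
    simp only [Function.mem_support, Set.mem_univ, iff_true]
    unfold kerP; positivity
  rw [this]
  exact isOpen_univ.measure_pos _ Set.univ_nonempty

lemma conv_sq_le {P h : Euc d → ℝ} (hP : Continuous P) (hP0 : ∀ x, 0 ≤ P x) (hPi : Integrable P)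
    (hh : Continuous h) (hc : HasCompactSupport h) (x : Euc d) :
    conv P h x ^ 2 ≤ (∫ y, P y) * conv P (fun y => h y ^ 2) x := by
  have hc2 : HasCompactSupport (fun y => h y ^ 2) := by
    simpa only [sq] using! hc.mul_left (f := h)
  have i1 := conv_integrable hP hh hc x
  have i2 : Integrable (fun t => P t * (fun y => h y ^ 2) (x - t)) :=
    conv_integrable hP (hh.pow 2) hc2 x
  have key : ∀ m : ℝ, 0 ≤ conv P (fun y => h y ^ 2) x - 2 * m * conv P h x + m ^ 2 * ∫ y, P y := by
    intro m
    have : conv P (fun y => h y ^ 2) x - 2 * m * conv P h x + m ^ 2 * ∫ y, P y =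
        ∫ t, P t * (h (x - t) - m) ^ 2 := by
      unfold conv
      rw [← integral_const_mul, ← integral_const_mul, ← integral_sub i2 (i1.const_mul _),
        ← integral_add (f := fun t => P t * (fun y => h y ^ 2) (x - t) - 2 * m * (P t * h (x - t)))
          (i2.sub (i1.const_mul _)) (hPi.const_mul _)]
      congr 1; ext t; ring
    rw [this]
    exact integral_nonneg fun t => mul_nonneg (hP0 t) (sq_nonneg _)
  have h0 : 0 ≤ ∫ y, P y := integral_nonneg hP0
  set M := ∫ y, P y
  set B := conv P h x
  set D := conv P (fun y => h y ^ 2) x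
  rcases h0.eq_or_lt with hM | hM
  · have hB : B = 0 := by
      by_contra hB
      have k1 := key ((D + 1) / (2 * B))
      rw [← hM] at k1
      have : 2 * ((D + 1) / (2 * B)) * B = D + 1 := by field_simp
      nlinarith
    rw [hB, ← hM]; simp
  · have k1 := key (B / M)
    have e : D - 2 * (B / M) * B + (B / M) ^ 2 * M = (M * D - B ^ 2) / M := by field_simp; ring
    rw [e] at k1
    have := (div_nonneg_iff.1 k1)
    rcases this with h | h <;> nlinarith [h.1, h.2]

lemma integral_conv_sq_le {P h : Euc d → ℝ} (hP : Continuous P) (hP0 : ∀ x, 0 ≤ P x)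
    (hPi : Integrable P) (hh : Continuous h) (hc : HasCompactSupport h) :
    ∫ x, conv P h x ^ 2 ≤ (∫ y, P y) ^ 2 * ∫ x, h x ^ 2 := by
  have hc2 : HasCompactSupport (fun y => h y ^ 2) := by
    simpa only [sq] using! hc.mul_left (f := h)
  have hi2 : Integrable (fun y => h y ^ 2) := (hh.pow 2).integrable_of_hasCompactSupport hc2
  have hci : Integrable (conv P (fun y => h y ^ 2)) :=
    hPi.integrable_convolution (ContinuousLinearMap.mul ℝ ℝ) hi2
  have e : ∫ x, conv P (fun y => h y ^ 2) x = (∫ y, P y) * ∫ x, h x ^ 2 :=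
    integral_convolution (ContinuousLinearMap.mul ℝ ℝ) hPi hi2
  calc ∫ x, conv P h x ^ 2 ≤ ∫ x, (∫ y, P y) * conv P (fun y => h y ^ 2) x :=
        integral_mono_of_nonneg (Filter.Eventually.of_forall fun x => sq_nonneg _)
          (hci.const_mul _)
          (Filter.Eventually.of_forall fun x => conv_sq_le hP hP0 hPi hh hc x)
    _ = _ := by rw [integral_const_mul, e]; ring

lemma ker2_decay {ε : ℝ} (hε : 0 < ε) (i j : Fin d) :
    ∃ A, 0 ≤ A ∧ ∀ x, |ker2 ε i j x| ≤ A * jap d x := by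
  obtain ⟨A, hA, h⟩ := exists_phi_le_jap (d := d) hε d
  refine ⟨(1 + d) * A, by positivity, fun x => (abs_ker2_le hε i j x).trans ?_⟩
  rw [mul_assoc]
  gcongr; exact h x

lemma integrable_mul_of_jap {f g : Euc d → ℝ} (hf : Continuous f) (hg : Continuous g) {m n : ℕ}
    (hm : d < m + n) (h1 : ∃ A, 0 ≤ A ∧ ∀ x, |f x| ≤ A * jap m x)
    (h2 : ∃ A, 0 ≤ A ∧ ∀ x, |g x| ≤ A * jap n x) : Integrable (fun x => f x * g x) := by
  obtain ⟨A, hA, h1⟩ := h1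
  obtain ⟨B, hB, h2⟩ := h2
  refine integrable_of_le_jap (hf.mul hg) hm (A := A * B) fun x => ?_
  rw [abs_mul, ← jap_mul]
  calc |f x| * |g x| ≤ (A * jap m x) * (B * jap n x) := by
        gcongr
        · exact mul_nonneg hA (jap_pos _ _).le
        · exact h1 x
        · exact h2 x
    _ = _ := by ring

lemma integrable_conv_ker2_mul (hd : 1 ≤ d) {ε : ℝ} (hε : 0 < ε) {h h' : Euc d → ℝ}
    (hh : Continuous h) (hc : HasCompactSupport h) (hh' : Continuous h')
    (hc' : HasCompactSupport h') (i j k l : Fin d) :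
    Integrable (fun x => conv (ker2 ε i j) h x * conv (ker2 ε k l) h' x) :=
  integrable_mul_of_jap (conv_continuous (ker2_contDiff hε i j (n := 0)).continuous hh hc)
    (conv_continuous (ker2_contDiff hε k l (n := 0)).continuous hh' hc')
    (by omega) (exists_conv_le_jap hh hc (ker2_decay hε i j))
    (exists_conv_le_jap hh' hc' (ker2_decay hε k l))

lemma integral_ker2_conv_cross (hd : 2 ≤ d) {ε : ℝ} (hε : 0 < ε) {h : Euc d → ℝ}
    (hh : ContDiff ℝ 2 h) (hc : HasCompactSupport h) (i j : Fin d) :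
    ∫ x, conv (ker2 ε i j) h x ^ 2 = ∫ x, conv (ker2 ε i i) h x * conv (ker2 ε j j) h x := by
  have hh1 : ContDiff ℝ 1 h := hh.of_le (by norm_num)
  have hk1 : ∀ a : Fin d, Continuous (ker1 ε a) := fun a => (ker1_contDiff hε a (n := 0)).continuous
  have hk2 : ∀ a b : Fin d, Continuous (ker2 ε a b) :=
    fun a b => (ker2_contDiff hε a b (n := 0)).continuous
  have e1 : ∀ a b : Fin d, dd b (conv (ker1 ε a) h) = conv (ker2 ε a b) h := by
    intro a b
    rw [dd_conv (hk1 a) hh1 hc, conv_dd (ker1_contDiff hε a) hh1 hc, dd_ker1 hε]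
  have e2 : ∀ a b c : Fin d, dd c (conv (ker2 ε a b) h) = conv (ker2 ε a b) (dd c h) :=
    fun a b c => dd_conv (hk2 a b) hh1 hc c
  have dec1 : ∃ A, 0 ≤ A ∧ ∀ x, |ker1 ε i x| ≤ A * jap (d - 1) x := by
    obtain ⟨A, hA, h⟩ := exists_phi_le_jap (d := d) hε (d - 1)
    exact ⟨A, hA, fun x => (abs_ker1_le hε (by omega) i x).trans (h x)⟩
  have key : ∀ b c : Fin d, ∫ x, conv (ker1 ε i) h x * dd b (conv (ker2 ε j c) h) x =
      - ∫ x, conv (ker2 ε i b) h x * conv (ker2 ε j c) h x := by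
    intro b c
    rw [integral_mul_dd (conv_contDiff (n := 1) (hk1 i) hh1 hc)
      (conv_contDiff (n := 1) (hk2 j c) hh1 hc), e1]
    · rw [e1]
      exact integrable_conv_ker2_mul (by omega) hε hh.continuous hc hh.continuous hc _ _ _ _
    · rw [e2]
      exact integrable_mul_of_jap (m := d - 1) (n := d) (conv_continuous (hk1 i) hh.continuous hc)
        (conv_continuous (hk2 _ _) (dd_continuous hh1 b) (dd_hasCompactSupport hc b)) (by omega)
        (exists_conv_le_jap hh.continuous hc dec1)
        (exists_conv_le_jap (dd_continuous hh1 b) (dd_hasCompactSupport hc b) (ker2_decay hε _ _))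
    · exact integrable_mul_of_jap (m := d - 1) (n := d) (conv_continuous (hk1 i) hh.continuous hc)
        (conv_continuous (hk2 _ _) hh.continuous hc) (by omega)
        (exists_conv_le_jap hh.continuous hc dec1)
        (exists_conv_le_jap hh.continuous hc (ker2_decay hε _ _))
  have k1 := key j i
  have k2 := key i j
  have sw : dd j (conv (ker2 ε j i) h) = dd i (conv (ker2 ε j j) h) := by
    rw [← e1 j i, ← e1 j j]
    exact dd_comm (conv_contDiff (n := 2) (hk1 j) hh hc) j i
  rw [sw, k2] at k1
  rw [neg_inj] at k1
  rw [k1]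
  congr 1; ext x
  rw [ker2_symm ε j i, sq]

lemma integral_ker2_conv_sq_le_of_smooth (hd : 1 ≤ d) {ε : ℝ} (hε : 0 < ε) {h : Euc d → ℝ}
    (hh : ContDiff ℝ 2 h) (hc : HasCompactSupport h) (i j : Fin d) :
    ∫ x, conv (ker2 ε i j) h x ^ 2 ≤ massP d ^ 2 * ∫ x, h x ^ 2 := by
  have hP := integral_conv_sq_le (kerP_contDiff hε (n := 0)).continuous (kerP_nonneg hε)
    (kerP_integrable hε) hh.continuous hc
  rw [integral_kerP hε] at hP
  refine le_trans ?_ hP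
  have hs : ∀ x, conv (kerP d ε) h x = ∑ k, conv (ker2 ε k k) h x := by
    intro x
    rw [← conv_sum_left _ (fun k => (ker2_contDiff hε k k (n := 0)).continuous) hh.continuous hc]
    congr 1; ext y; exact (sum_ker2 hε y).symm
  have hint := integrable_conv_ker2_mul hd hε hh.continuous hc hh.continuous hc
  rcases Nat.lt_or_ge 1 d with h2 | h2
  · have e : ∫ x, conv (kerP d ε) h x ^ 2 = ∑ a, ∑ b, ∫ x, conv (ker2 ε a b) h x ^ 2 := by
      simp_rw [integral_ker2_conv_cross h2 hε hh hc, hs, sq, Finset.sum_mul_sum]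
      rw [integral_finsetSum _ (fun a _ => integrable_finsetSum _ fun b _ => hint a a b b)]
      refine Finset.sum_congr rfl fun a _ => ?_
      rw [integral_finsetSum _ (fun b _ => hint a a b b)]
    rw [e]
    have h0 : ∀ a b : Fin d, 0 ≤ ∫ x, conv (ker2 ε a b) h x ^ 2 :=
      fun a b => integral_nonneg fun x => sq_nonneg _
    exact (Finset.single_le_sum (f := fun b => ∫ x, conv (ker2 ε i b) h x ^ 2)
      (fun b _ => h0 i b) (Finset.mem_univ j)).trans
      (Finset.single_le_sum (f := fun a => ∑ b, ∫ x, conv (ker2 ε a b) h x ^ 2)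
        (fun a _ => Finset.sum_nonneg fun b _ => h0 a b) (Finset.mem_univ i))
  · obtain rfl : d = 1 := by omega
    apply le_of_eq
    congr 1; ext x
    rw [hs, Fin.sum_univ_one, Subsingleton.elim i 0, Subsingleton.elim j 0]

lemma exists_mollification {h : Euc d → ℝ} (hh : Continuous h) (hc : HasCompactSupport h) :
    ∃ (hn : ℕ → Euc d → ℝ) (R M : ℝ), (∀ n, ContDiff ℝ 2 (hn n)) ∧ (∀ n x, |hn n x| ≤ M) ∧
      (∀ n x, R < ‖x‖ → hn n x = 0) ∧ (∀ x, R < ‖x‖ → h x = 0) ∧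
      ∀ x, Filter.Tendsto (fun n => hn n x) Filter.atTop (nhds (h x)) := by
  let φ : ℕ → ContDiffBump (0 : Euc d) := fun n =>
    { rIn := 1 / ((n : ℝ) + 2), rOut := 1 / ((n : ℝ) + 1), rIn_pos := by positivity,
      rIn_lt_rOut := one_div_lt_one_div_of_lt (by positivity) (by linarith) }
  obtain ⟨M, hM⟩ := hc.exists_bound_of_continuous hh
  obtain ⟨R, hR⟩ := hc.isCompact.isBounded.subset_closedBall 0
  refine ⟨fun n => convolution ((φ n).normed volume) h (ContinuousLinearMap.lsmul ℝ ℝ) volume,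
    R + 1, M, fun n => ?_, fun n x => ?_, fun n x hx => ?_, fun x hx => ?_, fun x => ?_⟩
  · exact (φ n).hasCompactSupport_normed.contDiff_convolution_left _ (φ n).contDiff_normed
      hh.locallyIntegrable
  · unfold convolution
    rw [← Real.norm_eq_abs]
    have : ∫ t, (φ n).normed volume t * M = M := by
      rw [integral_mul_const, (φ n).integral_normed, one_mul]
    rw [← this]
    apply norm_integral_le_of_norm_le
    · exact (φ n).integrable_normed.mul_const _
    · refine Filter.Eventually.of_forall fun t => ?_
      simp only [ContinuousLinearMap.lsmul_apply, smul_eq_mul, norm_mul]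
      rw [Real.norm_of_nonneg ((φ n).nonneg_normed t)]
      exact mul_le_mul_of_nonneg_left (hM _) ((φ n).nonneg_normed t)
  · unfold convolution
    refine integral_eq_zero_of_ae ?_
    refine Filter.Eventually.of_forall fun t => ?_
    simp only [ContinuousLinearMap.lsmul_apply, smul_eq_mul, Pi.zero_apply, mul_eq_zero]
    by_cases ht : t ∈ ball (0 : Euc d) (φ n).rOut
    · right
      apply image_eq_zero_of_notMem_tsupport
      intro hmem
      have h1 := hR hmem
      have h2 : (φ n).rOut ≤ 1 := by
        change 1 / ((n : ℝ) + 1) ≤ 1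
        rw [div_le_one (by positivity)]
        have : (0 : ℝ) ≤ n := n.cast_nonneg
        linarith
      simp only [mem_closedBall, dist_zero_right, mem_ball] at h1 ht
      have := norm_sub_norm_le x t
      linarith
    · left
      rw [← Function.notMem_support, (φ n).support_normed_eq]
      exact ht
  · apply image_eq_zero_of_notMem_tsupport
    intro hmem
    have h1 := hR hmem
    simp only [mem_closedBall, dist_zero_right] at h1
    linarith
  · refine ContDiffBump.convolution_tendsto_right_of_continuous ?_ hh x
    exact tendsto_one_div_add_atTop_nhds_zero_nat

lemma lintegral_ofReal_le_of_tendsto {α : Type*} [MeasurableSpace α] {μ : Measure α}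
    {f : ℕ → α → ℝ} {g : α → ℝ} {c : ℕ → ENNReal} {c' : ENNReal} (hf : ∀ n, Measurable (f n))
    (hg : ∀ x, Filter.Tendsto (fun n => f n x) Filter.atTop (nhds (g x)))
    (hc : Filter.Tendsto c Filter.atTop (nhds c'))
    (h : ∀ n, ∫⁻ x, ENNReal.ofReal (f n x) ∂μ ≤ c n) :
    ∫⁻ x, ENNReal.ofReal (g x) ∂μ ≤ c' := by
  have h1 : ∀ x, ENNReal.ofReal (g x) =
      Filter.liminf (fun n => ENNReal.ofReal (f n x)) Filter.atTop := fun x =>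
    ((ENNReal.continuous_ofReal.tendsto _).comp (hg x)).liminf_eq.symm
  simp_rw [h1]
  refine (lintegral_liminf_le fun n => (hf n).ennreal_ofReal).trans ?_
  rw [← hc.liminf_eq]
  exact Filter.liminf_le_liminf (Filter.Eventually.of_forall h)

lemma integrable_ker2_conv_sq (hd : 1 ≤ d) {ε : ℝ} (hε : 0 < ε) {h : Euc d → ℝ}
    (hh : Continuous h) (hc : HasCompactSupport h) (i j : Fin d) :
    Integrable (fun x => conv (ker2 ε i j) h x ^ 2) := by
  simp only [sq]
  exact integrable_conv_ker2_mul hd hε hh hc hh hc _ _ _ _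

lemma ker2_continuous {ε : ℝ} (hε : 0 < ε) (i j : Fin d) : Continuous (ker2 ε i j) :=
  (ker2_contDiff hε i j (n := 0)).continuous

lemma integral_ker2_conv_sq_le (hd : 1 ≤ d) {ε : ℝ} (hε : 0 < ε) {h : Euc d → ℝ}
    (hh : Continuous h) (hc : HasCompactSupport h) (i j : Fin d) :
    ∫ x, conv (ker2 ε i j) h x ^ 2 ≤ massP d ^ 2 * ∫ x, h x ^ 2 := by
  obtain ⟨hn, R, M, h1, h2, h3, h4, h5⟩ := exists_mollification hh hc
  have hcn : ∀ n, HasCompactSupport (hn n) := fun n =>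
    HasCompactSupport.intro (isCompact_closedBall (0 : Euc d) R) fun x hx => h3 n x (by
      simpa using hx)
  have hK := ker2_continuous hε i j
  have hlim : ∀ x, Filter.Tendsto (fun n => conv (ker2 ε i j) (hn n) x ^ 2) Filter.atTop
      (nhds (conv (ker2 ε i j) h x ^ 2)) := by
    intro x
    apply Filter.Tendsto.pow
    simp_rw [conv_swap]
    apply tendsto_integral_of_dominated_convergence
      ((closedBall (0 : Euc d) R).indicator fun t => |ker2 ε i j (x - t)| * M)
    · intro n
      exact ((hK.comp (by fun_prop)).mul (h1 n).continuous).aestronglyMeasurable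
    · rw [integrable_indicator_iff measurableSet_closedBall]
      apply ContinuousOn.integrableOn_compact (isCompact_closedBall _ _)
      have : Continuous fun t => ker2 ε i j (x - t) := hK.comp (by fun_prop)
      fun_prop
    · intro n
      refine Filter.Eventually.of_forall fun t => ?_
      rw [Real.norm_eq_abs, abs_mul]
      by_cases ht : t ∈ closedBall (0 : Euc d) R
      · rw [Set.indicator_of_mem ht]
        exact mul_le_mul_of_nonneg_left (h2 n t) (abs_nonneg _)
      · rw [Set.indicator_of_notMem ht, h3 n t (by simpa using ht)]
        simp
    · exact Filter.Eventually.of_forall fun t => (h5 t).const_mul _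
  have hsq : Filter.Tendsto (fun n => ∫ x, hn n x ^ 2) Filter.atTop (nhds (∫ x, h x ^ 2)) := by
    apply tendsto_integral_of_dominated_convergence
      ((closedBall (0 : Euc d) R).indicator fun t => M ^ 2)
    · intro n
      exact ((h1 n).continuous.pow 2).aestronglyMeasurable
    · rw [integrable_indicator_iff measurableSet_closedBall]
      exact integrableOn_const (by exact (measure_closedBall_lt_top).ne)
    · intro n
      refine Filter.Eventually.of_forall fun t => ?_
      rw [Real.norm_eq_abs, abs_pow]
      by_cases ht : t ∈ closedBall (0 : Euc d) R
      · rw [Set.indicator_of_mem ht]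
        exact pow_le_pow_left₀ (abs_nonneg _) (h2 n t) 2
      · rw [Set.indicator_of_notMem ht, h3 n t (by simpa using ht)]
        simp
    · exact Filter.Eventually.of_forall fun t => (h5 t).pow 2
  have hfin := lintegral_ofReal_le_of_tendsto (μ := volume)
    (fun n => ((conv_continuous hK (h1 n).continuous (hcn n)).pow 2).measurable) hlim
    ((ENNReal.continuous_ofReal.tendsto _).comp (hsq.const_mul (massP d ^ 2)))
    (fun n => by
      simp only [Pi.pow_apply]
      rw [← ofReal_integral_eq_lintegral_ofReal
        (integrable_ker2_conv_sq hd hε (h1 n).continuous (hcn n) i j)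
        (Filter.Eventually.of_forall fun x => sq_nonneg _)]
      exact ENNReal.ofReal_le_ofReal
        (integral_ker2_conv_sq_le_of_smooth hd hε (h1 n) (hcn n) i j))
  rw [← ofReal_integral_eq_lintegral_ofReal (integrable_ker2_conv_sq hd hε hh hc i j)
        (Filter.Eventually.of_forall fun x => sq_nonneg _)] at hfin
  refine (ENNReal.ofReal_le_ofReal_iff ?_).1 hfin
  exact mul_nonneg (sq_nonneg _) (integral_nonneg fun x => sq_nonneg _)

/-- The Laplacian. -/
def lap (u : Euc d → ℝ) (x : Euc d) : ℝ := ∑ k, dd k (dd k u) x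

lemma lap_continuous {u : Euc d → ℝ} (hu : ContDiff ℝ 2 u) : Continuous (lap u) :=
  continuous_finsetSum _ fun k _ => dd_continuous (dd_contDiff (n := 2) (m := 1) hu (by norm_num) k) k

lemma lap_hasCompactSupport {u : Euc d → ℝ} (hc : HasCompactSupport u) :
    HasCompactSupport (lap u) := by
  refine HasCompactSupport.intro hc.isCompact fun x hx => ?_
  refine Finset.sum_eq_zero fun k _ => ?_
  apply image_eq_zero_of_notMem_tsupport
  intro h
  apply hx
  exact (tsupport_fderiv_apply_subset ℝ _).trans (tsupport_fderiv_apply_subset ℝ _) h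

lemma conv_ker2_lap {ε : ℝ} (hε : 0 < ε) {u : Euc d → ℝ} (hu : ContDiff ℝ 2 u)
    (hc : HasCompactSupport u) (i j : Fin d) :
    conv (ker2 ε i j) (lap u) = conv (kerP d ε) (dd j (dd i u)) := by
  have h1 : ∀ k, ContDiff ℝ 1 (dd k u) := fun k => dd_contDiff (n := 2) (m := 1) hu (by norm_num) k
  have c1 : ∀ k, HasCompactSupport (dd k u) := fun k => dd_hasCompactSupport hc k
  have h2 : ∀ k l, Continuous (dd k (dd l u)) := fun k l => dd_continuous (h1 l) k
  have c2 : ∀ k l, HasCompactSupport (dd k (dd l u)) := fun k l => dd_hasCompactSupport (c1 l) k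
  have hK : ∀ a b : Fin d, ContDiff ℝ 1 (ker2 ε a b) := fun a b => ker2_contDiff hε a b
  have step : ∀ k, conv (ker2 ε i j) (dd k (dd k u)) = conv (ker2 ε k k) (dd j (dd i u)) := by
    intro k
    rw [conv_dd (hK i j) (h1 k) (c1 k), dd_ker2_symm hε i j k, ← conv_dd (hK k j) (h1 k) (c1 k),
      dd_comm hu i k, conv_dd (hK k j) (h1 i) (c1 i), ker2_symm ε k j, dd_ker2_symm hε j k k,
      ← conv_dd (hK k k) (h1 i) (c1 i)]
  funext x
  have e : kerP d ε = fun y => ∑ k, ker2 ε k k y := by funext y; exact (sum_ker2 hε y).symm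
  rw [e, conv_sum_left _ (fun k => (hK k k).continuous) (h2 j i) (c2 j i)]
  unfold lap
  rw [conv_sum_right _ (hK i j).continuous (fun k => h2 k k) (fun k => c2 k k)]
  exact Finset.sum_congr rfl fun k _ => congrFun (step k) x

lemma tendsto_conv_kerP {g : Euc d → ℝ} (hg : Continuous g) (hc : HasCompactSupport g)
    (x : Euc d) : Filter.Tendsto (fun n : ℕ => conv (kerP d (1 / ((n : ℝ) + 1))) g x) Filter.atTop
      (nhds (massP d * g x)) := by
  have e : ∀ n : ℕ, conv (kerP d (1 / ((n : ℝ) + 1))) g x =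
      ∫ t, kerP d 1 t * g (x - (1 / ((n : ℝ) + 1)) • t) := by
    intro n
    have hε : 0 < 1 / ((n : ℝ) + 1) := by positivity
    set ε := 1 / ((n : ℝ) + 1)
    have h0 : ∀ t : Euc d, kerP d ε t * g (x - t) =
        (ε⁻¹) ^ d * (fun s => kerP d 1 s * g (x - ε • s)) (ε⁻¹ • t) := by
      intro t
      simp only [smul_smul, mul_inv_cancel₀ hε.ne', one_smul]
      rw [kerP_scale hε]; ring
    unfold conv
    simp_rw [h0]
    have h1 := Measure.integral_comp_smul volume
      (fun s : Euc d => kerP d 1 s * g (x - ε • s)) ε⁻¹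
    rw [integral_const_mul, h1, smul_eq_mul, ← mul_assoc]
    have : 0 < (ε⁻¹) ^ d := by positivity
    rw [finrank_euclideanSpace, Fintype.card_fin, abs_of_pos (inv_pos.2 this),
      mul_inv_cancel₀ this.ne', one_mul]
  simp_rw [e]
  have e2 : massP d * g x = ∫ t, kerP d 1 t * g x := by rw [integral_mul_const, massP]
  rw [e2]
  obtain ⟨M, hM⟩ := hc.exists_bound_of_continuous hg
  apply tendsto_integral_of_dominated_convergence (fun t => kerP d 1 t * M)
  · intro n
    refine ((kerP_contDiff one_pos (n := 0)).continuous.mul ?_).aestronglyMeasurable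
    exact hg.comp (by fun_prop)
  · exact (kerP_integrable one_pos).mul_const _
  · intro n
    refine Filter.Eventually.of_forall fun t => ?_
    rw [norm_mul, Real.norm_of_nonneg (kerP_nonneg one_pos t)]
    exact mul_le_mul_of_nonneg_left (hM _) (kerP_nonneg one_pos t)
  · refine Filter.Eventually.of_forall fun t => ?_
    apply Filter.Tendsto.const_mul
    have h1 : Filter.Tendsto (fun n : ℕ => x - (1 / ((n : ℝ) + 1)) • t) Filter.atTop
        (nhds (x - (0 : ℝ) • t)) :=
      tendsto_const_nhds.sub (tendsto_one_div_add_atTop_nhds_zero_nat.smul_const t)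
    rw [zero_smul, sub_zero] at h1
    exact (hg.tendsto x).comp h1

lemma norm_fderiv_le_sum (f : Euc d → ℝ) (x : Euc d) : ‖fderiv ℝ f x‖ ≤ ∑ i, |dd i f x| := by
  refine ContinuousLinearMap.opNorm_le_bound _ (Finset.sum_nonneg fun _ _ => abs_nonneg _) ?_
  intro y
  have hy : y = ∑ i, y i • EuclideanSpace.single i (1 : ℝ) := by
    ext k
    simp [Finset.sum_apply, Pi.single_apply]
  have h2 : fderiv ℝ f x y = ∑ i, y i * dd i f x := by
    conv_lhs => rw [hy]
    rw [map_sum]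
    simp [dd]
  rw [h2, Finset.sum_mul]
  refine (norm_sum_le _ _).trans (Finset.sum_le_sum fun i _ => ?_)
  rw [norm_mul, Real.norm_eq_abs, Real.norm_eq_abs, mul_comm]
  exact mul_le_mul_of_nonneg_left (abs_coord_le y i) (abs_nonneg _)

lemma phi_le_of_le_norm {ε r : ℝ} (m : ℕ) {x : Euc d} (hr : 0 < r) (h : r ≤ ‖x‖) :
    phi ε m x ≤ (r ^ m)⁻¹ := by
  unfold phi
  have := h.trans (norm_le_sreg ε x)
  gcongr

/-- The constant in the gradient bound of `ker2`. -/
def gradC (d : ℕ) : ℝ := d * (d * 3 + d * (d + 2))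

lemma gradC_nonneg (d : ℕ) : 0 ≤ gradC d := by unfold gradC; positivity

lemma abs_ker2_sub_le {ε : ℝ} (hε : 0 < ε) (i j : Fin d) {x0 x y t : Euc d} {R : ℝ} (hR : 0 < R)
    (hx : x ∈ closedBall x0 R) (hy : y ∈ closedBall x0 R) (ht : 2 * R ≤ ‖t - x0‖) :
    |ker2 ε i j (x - t) - ker2 ε i j (y - t)| ≤
      gradC d * 2 ^ (d + 2) * R * (‖t - x0‖ ^ (d + 1))⁻¹ := by
  have hpos : 0 < ‖t - x0‖ := by linarith
  have hmem : ∀ z ∈ closedBall x0 R, z - t ∈ closedBall (x0 - t) R := by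
    intro z hz
    simpa [dist_eq_norm] using hz
  have hb : ∀ z ∈ closedBall (x0 - t) R, ‖fderiv ℝ (ker2 ε i j) z‖ ≤
      gradC d * 2 ^ (d + 1) * (‖t - x0‖ ^ (d + 1))⁻¹ := by
    intro z hz
    have h1 : ‖t - x0‖ / 2 ≤ ‖z‖ := by
      rw [mem_closedBall, dist_eq_norm] at hz
      have := norm_sub_norm_le (x0 - t) (x0 - t - z)
      have e : x0 - t - (x0 - t - z) = z := by abel
      rw [e, norm_sub_rev x0 t, norm_sub_rev (x0 - t) z] at this
      linarith
    refine (norm_fderiv_le_sum _ _).trans ?_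
    have h2 : ∀ k, |dd k (ker2 ε i j) z| ≤
        (d * 3 + d * (d + 2)) * (2 ^ (d + 1) * (‖t - x0‖ ^ (d + 1))⁻¹) := by
      intro k
      refine (abs_dd_ker2_le hε i j k z).trans ?_
      refine mul_le_mul_of_nonneg_left ?_ (by positivity)
      refine (phi_le_of_le_norm _ (by positivity) h1).trans_eq ?_
      rw [div_pow, inv_div, div_eq_mul_inv]
    refine (Finset.sum_le_sum fun k _ => h2 k).trans_eq ?_
    rw [Finset.sum_const, Finset.card_univ, Fintype.card_fin, nsmul_eq_mul]
    unfold gradC; ring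
  have := (convex_closedBall (x0 - t) R).norm_image_sub_le_of_norm_fderiv_le
    (fun z _ => (ker2_contDiff hε i j (n := 1)).differentiable one_ne_zero z) hb
    (hmem y hy) (hmem x hx)
  rw [Real.norm_eq_abs] at this
  refine this.trans ?_
  have h3 : ‖x - t - (y - t)‖ ≤ 2 * R := by
    rw [sub_sub_sub_cancel_right, ← dist_eq_norm]
    have := dist_triangle_right x y x0
    rw [mem_closedBall] at hx hy
    linarith
  calc _ ≤ gradC d * 2 ^ (d + 1) * (‖t - x0‖ ^ (d + 1))⁻¹ * (2 * R) :=
        mul_le_mul_of_nonneg_left h3 (by have := gradC_nonneg d; positivity)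
    _ = _ := by ring

/-- The volume of the unit ball. -/
def omg (d : ℕ) : ℝ := volume.real (ball (0 : Euc d) 1)

lemma omg_pos (d : ℕ) : 0 < omg d :=
  ENNReal.toReal_pos (measure_ball_pos _ _ one_pos).ne' measure_ball_lt_top.ne

lemma volume_closedBall (x : Euc d) {r : ℝ} (hr : 0 ≤ r) :
    volume (closedBall x r) = ENNReal.ofReal (r ^ d * omg d) := by
  rw [Measure.addHaar_closedBall _ _ hr, finrank_euclideanSpace, Fintype.card_fin,
    ENNReal.ofReal_mul (by positivity), omg, Measure.real, ENNReal.ofReal_toReal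
    measure_ball_lt_top.ne]

lemma volume_real_closedBall (x : Euc d) {r : ℝ} (hr : 0 ≤ r) :
    volume.real (closedBall x r) = r ^ d * omg d := by
  rw [Measure.real, volume_closedBall x hr, ENNReal.toReal_ofReal]
  have := omg_pos d
  positivity

lemma integral_abs_le_of_sq {f : Euc d → ℝ} (hf : Continuous f) {x0 : Euc d} {s a : ℝ}
    (hs : 0 ≤ s) (ha : 0 < a) (h : ∫ x in closedBall x0 s, f x ^ 2 ≤ a ^ 2 * s ^ d) :
    ∫ x in closedBall x0 s, |f x| ≤ (1 + omg d) * a * s ^ d := by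
  have hK := isCompact_closedBall x0 s
  have i1 : IntegrableOn (fun x => a⁻¹ * f x ^ 2) (closedBall x0 s) :=
    (by fun_prop : Continuous fun x => a⁻¹ * f x ^ 2).continuousOn.integrableOn_compact hK
  have i2 : IntegrableOn (fun _ : Euc d => a) (closedBall x0 s) :=
    continuous_const.continuousOn.integrableOn_compact hK
  have h1 : ∫ x in closedBall x0 s, |f x| ≤ ∫ x in closedBall x0 s, (a⁻¹ * f x ^ 2 + a) := by
    refine integral_mono (hf.abs.continuousOn.integrableOn_compact hK) (i1.add i2) fun x => ?_
    change |f x| ≤ a⁻¹ * f x ^ 2 + a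
    rw [← sq_abs, inv_mul_eq_div, div_add' _ _ _ ha.ne', le_div_iff₀ ha]
    nlinarith [sq_nonneg (|f x| - a), abs_nonneg (f x), mul_nonneg (abs_nonneg (f x)) ha.le]
  refine h1.trans ?_
  rw [integral_add i1 i2, integral_const_mul, setIntegral_const, volume_real_closedBall x0 hs,
    smul_eq_mul]
  calc _ ≤ a⁻¹ * (a ^ 2 * s ^ d) + s ^ d * omg d * a := by
        gcongr
    _ = _ := by field_simp

lemma inv_pow_le_sum_dyadic {R r : ℝ} (hR : 0 < R) (hr : R ≤ r) (n m : ℕ) (hn : r < 2 ^ n * R) :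
    (r ^ m)⁻¹ ≤ ∑ k ∈ Finset.range n,
      if r ≤ 2 ^ (k + 1) * R then ((2 ^ k * R) ^ m)⁻¹ else 0 := by
  have hex : ∃ k, r < 2 ^ k * R := ⟨n, hn⟩
  classical
  obtain ⟨k, hk⟩ : ∃ k, Nat.find hex = k + 1 := by
    refine Nat.exists_eq_succ_of_ne_zero fun h0 => ?_
    have := Nat.find_spec hex
    rw [h0] at this
    simp at this
    linarith
  have h1 := Nat.find_spec hex
  have h2 := Nat.find_min hex (m := k) (by omega)
  have h3 := Nat.find_min' hex hn
  rw [hk] at h1 h3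
  rw [not_lt] at h2
  have hmem : k ∈ Finset.range n := by rw [Finset.mem_range]; omega
  refine le_trans ?_ (Finset.single_le_sum (f := fun k => if r ≤ 2 ^ (k + 1) * R then
    ((2 ^ k * R) ^ m)⁻¹ else 0) (fun k _ => ?_) hmem)
  · rw [if_pos h1.le]
    gcongr
  · split_ifs <;> positivity

open Classical in
lemma integral_tail_le {f : Euc d → ℝ} (hf : Continuous f) (hc : HasCompactSupport f)
    {x0 : Euc d} {R a : ℝ} (hR : 0 < R) (ha : 0 < a) (h0 : ∀ x ∈ ball x0 R, f x = 0)
    (h : ∀ s, R ≤ s → ∫ x in closedBall x0 s, |f x| ≤ a * s ^ d) :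
    ∫ t, (‖t - x0‖ ^ (d + 1))⁻¹ * |f t| ≤ 2 ^ (d + 1) * a * R⁻¹ := by
  obtain ⟨M, hM⟩ := hc.isCompact.isBounded.subset_closedBall x0
  obtain ⟨n, hn⟩ := pow_unbounded_of_one_lt (M / R) one_lt_two
  rw [div_lt_iff₀ hR] at hn
  have hint : ∀ k : ℕ, Integrable ((closedBall x0 (2 ^ (k + 1) * R)).indicator
      fun t => ((2 ^ k * R) ^ (d + 1))⁻¹ * |f t|) := by
    intro k
    rw [integrable_indicator_iff measurableSet_closedBall]
    exact (by fun_prop : Continuous fun t => ((2 ^ k * R) ^ (d + 1))⁻¹ * |f t|).continuousOn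
      |>.integrableOn_compact (isCompact_closedBall _ _)
  have hpt : ∀ t, (‖t - x0‖ ^ (d + 1))⁻¹ * |f t| ≤ ∑ k ∈ Finset.range n,
      (closedBall x0 (2 ^ (k + 1) * R)).indicator
        (fun t => ((2 ^ k * R) ^ (d + 1))⁻¹ * |f t|) t := by
    intro t
    by_cases ht : f t = 0
    · simp only [ht, abs_zero, mul_zero]
      refine Finset.sum_nonneg fun k _ => ?_
      apply Set.indicator_nonneg
      intros
      positivity
    · have h1 : R ≤ ‖t - x0‖ := by
        by_contra hlt
        exact ht (h0 t (by rw [mem_ball, dist_eq_norm]; linarith))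
      have h2 : ‖t - x0‖ < 2 ^ n * R := by
        have := hM (subset_tsupport _ ht)
        rw [mem_closedBall, dist_eq_norm] at this
        linarith
      refine (mul_le_mul_of_nonneg_right (inv_pow_le_sum_dyadic hR h1 n (d + 1) h2)
        (abs_nonneg _)).trans_eq ?_
      rw [Finset.sum_mul]
      refine Finset.sum_congr rfl fun k _ => ?_
      rw [Set.indicator_apply, mem_closedBall, dist_eq_norm]
      split_ifs <;> simp
  have h1 : ∫ t, (‖t - x0‖ ^ (d + 1))⁻¹ * |f t| ≤ ∫ t, ∑ k ∈ Finset.range n,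
      (closedBall x0 (2 ^ (k + 1) * R)).indicator
        (fun t => ((2 ^ k * R) ^ (d + 1))⁻¹ * |f t|) t := by
    apply integral_mono_of_nonneg
    · exact Filter.Eventually.of_forall fun t => by positivity
    · exact integrable_finsetSum _ fun k _ => hint k
    · exact Filter.Eventually.of_forall hpt
  refine h1.trans ?_
  rw [integral_finsetSum _ fun k _ => hint k]
  have h2 : ∀ k ∈ Finset.range n, ∫ t, (closedBall x0 (2 ^ (k + 1) * R)).indicator
        (fun t => ((2 ^ k * R) ^ (d + 1))⁻¹ * |f t|) t ≤ 2 ^ d * a * R⁻¹ * (1 / 2) ^ k := by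
    intro k _
    rw [integral_indicator measurableSet_closedBall, integral_const_mul]
    have hk : R ≤ 2 ^ (k + 1) * R := le_mul_of_one_le_left hR.le (one_le_pow₀ one_le_two)
    calc _ ≤ ((2 ^ k * R) ^ (d + 1))⁻¹ * (a * (2 ^ (k + 1) * R) ^ d) :=
          mul_le_mul_of_nonneg_left (h _ hk) (by positivity)
      _ = _ := by
        rw [pow_succ 2 k, mul_right_comm, mul_pow _ 2 d, pow_succ _ d, one_div, inv_pow]
        field_simp
  refine (Finset.sum_le_sum h2).trans ?_
  rw [← Finset.mul_sum]
  have h3 : ∑ k ∈ Finset.range n, (1 / 2 : ℝ) ^ k ≤ 2 := by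
    have := Summable.sum_le_tsum (Finset.range n) (fun k _ => by positivity)
      summable_geometric_two
    rwa [tsum_geometric_two] at this
  calc _ ≤ 2 ^ d * a * R⁻¹ * 2 := mul_le_mul_of_nonneg_left h3 (by positivity)
    _ = _ := by ring

lemma ker2_local_comparison (hd : 1 ≤ d) : ∃ N C : ℝ, 1 ≤ N ∧ 1 ≤ C ∧ ∀ {ε : ℝ}, 0 < ε →
    ∀ (i j : Fin d) {f : Euc d → ℝ}, Continuous f → HasCompactSupport f → ∀ (x0 : Euc d)
    {R l δ : ℝ}, 0 < R → 0 < l → 0 < δ → δ ≤ 1 →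
    ∫ x in closedBall x0 R, conv (ker2 ε i j) f x ^ 2 ≤ l ^ 2 * R ^ d →
    (∀ s, R ≤ s → ∫ x in closedBall x0 s, f x ^ 2 ≤ (δ * l) ^ 2 * s ^ d) →
    ∃ G : Euc d → ℝ, Continuous G ∧ (∀ x, 0 ≤ G x) ∧
      (∀ x ∈ closedBall x0 R, |conv (ker2 ε i j) f x| ≤ G x + N * l) ∧
      ∫ x in closedBall x0 R, G x ^ 2 ≤ C * (δ * l) ^ 2 * R ^ d := by
  have hω := omg_pos d
  set C := massP d ^ 2 * 4 ^ d + 1 with hC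
  have hC1 : 1 ≤ C := by have : 0 ≤ massP d ^ 2 * 4 ^ d := by positivity
                         linarith
  set B := √((2 + 2 * C) / omg d) with hB
  set D := gradC d * 2 ^ (d + 2) * (2 ^ (d + 1) * (1 + omg d)) with hD
  have hD0 : 0 ≤ D := by have := gradC_nonneg d; positivity
  have hB0 : 0 ≤ B := Real.sqrt_nonneg _
  refine ⟨1 + B + D, C, by linarith, hC1, ?_⟩
  intro ε hε i j f hf hc x0 R l δ hR hl hδ hδ1 hg hfs
  have hK := ker2_continuous hε i j
  let η : ContDiffBump x0 := { rIn := 2 * R, rOut := 4 * R, rIn_pos := by positivity,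
                               rIn_lt_rOut := by linarith }
  have hηc : Continuous η := η.continuous
  set f1 : Euc d → ℝ := fun x => η x * f x with hf1
  set f2 : Euc d → ℝ := fun x => (1 - η x) * f x with hf2
  have f1c : Continuous f1 := by fun_prop
  have f2c : Continuous f2 := by fun_prop
  have f1s : HasCompactSupport f1 := hc.mul_left
  have f2s : HasCompactSupport f2 := hc.mul_left
  have hsplit : ∀ x, conv (ker2 ε i j) f x = conv (ker2 ε i j) f1 x + conv (ker2 ε i j) f2 x := by
    intro x
    have : f = fun x => f1 x + f2 x := by funext x; simp only [hf1, hf2]; ring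
    conv_lhs => rw [this]
    exact conv_add_right hK f1c f1s f2c f2s x
  set g1 := conv (ker2 ε i j) f1 with hg1
  have g1c : Continuous g1 := conv_continuous hK f1c f1s
  set g := conv (ker2 ε i j) f with hgdef
  have gc : Continuous g := conv_continuous hK hf hc
  have hcomp := isCompact_closedBall x0 R
  have hG2 : ∫ x in closedBall x0 R, |g1 x| ^ 2 ≤ C * (δ * l) ^ 2 * R ^ d := by
    have e1 : ∫ x in closedBall x0 R, |g1 x| ^ 2 ≤ ∫ x, g1 x ^ 2 := by
      simp only [sq_abs]
      exact setIntegral_le_integral (integrable_ker2_conv_sq hd hε f1c f1s i j)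
        (Filter.Eventually.of_forall fun x => sq_nonneg _)
    have e2 := integral_ker2_conv_sq_le hd hε f1c f1s i j
    have e3 : ∫ x, f1 x ^ 2 ≤ ∫ x in closedBall x0 (4 * R), f x ^ 2 := by
      rw [← integral_indicator measurableSet_closedBall]
      apply integral_mono_of_nonneg
      · exact Filter.Eventually.of_forall fun x => sq_nonneg _
      · rw [integrable_indicator_iff measurableSet_closedBall]
        exact (hf.pow 2).continuousOn.integrableOn_compact (isCompact_closedBall _ _)
      · refine Filter.Eventually.of_forall fun x => ?_
        by_cases hx : x ∈ closedBall x0 (4 * R)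
        · rw [Set.indicator_of_mem hx]
          simp only [hf1, mul_pow]
          exact mul_le_of_le_one_left (sq_nonneg _) (pow_le_one₀ η.nonneg η.le_one)
        · rw [Set.indicator_of_notMem hx]
          have : η x = 0 := η.zero_of_le_dist (by
            rw [mem_closedBall, not_le] at hx
            exact hx.le)
          simp [hf1, this]
    have e4 := hfs (4 * R) (by linarith)
    calc _ ≤ massP d ^ 2 * ((δ * l) ^ 2 * (4 * R) ^ d) :=
          e1.trans (e2.trans (mul_le_mul_of_nonneg_left (e3.trans e4) (sq_nonneg _)))
      _ = massP d ^ 2 * 4 ^ d * ((δ * l) ^ 2 * R ^ d) := by rw [mul_pow 4 R]; ring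
      _ ≤ C * ((δ * l) ^ 2 * R ^ d) := mul_le_mul_of_nonneg_right (by linarith) (by positivity)
      _ = _ := by ring
  refine ⟨fun x => |g1 x|, g1c.abs, fun x => abs_nonneg _, ?_, hG2⟩
  have hfar : ∀ x ∈ closedBall x0 R, ∀ y ∈ closedBall x0 R,
      |conv (ker2 ε i j) f2 x - conv (ker2 ε i j) f2 y| ≤ D * l := by
    intro x hx y hy
    rw [conv_swap, conv_swap, ← integral_sub (conv_integrable_swap hK f2c f2s x)
      (conv_integrable_swap hK f2c f2s y)]
    have hz : ∀ t ∈ ball x0 (2 * R), f2 t = 0 := by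
      intro t ht
      have : η t = 1 := η.one_of_mem_closedBall (ball_subset_closedBall ht)
      simp [hf2, this]
    have hab : ∀ t, |f2 t| ≤ |f t| := by
      intro t
      simp only [hf2, abs_mul]
      refine mul_le_of_le_one_left (abs_nonneg _) ?_
      rw [abs_of_nonneg (by linarith [η.le_one (x := t)])]
      linarith [η.nonneg (x := t)]
    have htail := integral_tail_le f2c f2s (x0 := x0) (R := 2 * R) (a := (1 + omg d) * l)
      (by positivity) (by positivity) hz (fun s hs => by
        have h1 := integral_abs_le_of_sq hf (x0 := x0) (s := s) (a := δ * l) (by linarith)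
          (by positivity) (hfs s (by linarith))
        have h2 : ∫ t in closedBall x0 s, |f2 t| ≤ ∫ t in closedBall x0 s, |f t| :=
          integral_mono (f2c.abs.continuousOn.integrableOn_compact (isCompact_closedBall _ _))
            (hf.abs.continuousOn.integrableOn_compact (isCompact_closedBall _ _)) hab
        have hs0 : 0 ≤ s := by linarith
        refine (h2.trans h1).trans ?_
        have : δ * l ≤ l := mul_le_of_le_one_left hl.le hδ1
        gcongr)
    have hle : ∀ t, ‖ker2 ε i j (x - t) * f2 t - ker2 ε i j (y - t) * f2 t‖ ≤
        gradC d * 2 ^ (d + 2) * R * ((‖t - x0‖ ^ (d + 1))⁻¹ * |f2 t|) := by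
      intro t
      by_cases ht : t ∈ ball x0 (2 * R)
      · simp [hz t ht]
      · rw [mem_ball, not_lt, dist_eq_norm] at ht
        rw [← sub_mul, norm_mul, Real.norm_eq_abs, Real.norm_eq_abs, ← mul_assoc]
        exact mul_le_mul_of_nonneg_right (abs_ker2_sub_le hε i j hR hx hy ht) (abs_nonneg _)
    have hint : Integrable fun t => (‖t - x0‖ ^ (d + 1))⁻¹ * |f2 t| := by
      have i1 : Integrable fun t => ((2 * R) ^ (d + 1))⁻¹ * |f2 t| :=
        ((f2c.integrable_of_hasCompactSupport f2s).abs).const_mul _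
      refine i1.mono' ?_ (Filter.Eventually.of_forall fun t => ?_)
      · exact ((by fun_prop : Measurable fun t : Euc d => (‖t - x0‖ ^ (d + 1))⁻¹).mul
          f2c.abs.measurable).aestronglyMeasurable
      · by_cases ht : t ∈ ball x0 (2 * R)
        · simp [hz t ht]
        · rw [mem_ball, not_lt, dist_eq_norm] at ht
          rw [norm_mul, Real.norm_eq_abs, Real.norm_eq_abs, abs_abs, abs_of_nonneg (by positivity)]
          gcongr
    refine (norm_integral_le_of_norm_le (hint.const_mul _)
      (Filter.Eventually.of_forall hle)).trans ?_
    rw [integral_const_mul]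
    calc _ ≤ gradC d * 2 ^ (d + 2) * R * (2 ^ (d + 1) * ((1 + omg d) * l) * (2 * R)⁻¹) :=
          mul_le_mul_of_nonneg_left htail (by have := gradC_nonneg d; positivity)
      _ = D * l / 2 := by rw [hD]; field_simp
      _ ≤ D * l := half_le_self (by positivity)
  obtain ⟨y, hy, hyle⟩ : ∃ y ∈ closedBall x0 R, (|g y| + |g1 y|) ^ 2 ≤ (B * l) ^ 2 := by
    have hvol := volume_real_closedBall x0 hR.le
    have hcont : Continuous fun x => (|g x| + |g1 x|) ^ 2 := by fun_prop
    obtain ⟨y, hy, hle⟩ := exists_le_setAverage (μ := volume) (s := closedBall x0 R)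
      (f := fun x => (|g x| + |g1 x|) ^ 2)
      (measure_closedBall_pos _ _ hR).ne' measure_closedBall_lt_top.ne
      (hcont.continuousOn.integrableOn_compact hcomp)
    refine ⟨y, hy, hle.trans ?_⟩
    rw [setAverage_eq, hvol, smul_eq_mul, inv_mul_le_iff₀ (by positivity)]
    have i1 : IntegrableOn (fun x => 2 * g x ^ 2) (closedBall x0 R) :=
      (by fun_prop : Continuous fun x => 2 * g x ^ 2).continuousOn.integrableOn_compact hcomp
    have i2 : IntegrableOn (fun x => 2 * |g1 x| ^ 2) (closedBall x0 R) :=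
      (by fun_prop : Continuous fun x => 2 * |g1 x| ^ 2).continuousOn.integrableOn_compact hcomp
    calc ∫ x in closedBall x0 R, (|g x| + |g1 x|) ^ 2
        ≤ ∫ x in closedBall x0 R, (2 * g x ^ 2 + 2 * |g1 x| ^ 2) := by
          refine integral_mono (hcont.continuousOn.integrableOn_compact hcomp) (i1.add i2) ?_
          intro x
          change (|g x| + |g1 x|) ^ 2 ≤ 2 * g x ^ 2 + 2 * |g1 x| ^ 2
          rw [← sq_abs (g x)]
          nlinarith [sq_nonneg (|g x| - |g1 x|)]
      _ ≤ 2 * (l ^ 2 * R ^ d) + 2 * (C * (δ * l) ^ 2 * R ^ d) := by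
          rw [integral_add i1 i2, integral_const_mul, integral_const_mul]
          gcongr
      _ ≤ 2 * (l ^ 2 * R ^ d) + 2 * (C * l ^ 2 * R ^ d) := by
          have : δ * l ≤ l := mul_le_of_le_one_left hl.le hδ1
          gcongr
      _ = R ^ d * omg d * (B * l) ^ 2 := by
          rw [mul_pow, hB, Real.sq_sqrt (by positivity)]
          field_simp
  have hyle' : |g y| + |g1 y| ≤ B * l := abs_le_of_sq_le_sq' hyle (by positivity) |>.2
  intro x hx
  have h1 := hfar x hx y hy
  have h2 := hsplit x
  have h3 := hsplit y
  have h4 : |conv (ker2 ε i j) f2 y| ≤ B * l := by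
    have : conv (ker2 ε i j) f2 y = g y - g1 y := by linarith
    rw [this]
    exact (abs_sub _ _).trans hyle'
  have h5 : |g x| ≤ |g1 x| + |conv (ker2 ε i j) f2 x| := by
    rw [h2]; exact abs_add_le _ _
  have h6 := abs_sub_abs_le_abs_sub (conv (ker2 ε i j) f2 x) (conv (ker2 ε i j) f2 y)
  change |g x| ≤ |g1 x| + (1 + B + D) * l
  nlinarith

lemma Continuous.integrableOn_closedBall {f : Euc d → ℝ} (hf : Continuous f) (x : Euc d) (r : ℝ) :
    IntegrableOn f (closedBall x r) :=
  hf.continuousOn.integrableOn_compact (isCompact_closedBall x r)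

lemma exists_stopping_radius (hd : 1 ≤ d) {Ψ : Euc d → ℝ} (hc : Continuous Ψ)
    (h0 : ∀ x, 0 ≤ Ψ x) (hi : Integrable Ψ) {c : ℝ} (hcp : 0 < c) {x : Euc d}
    (hx : c < omg d * Ψ x) :
    ∃ r, 0 < r ∧ r ≤ max 1 ((∫ y, Ψ y) / c) ∧ c * r ^ d < ∫ y in closedBall x r, Ψ y ∧
      ∀ s, 2 * r ≤ s → ∫ y in closedBall x s, Ψ y ≤ c * s ^ d := by
  have hω := omg_pos d
  set S : Set ℝ := {r | 0 < r ∧ c * r ^ d < ∫ y in closedBall x r, Ψ y} with hS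
  have hSb : ∀ r ∈ S, r ≤ max 1 ((∫ y, Ψ y) / c) := by
    intro r hr
    by_contra! hlt
    have h1 : 1 < r := (le_max_left _ _).trans_lt hlt
    have h2 : (∫ y, Ψ y) / c < r := (le_max_right _ _).trans_lt hlt
    rw [div_lt_iff₀ hcp] at h2
    have h3 : r ≤ r ^ d := le_self_pow₀ h1.le (by omega)
    have h4 : ∫ y in closedBall x r, Ψ y ≤ ∫ y, Ψ y :=
      setIntegral_le_integral hi (Filter.Eventually.of_forall h0)
    have h5 := hr.2
    nlinarith
  have hne : S.Nonempty := by
    have h1 : c / omg d < Ψ x := by rw [div_lt_iff₀ hω]; linarith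
    obtain ⟨c', hc1, hc2⟩ := exists_between h1
    have hop : {y | c' < Ψ y} ∈ nhds x := (isOpen_lt continuous_const hc).mem_nhds hc2
    obtain ⟨r, hr, hsub⟩ := Metric.nhds_basis_closedBall.mem_iff.1 hop
    refine ⟨r, hr, ?_⟩
    have h2 : ∫ y in closedBall x r, c' ≤ ∫ y in closedBall x r, Ψ y :=
      setIntegral_mono_on (continuous_const.integrableOn_closedBall x r)
        (hc.integrableOn_closedBall x r) measurableSet_closedBall fun y hy => (hsub hy).le
    rw [setIntegral_const, volume_real_closedBall x hr.le, smul_eq_mul] at h2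
    refine lt_of_lt_of_le ?_ h2
    rw [div_lt_iff₀ hω] at hc1
    have : 0 < r ^ d := by positivity
    nlinarith
  have hbdd : BddAbove S := ⟨_, hSb⟩
  obtain ⟨r0, hr0⟩ := hne
  have hs0 : 0 < sSup S := hr0.1.trans_le (le_csSup hbdd hr0)
  obtain ⟨r, hr, hrs⟩ := exists_lt_of_lt_csSup ⟨r0, hr0⟩ (half_lt_self hs0)
  refine ⟨r, hr.1, hSb r hr, hr.2, fun s hs => ?_⟩
  by_contra! hlt
  have : s ∈ S := ⟨by linarith [hr.1], hlt⟩
  linarith [le_csSup hbdd this]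

/-- The measure with density `g ^ 2`. -/
def sqMeas (g : Euc d → ℝ) : Measure (Euc d) :=
  volume.withDensity fun x => ENNReal.ofReal (g x ^ 2)

lemma sqMeas_apply (g : Euc d → ℝ) {s : Set (Euc d)} (hs : MeasurableSet s) :
    sqMeas g s = ∫⁻ x in s, ENNReal.ofReal (g x ^ 2) := withDensity_apply _ hs

lemma sqMeas_closedBall_le {g : Euc d → ℝ} (hg : Continuous g) (a : ℝ) (x : Euc d)
    {r : ℝ} (hr : 0 ≤ r) :
    sqMeas g (closedBall x r) ≤ sqMeas g (closedBall x r ∩ {y | a < |g y|}) +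
      ENNReal.ofReal (a ^ 2 * (r ^ d * omg d)) := by
  have hU : MeasurableSet {y | a < |g y|} := (isOpen_lt continuous_const hg.abs).measurableSet
  rw [← measure_inter_add_sdiff (closedBall x r) hU]
  gcongr
  rw [sqMeas_apply _ (measurableSet_closedBall.diff hU), ENNReal.ofReal_mul (sq_nonneg _),
    ← volume_closedBall x hr]
  calc ∫⁻ y in closedBall x r \ {y | a < |g y|}, ENNReal.ofReal (g y ^ 2)
      ≤ ∫⁻ y in closedBall x r \ {y | a < |g y|}, ENNReal.ofReal (a ^ 2) := by
        refine setLIntegral_mono measurable_const fun y hy => ENNReal.ofReal_le_ofReal ?_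
        have : |g y| ≤ a := not_lt.1 hy.2
        rw [← sq_abs]
        gcongr
    _ ≤ ENNReal.ofReal (a ^ 2) * volume (closedBall x r) := by
        rw [setLIntegral_const]
        gcongr
        exact Set.sdiff_subset

lemma sqMeas_closedBall_eq {g : Euc d → ℝ} (hg : Continuous g) (x : Euc d) (r : ℝ) :
    sqMeas g (closedBall x r) = ENNReal.ofReal (∫ y in closedBall x r, g y ^ 2) := by
  rw [sqMeas_apply _ measurableSet_closedBall, ofReal_integral_eq_lintegral_ofReal
    ((by fun_prop : Continuous fun y => g y ^ 2).integrableOn_closedBall x r) (Filter.Eventually.of_forall fun y => sq_nonneg _)]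

/-- The local comparison property which drives the level set estimate. -/
def LocComp (N C : ℝ) (f g : Euc d → ℝ) : Prop :=
  ∀ (x0 : Euc d) {R l δ : ℝ}, 0 < R → 0 < l → 0 < δ → δ ≤ 1 →
    ∫ x in closedBall x0 R, g x ^ 2 ≤ l ^ 2 * R ^ d →
    (∀ s, R ≤ s → ∫ x in closedBall x0 s, f x ^ 2 ≤ (δ * l) ^ 2 * s ^ d) →
    ∃ G : Euc d → ℝ, Continuous G ∧ (∀ x, 0 ≤ G x) ∧
      (∀ x ∈ closedBall x0 R, |g x| ≤ G x + N * l) ∧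
      ∫ x in closedBall x0 R, G x ^ 2 ≤ C * (δ * l) ^ 2 * R ^ d

lemma sqMeas_level_local {N C : ℝ} {f g : Euc d → ℝ}
    (hg : Continuous g) (hloc : LocComp N C f g) (x0 : Euc d) {R l δ : ℝ} (hR : 0 < R)
    (hl : 0 < l) (hδ : 0 < δ) (hδ1 : δ ≤ 1)
    (h1 : ∫ x in closedBall x0 R, g x ^ 2 ≤ l ^ 2 * R ^ d)
    (h2 : ∀ s, R ≤ s → ∫ x in closedBall x0 s, f x ^ 2 ≤ (δ * l) ^ 2 * s ^ d) :
    sqMeas g (closedBall x0 R ∩ {y | 2 * N * l < |g y|}) ≤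
      ENNReal.ofReal (4 * C * (δ * l) ^ 2 * R ^ d) := by
  obtain ⟨G, Gc, G0, hG, hG2⟩ := hloc x0 hR hl hδ hδ1 h1 h2
  have hU : MeasurableSet {y | 2 * N * l < |g y|} :=
    (isOpen_lt continuous_const hg.abs).measurableSet
  rw [sqMeas_apply _ (measurableSet_closedBall.inter hU)]
  calc ∫⁻ y in closedBall x0 R ∩ {y | 2 * N * l < |g y|}, ENNReal.ofReal (g y ^ 2)
      ≤ ∫⁻ y in closedBall x0 R ∩ {y | 2 * N * l < |g y|}, ENNReal.ofReal (4 * G y ^ 2) := by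
        refine setLIntegral_mono (by fun_prop) fun y hy => ENNReal.ofReal_le_ofReal ?_
        have a1 := hG y hy.1
        have a2 : 2 * N * l < |g y| := hy.2
        rw [← sq_abs]
        nlinarith [abs_nonneg (g y), G0 y]
    _ ≤ ∫⁻ y in closedBall x0 R, ENNReal.ofReal (4 * G y ^ 2) :=
        lintegral_mono_set Set.inter_subset_left
    _ = ENNReal.ofReal (∫ y in closedBall x0 R, 4 * G y ^ 2) := by
        rw [ofReal_integral_eq_lintegral_ofReal
          ((by fun_prop : Continuous fun y => 4 * G y ^ 2).integrableOn_closedBall x0 R)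
          (Filter.Eventually.of_forall fun y => by positivity)]
    _ ≤ _ := by
        rw [integral_const_mul]
        apply ENNReal.ofReal_le_ofReal
        linarith

lemma sqMeas_level_le (hd : 1 ≤ d) {N C : ℝ} (hN : 1 ≤ N) (hC : 1 ≤ C) (hNω : 1 ≤ N ^ 2 * omg d)
    {b : ℝ} (hb : 0 < b) (hbω : (2 * N * b) ^ 2 * omg d ≤ 1 / 4)
    {f g : Euc d → ℝ} (hf : Continuous f) (hg : Continuous g)
    (hf2 : Integrable fun x => f x ^ 2) (hg2 : Integrable fun x => g x ^ 2)
    (hloc : LocComp N C f g) {δ t : ℝ} (hδ : 0 < δ) (hδ1 : δ ≤ 1) (ht : 0 < t) :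
    sqMeas g {x | t < |g x|} ≤ ENNReal.ofReal (8 * C * 10 ^ d) *
      (ENNReal.ofReal (δ ^ 2) * sqMeas g {x | b * t < |g x|} +
        sqMeas f {x | b * δ * t < |f x|}) := by
  obtain ⟨l, hl, rfl⟩ : ∃ l, 0 < l ∧ t = 2 * N * l :=
    ⟨t / (2 * N), by positivity, by field_simp⟩
  have hω := omg_pos d
  set a := 2 * N * b with ha
  have ha0 : 0 < a := by positivity
  have e1 : b * (2 * N * l) = a * l := by rw [ha]; ring
  have e2 : b * δ * (2 * N * l) = a * (δ * l) := by rw [ha]; ring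
  rw [e1, e2]
  set L := {x | 2 * N * l < |g x|} with hL
  set U := {x | a * l < |g x|} with hU
  set V := {x | a * (δ * l) < |f x|} with hV
  have mU : MeasurableSet U := (isOpen_lt continuous_const hg.abs).measurableSet
  have mV : MeasurableSet V := (isOpen_lt continuous_const hf.abs).measurableSet
  set Ψ : Euc d → ℝ := fun x => δ ^ 2 * g x ^ 2 + f x ^ 2 with hΨ
  have Ψc : Continuous Ψ := by fun_prop
  have Ψ0 : ∀ x, 0 ≤ Ψ x := fun x => by positivity
  have Ψi : Integrable Ψ := (hg2.const_mul _).add hf2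
  have Ψint : ∀ x r, ∫ y in closedBall x r, Ψ y =
      δ ^ 2 * (∫ y in closedBall x r, g y ^ 2) + ∫ y in closedBall x r, f y ^ 2 := by
    intro x r
    rw [hΨ, integral_add
      ((by fun_prop : Continuous fun y => δ ^ 2 * g y ^ 2).integrableOn_closedBall x r)
      ((by fun_prop : Continuous fun y => f y ^ 2).integrableOn_closedBall x r),
      integral_const_mul]
  have hrad : ∀ x ∈ L, ∃ r, 0 < r ∧ r ≤ max 1 ((∫ y, Ψ y) / (δ * l) ^ 2) ∧
      (δ * l) ^ 2 * r ^ d < ∫ y in closedBall x r, Ψ y ∧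
      ∀ s, 2 * r ≤ s → ∫ y in closedBall x s, Ψ y ≤ (δ * l) ^ 2 * s ^ d := by
    intro x hx
    apply exists_stopping_radius hd Ψc Ψ0 Ψi (by positivity)
    have h1 : (2 * N * l) ^ 2 < g x ^ 2 := by
      rw [← sq_abs (g x)]
      exact pow_lt_pow_left₀ hx (by positivity) two_ne_zero
    calc (δ * l) ^ 2 ≤ δ ^ 2 * l ^ 2 * (4 * (N ^ 2 * omg d)) := by
          rw [mul_pow]
          exact le_mul_of_one_le_right (by positivity) (by linarith)
      _ = omg d * (δ ^ 2 * (2 * N * l) ^ 2) := by ring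
      _ < omg d * (δ ^ 2 * g x ^ 2 + f x ^ 2) := by
          have h2 : δ ^ 2 * (2 * N * l) ^ 2 < δ ^ 2 * g x ^ 2 := by gcongr
          have h3 := sq_nonneg (f x)
          exact mul_lt_mul_of_pos_left (by linarith) hω
  choose! r hr0 hrb hr1 hr2 using hrad
  obtain ⟨u, huL, hdisj, hcov⟩ := Vitali.exists_disjoint_subfamily_covering_enlargement_closedBall
    L (fun x => x) r _ hrb 10 (by norm_num)
  have hcount : u.Countable := hdisj.countable_of_nonempty_interior fun x hx => by
    refine ⟨x, ?_⟩
    exact ball_subset_interior_closedBall (mem_ball_self (hr0 x (huL hx)))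
  set ν : Measure (Euc d) := ENNReal.ofReal (δ ^ 2) • (sqMeas g).restrict U +
    (sqMeas f).restrict V with hν
  have hνle : ν Set.univ ≤ ENNReal.ofReal (δ ^ 2) * sqMeas g U + sqMeas f V := by
    simp [hν]
  have hball : ∀ x ∈ L, ENNReal.ofReal ((δ * l) ^ 2 * r x ^ d) ≤ 2 * ν (closedBall x (r x)) := by
    intro x hx
    set T := (δ * l) ^ 2 * r x ^ d with hT
    have hr := (hr0 x hx).le
    have hT0 : 0 ≤ T := by positivity
    have h1 : ENNReal.ofReal T ≤ ν (closedBall x (r x)) + ENNReal.ofReal (T / 2) := by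
      calc ENNReal.ofReal T ≤ ENNReal.ofReal (∫ y in closedBall x (r x), Ψ y) :=
            ENNReal.ofReal_le_ofReal (hr1 x hx).le
        _ = ENNReal.ofReal (δ ^ 2) * sqMeas g (closedBall x (r x)) +
              sqMeas f (closedBall x (r x)) := by
            rw [Ψint, ENNReal.ofReal_add, ENNReal.ofReal_mul (sq_nonneg _), sqMeas_closedBall_eq hg,
              sqMeas_closedBall_eq hf]
            · exact mul_nonneg (sq_nonneg _) (integral_nonneg fun y => sq_nonneg _)
            · exact integral_nonneg fun y => sq_nonneg _
        _ ≤ ENNReal.ofReal (δ ^ 2) * (sqMeas g (closedBall x (r x) ∩ U) +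
              ENNReal.ofReal ((a * l) ^ 2 * (r x ^ d * omg d))) +
              (sqMeas f (closedBall x (r x) ∩ V) +
              ENNReal.ofReal ((a * (δ * l)) ^ 2 * (r x ^ d * omg d))) := by
            gcongr
            · exact sqMeas_closedBall_le hg _ x hr
            · exact sqMeas_closedBall_le hf _ x hr
        _ = ν (closedBall x (r x)) + (ENNReal.ofReal (δ ^ 2 * ((a * l) ^ 2 * (r x ^ d * omg d))) +
              ENNReal.ofReal ((a * (δ * l)) ^ 2 * (r x ^ d * omg d))) := by
            rw [hν, Measure.add_apply, Measure.smul_apply, smul_eq_mul,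
              Measure.restrict_apply measurableSet_closedBall,
              Measure.restrict_apply measurableSet_closedBall, ENNReal.ofReal_mul (sq_nonneg δ)]
            ring
        _ ≤ _ := by
            rw [← ENNReal.ofReal_add (by positivity) (by positivity)]
            gcongr
            calc _ = 2 * (a ^ 2 * omg d) * T := by rw [hT]; ring
              _ ≤ 2 * (1 / 4) * T := by gcongr
              _ = T / 2 := by ring
    have h2 : ENNReal.ofReal T = ENNReal.ofReal (T / 2) + ENNReal.ofReal (T / 2) := by
      rw [← ENNReal.ofReal_add (by positivity) (by positivity), add_halves]
    have h3 : ENNReal.ofReal (T / 2) ≤ ν (closedBall x (r x)) := by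
      rw [h2] at h1
      exact (ENNReal.add_le_add_iff_right ENNReal.ofReal_ne_top).1 h1
    rw [h2, two_mul]
    gcongr
  have hloc' : ∀ x ∈ L, sqMeas g (closedBall x (10 * r x) ∩ L) ≤
      ENNReal.ofReal (8 * C * 10 ^ d) * ν (closedBall x (r x)) := by
    intro x hx
    have hr := hr0 x hx
    have h1 := sqMeas_level_local hg hloc x (R := 10 * r x) (by positivity) hl hδ hδ1
      (by
        have := hr2 x hx (10 * r x) (by linarith)
        rw [Ψint, mul_pow δ l, mul_assoc] at this
        have h3 : 0 ≤ ∫ y in closedBall x (10 * r x), f y ^ 2 := integral_nonneg fun y => sq_nonneg _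
        exact le_of_mul_le_mul_left (by linarith) (by positivity : 0 < δ ^ 2))
      (fun s hs => by
        have := hr2 x hx s (by linarith)
        rw [Ψint] at this
        have h3 : 0 ≤ ∫ y in closedBall x s, g y ^ 2 := integral_nonneg fun y => sq_nonneg _
        nlinarith [sq_nonneg δ])
    refine h1.trans ?_
    calc ENNReal.ofReal (4 * C * (δ * l) ^ 2 * (10 * r x) ^ d)
        = ENNReal.ofReal (4 * C * 10 ^ d) * ENNReal.ofReal ((δ * l) ^ 2 * r x ^ d) := by
          rw [← ENNReal.ofReal_mul (by positivity), mul_pow 10]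
          congr 1; ring
      _ ≤ ENNReal.ofReal (4 * C * 10 ^ d) * (2 * ν (closedBall x (r x))) := by
          gcongr
          exact hball x hx
      _ = _ := by
          rw [← mul_assoc]
          congr 1
          rw [show (2 : ENNReal) = ENNReal.ofReal 2 by simp,
            ← ENNReal.ofReal_mul (by positivity)]
          congr 1; ring
  have hsub : L ⊆ ⋃ x ∈ u, (closedBall x (10 * r x) ∩ L) := by
    intro x hx
    obtain ⟨y, hy, hxy⟩ := hcov x hx
    refine Set.mem_biUnion hy ⟨hxy (mem_closedBall_self (hr0 x hx).le), hx⟩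
  calc sqMeas g L ≤ sqMeas g (⋃ x ∈ u, (closedBall x (10 * r x) ∩ L)) := measure_mono hsub
    _ ≤ ∑' x : u, sqMeas g (closedBall (x : Euc d) (10 * r x) ∩ L) :=
        measure_biUnion_le _ hcount _
    _ ≤ ∑' x : u, ENNReal.ofReal (8 * C * 10 ^ d) * ν (closedBall (x : Euc d) (r x)) :=
        ENNReal.tsum_le_tsum fun x => hloc' x (huL x.2)
    _ = ENNReal.ofReal (8 * C * 10 ^ d) * ν (⋃ x ∈ u, closedBall x (r x)) := by
        rw [ENNReal.tsum_mul_left, measure_biUnion hcount hdisj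
          fun x _ => measurableSet_closedBall]
    _ ≤ _ := by
        gcongr
        exact (measure_mono (Set.subset_univ _)).trans hνle

lemma lintegral_pow_sqMeas {g : Euc d → ℝ} (hg : Continuous g) (q : ℕ) :
    ∫⁻ x, ENNReal.ofReal (|g x| ^ q) ∂(sqMeas g) = ∫⁻ x, ENNReal.ofReal (|g x| ^ (q + 2)) := by
  rw [sqMeas, lintegral_withDensity_eq_lintegral_mul _ (by fun_prop) (by fun_prop)]
  refine lintegral_congr fun x => ?_
  rw [Pi.mul_apply, ← ENNReal.ofReal_mul (sq_nonneg _), pow_add, sq_abs, mul_comm]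

lemma lintegral_layer {μ : Measure (Euc d)} {g : Euc d → ℝ} (hg : Continuous g) {c : ℝ}
    (hc : 0 < c) {q : ℕ} (hq : 0 < q) :
    ENNReal.ofReal q * ∫⁻ t in Set.Ioi (0 : ℝ), μ {x | c * t < |g x|} *
      ENNReal.ofReal (t ^ ((q : ℝ) - 1)) =
    ENNReal.ofReal ((c ^ q)⁻¹) * ∫⁻ x, ENNReal.ofReal (|g x| ^ q) ∂μ := by
  have h := lintegral_rpow_eq_lintegral_meas_lt_mul μ (f := fun x => |g x| / c)
    (Filter.Eventually.of_forall fun x => by positivity)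
    (by fun_prop) (p := q) (by exact_mod_cast hq)
  have e : ∀ t : ℝ, {x | t < |g x| / c} = {x | c * t < |g x|} := by
    intro t; ext x
    simp only [Set.mem_ofPred_eq, lt_div_iff₀ hc, mul_comm]
  simp_rw [e] at h
  rw [← h, ← lintegral_const_mul _ (by fun_prop)]
  refine lintegral_congr fun x => ?_
  rw [← ENNReal.ofReal_mul (by positivity), rpow_natCast, div_pow, div_eq_inv_mul]

lemma lintegral_pow_le_of_level {K D b δ : ℝ} (hb : 0 < b) (hδ : 0 < δ) {f g : Euc d → ℝ}
    (hf : Continuous f) (hg : Continuous g) {q : ℕ} (hq : 0 < q)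
    (h : ∀ t, 0 < t → sqMeas g {x | t < |g x|} ≤ ENNReal.ofReal K *
      (ENNReal.ofReal D * sqMeas g {x | b * t < |g x|} + sqMeas f {x | b * δ * t < |f x|})) :
    ∫⁻ x, ENNReal.ofReal (|g x| ^ (q + 2)) ≤ ENNReal.ofReal K *
      (ENNReal.ofReal D * (ENNReal.ofReal ((b ^ q)⁻¹) * ∫⁻ x, ENNReal.ofReal (|g x| ^ (q + 2))) +
        ENNReal.ofReal (((b * δ) ^ q)⁻¹) * ∫⁻ x, ENNReal.ofReal (|f x| ^ (q + 2))) := by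
  rw [← lintegral_pow_sqMeas hg, ← lintegral_pow_sqMeas hf, ← lintegral_layer hg hb hq,
    ← lintegral_layer hf (mul_pos hb hδ) hq]
  have h1 := lintegral_layer (μ := sqMeas g) hg one_pos hq
  simp only [one_mul, one_pow, inv_one, ENNReal.ofReal_one] at h1
  rw [← h1]
  have manti : ∀ (μ : Measure (Euc d)) (u : Euc d → ℝ) (c : ℝ), 0 < c →
      Measurable fun t : ℝ => μ {x | c * t < |u x|} := by
    intro μ u c hc
    have ha : Antitone fun t : ℝ => μ {x | c * t < |u x|} := fun s t hst =>
      measure_mono fun x hx => (mul_le_mul_of_nonneg_left hst hc.le).trans_lt hx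
    exact ha.measurable
  have m1 := manti (sqMeas g) g b hb
  have m2 := manti (sqMeas f) f (b * δ) (mul_pos hb hδ)
  have mt : Measurable fun t : ℝ => ENNReal.ofReal (t ^ ((q : ℝ) - 1)) := by fun_prop
  calc ENNReal.ofReal q * ∫⁻ t in Set.Ioi (0 : ℝ), sqMeas g {x | t < |g x|} *
          ENNReal.ofReal (t ^ ((q : ℝ) - 1))
      ≤ ENNReal.ofReal q * ∫⁻ t in Set.Ioi (0 : ℝ), (ENNReal.ofReal K *
      (ENNReal.ofReal D * (sqMeas g {x | b * t < |g x|} * ENNReal.ofReal (t ^ ((q : ℝ) - 1))) +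
        sqMeas f {x | b * δ * t < |f x|} * ENNReal.ofReal (t ^ ((q : ℝ) - 1)))) := by
        refine mul_le_mul' le_rfl (setLIntegral_mono' (α := ℝ) measurableSet_Ioi fun t ht => ?_)
        refine (mul_le_mul' (h t ht) le_rfl).trans_eq ?_
        ring
    _ = _ := by
        rw [lintegral_const_mul _ (by fun_prop), lintegral_add_left (by fun_prop),
          lintegral_const_mul _ (by fun_prop)]
        ring

lemma lintegral_ker2_conv_pow_le (hd : 1 ≤ d) {q : ℕ} (hq : 0 < q) : ∃ C : ℝ, 0 ≤ C ∧
    ∀ {ε : ℝ}, 0 < ε → ∀ (i j : Fin d) {f : Euc d → ℝ}, Continuous f → HasCompactSupport f →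
    ∫⁻ x, ENNReal.ofReal (|conv (ker2 ε i j) f x| ^ (q + 2)) ≠ ⊤ →
    ∫⁻ x, ENNReal.ofReal (|conv (ker2 ε i j) f x| ^ (q + 2)) ≤
      ENNReal.ofReal C * ∫⁻ x, ENNReal.ofReal (|f x| ^ (q + 2)) := by
  obtain ⟨N0, C, hN0, hC, hloc⟩ := ker2_local_comparison hd
  have hω := omg_pos d
  set N := max N0 (√(1 / omg d)) with hNdef
  have hN : 1 ≤ N := hN0.trans (le_max_left _ _)
  have hNω : 1 ≤ N ^ 2 * omg d := by
    have h1 : √(1 / omg d) ≤ N := le_max_right _ _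
    have h2 : √(1 / omg d) ^ 2 = 1 / omg d := Real.sq_sqrt (by positivity)
    calc 1 = √(1 / omg d) ^ 2 * omg d := by rw [h2]; field_simp
      _ ≤ _ := by gcongr
  set b := (1 / (4 * N)) * √(1 / omg d) with hbdef
  have hb : 0 < b := by positivity
  have hbω : (2 * N * b) ^ 2 * omg d ≤ 1 / 4 := by
    have h2 : √(1 / omg d) ^ 2 = 1 / omg d := Real.sq_sqrt (by positivity)
    rw [hbdef, mul_pow, mul_pow _ √(1 / omg d), h2]
    apply le_of_eq
    field_simp
    norm_num
  set K := 8 * C * 10 ^ d with hK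
  have hK0 : 0 < K := by positivity
  obtain ⟨δ, hδ, hδ1, hδK⟩ : ∃ δ : ℝ, 0 < δ ∧ δ ≤ 1 ∧ K * (δ ^ 2 * (b ^ q)⁻¹) ≤ 1 / 2 := by
    refine ⟨min 1 (b ^ q / (2 * K)), by positivity, min_le_left _ _, ?_⟩
    set δ := min 1 (b ^ q / (2 * K)) with hδ
    have h0 : 0 < δ := by positivity
    have h1 : δ ^ 2 ≤ b ^ q / (2 * K) :=
      (pow_le_of_le_one h0.le (min_le_left _ _) two_ne_zero).trans (min_le_right _ _)
    calc K * (δ ^ 2 * (b ^ q)⁻¹) ≤ K * (b ^ q / (2 * K) * (b ^ q)⁻¹) := by gcongr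
      _ = 1 / 2 := by field_simp
  refine ⟨2 * (K * ((b * δ) ^ q)⁻¹), by positivity, ?_⟩
  intro ε hε i j f hf hc hfin
  have hgc : Continuous (conv (ker2 ε i j) f) := conv_continuous (ker2_continuous hε i j) hf hc
  have hL : LocComp N C f (conv (ker2 ε i j) f) := by
    intro x0 R l δ hR hl hδ hδ1 h1 h2
    obtain ⟨G, a1, a2, a3, a4⟩ := hloc hε i j hf hc x0 hR hl hδ hδ1 h1 h2
    refine ⟨G, a1, a2, fun x hx => (a3 x hx).trans ?_, a4⟩
    have : N0 ≤ N := le_max_left _ _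
    gcongr
  have hf2 : Integrable fun x => f x ^ 2 :=
    (by fun_prop : Continuous fun x => f x ^ 2).integrable_of_hasCompactSupport
      (by simp only [sq]; exact hc.mul_left)
  have key := lintegral_pow_le_of_level hb hδ hf hgc hq fun t ht =>
    sqMeas_level_le hd hN hC hNω hb hbω hf hgc hf2 (integrable_ker2_conv_sq hd hε hf hc i j) hL
      hδ hδ1 ht
  set X := ∫⁻ x, ENNReal.ofReal (|conv (ker2 ε i j) f x| ^ (q + 2))
  set Y := ∫⁻ x, ENNReal.ofReal (|f x| ^ (q + 2))
  have k2 : X ≤ ENNReal.ofReal (1 / 2) * X + ENNReal.ofReal (K * ((b * δ) ^ q)⁻¹) * Y := by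
    refine key.trans ?_
    rw [mul_add, ← mul_assoc, ← mul_assoc, ← mul_assoc, ← ENNReal.ofReal_mul hK0.le,
      ← ENNReal.ofReal_mul hK0.le, ← ENNReal.ofReal_mul (by positivity), mul_assoc K]
    gcongr
  have k3 : X = ENNReal.ofReal (1 / 2) * X + ENNReal.ofReal (1 / 2) * X := by
    rw [← add_mul, ← ENNReal.ofReal_add (by norm_num) (by norm_num)]
    norm_num
  have hne : ENNReal.ofReal (1 / 2) * X ≠ ⊤ := ENNReal.mul_ne_top ENNReal.ofReal_ne_top hfin
  have k4 : ENNReal.ofReal (1 / 2) * X ≤ ENNReal.ofReal (K * ((b * δ) ^ q)⁻¹) * Y := by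
    rw [k3] at k2
    have := k2
    conv_rhs at this => rw [← k3]
    exact (ENNReal.add_le_add_iff_left hne).1 this
  have k5 : X ≤ ENNReal.ofReal 2 * (ENNReal.ofReal (1 / 2) * X) := by
    rw [← mul_assoc, ← ENNReal.ofReal_mul (by norm_num)]
    norm_num
  refine k5.trans ?_
  rw [ENNReal.ofReal_mul (by norm_num : (0 : ℝ) ≤ 2), mul_assoc]
  gcongr

/-- The Calderón–Zygmund estimate for compactly supported functions of class `C²`. -/
lemma calderon_zygmund (d : ℕ) {n : ℕ} (hn : 3 ≤ n) : ∃ C : ℝ, 0 ≤ C ∧ ∀ {u : Euc d → ℝ},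
    ContDiff ℝ 2 u → HasCompactSupport u → ∀ i j : Fin d,
    ∫ x, |dd i (dd j u) x| ^ n ≤ C * ∫ x, |lap u x| ^ n := by
  rcases Nat.eq_zero_or_pos d with rfl | hd
  · exact ⟨0, le_rfl, fun _ _ i => i.elim0⟩
  obtain ⟨q, rfl, hq⟩ : ∃ q, n = q + 2 ∧ 0 < q := ⟨n - 2, by omega, by omega⟩
  obtain ⟨C, hC, hCZ⟩ := lintegral_ker2_conv_pow_le (d := d) hd hq
  have hm := massP_pos hd
  refine ⟨(massP d ^ (q + 2))⁻¹ * C, by positivity, ?_⟩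
  intro u hu hc i j
  have h1 : ∀ k, ContDiff ℝ 1 (dd k u) := fun k => dd_contDiff (n := 2) (m := 1) hu (by norm_num) k
  have c1 : ∀ k, HasCompactSupport (dd k u) := fun k => dd_hasCompactSupport hc k
  have h2 : ∀ k l, Continuous (dd k (dd l u)) := fun k l => dd_continuous (h1 l) k
  have c2 : ∀ k l, HasCompactSupport (dd k (dd l u)) := fun k l => dd_hasCompactSupport (c1 l) k
  have lc := lap_continuous hu
  have ls := lap_hasCompactSupport hc
  have hint : ∀ {w : Euc d → ℝ}, Continuous w → HasCompactSupport w →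
      Integrable fun x => |w x| ^ (q + 2) := fun {w} hw hs =>
    (by fun_prop : Continuous fun x => |w x| ^ (q + 2)).integrable_of_hasCompactSupport
      (hs.comp_left (g := fun t : ℝ => |t| ^ (q + 2)) (by simp))
  have hfin : ∀ ε : ℝ, 0 < ε →
      ∫⁻ x, ENNReal.ofReal (|conv (ker2 ε i j) (lap u) x| ^ (q + 2)) ≠ ⊤ := by
    intro ε hε
    obtain ⟨M, hM⟩ := (c2 j i).exists_bound_of_continuous (h2 j i)
    have hb : ∀ x, |conv (ker2 ε i j) (lap u) x| ≤ massP d * M := by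
      intro x
      rw [conv_ker2_lap hε hu hc, ← integral_kerP hε, ← integral_mul_const]
      change |∫ t, kerP d ε t * dd j (dd i u) (x - t)| ≤ _
      rw [← Real.norm_eq_abs]
      refine norm_integral_le_of_norm_le ((kerP_integrable hε).mul_const _)
        (Filter.Eventually.of_forall fun t => ?_)
      rw [norm_mul, Real.norm_of_nonneg (kerP_nonneg hε t)]
      exact mul_le_mul_of_nonneg_left (hM _) (kerP_nonneg hε t)
    have i2 := (integrable_ker2_conv_sq hd hε lc ls i j).const_mul ((massP d * M) ^ q)
    have := i2.lintegral_lt_top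
    refine (lt_of_le_of_lt (lintegral_mono fun x => ENNReal.ofReal_le_ofReal ?_) this).ne
    rw [pow_add, sq_abs]
    gcongr
    exact hb x
  have hlim : ∀ x, Filter.Tendsto (fun n : ℕ =>
      |conv (ker2 (1 / ((n : ℝ) + 1)) i j) (lap u) x| ^ (q + 2)) Filter.atTop
      (nhds (|massP d * dd j (dd i u) x| ^ (q + 2))) := by
    intro x
    have := tendsto_conv_kerP (h2 j i) (c2 j i) x
    simp_rw [fun n : ℕ => conv_ker2_lap (ε := 1 / ((n : ℝ) + 1)) (by positivity) hu hc i j]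
    exact this.abs.pow _
  have key := lintegral_ofReal_le_of_tendsto (μ := volume) (fun n => by
      have := conv_continuous (ker2_continuous (ε := 1 / ((n : ℝ) + 1)) (by positivity) i j) lc ls
      exact (this.abs.pow (q + 2)).measurable) hlim tendsto_const_nhds
    (fun n => hCZ (ε := 1 / ((n : ℝ) + 1)) (by positivity) i j lc ls (hfin _ (by positivity)))
  rw [dd_comm hu i j]
  simp_rw [abs_mul, mul_pow, abs_of_pos hm] at key
  rw [← ofReal_integral_eq_lintegral_ofReal ((hint (h2 j i) (c2 j i)).const_mul _)
      (Filter.Eventually.of_forall fun x => by positivity),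
    ← ofReal_integral_eq_lintegral_ofReal (hint lc ls)
      (Filter.Eventually.of_forall fun x => by positivity), ← ENNReal.ofReal_mul hC,
    ENNReal.ofReal_le_ofReal_iff (mul_nonneg hC (integral_nonneg fun x => by positivity)),
    integral_const_mul] at key
  rw [mul_assoc, le_inv_mul_iff₀ (by positivity)]
  exact key

/-- The sum of the absolute values of the second-order partial derivatives. -/
def hs (u : Euc d → ℝ) (x : Euc d) : ℝ := ∑ i, ∑ j, |dd i (dd j u) x|

lemma hs_nonneg (u : Euc d → ℝ) (x : Euc d) : 0 ≤ hs u x :=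
  Finset.sum_nonneg fun _ _ => Finset.sum_nonneg fun _ _ => abs_nonneg _

lemma abs_dd_dd_le_hs (u : Euc d → ℝ) (x : Euc d) (i j : Fin d) : |dd i (dd j u) x| ≤ hs u x := by
  unfold hs
  calc |dd i (dd j u) x| ≤ ∑ j, |dd i (dd j u) x| :=
        Finset.single_le_sum (f := fun j => |dd i (dd j u) x|) (fun _ _ => abs_nonneg _)
          (Finset.mem_univ j)
    _ ≤ _ := Finset.single_le_sum (f := fun i => ∑ j, |dd i (dd j u) x|)
          (fun _ _ => Finset.sum_nonneg fun _ _ => abs_nonneg _) (Finset.mem_univ i)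

lemma dd_dd_continuous {u : Euc d → ℝ} (hu : ContDiff ℝ 2 u) (i j : Fin d) :
    Continuous (dd i (dd j u)) :=
  dd_continuous (dd_contDiff (n := 2) (m := 1) hu (by norm_num) j) i

lemma hs_continuous {u : Euc d → ℝ} (hu : ContDiff ℝ 2 u) : Continuous (hs u) :=
  continuous_finsetSum _ fun i _ => continuous_finsetSum _ fun j _ =>
    (dd_dd_continuous hu i j).abs

lemma dd_eq_zero {u : Euc d → ℝ} {x : Euc d} (hx : x ∉ tsupport u) (i : Fin d) :
    dd i u x = 0 := by
  unfold dd
  rw [fderiv_of_notMem_tsupport ℝ hx]; simp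

lemma tsupport_dd_subset (u : Euc d → ℝ) (i : Fin d) : tsupport (dd i u) ⊆ tsupport u :=
  closure_minimal (fun _ hx => by_contra fun h => hx (dd_eq_zero h i)) (isClosed_tsupport _)

lemma dd_dd_eq_zero {u : Euc d → ℝ} {x : Euc d} (hx : x ∉ tsupport u) (i j : Fin d) :
    dd i (dd j u) x = 0 :=
  dd_eq_zero (fun h => hx (tsupport_dd_subset u j h)) i

lemma hs_eq_zero {u : Euc d → ℝ} {x : Euc d} (hx : x ∉ tsupport u) : hs u x = 0 := by
  simp [hs, dd_dd_eq_zero hx]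

lemma hs_hasCompactSupport {u : Euc d → ℝ} (hc : HasCompactSupport u) : HasCompactSupport (hs u) :=
  hc.of_isClosed_subset (isClosed_tsupport _)
    (closure_minimal (fun _ hx => by_contra fun h => hx (hs_eq_zero h)) (isClosed_tsupport _))

lemma hs_pow_integrable {u : Euc d → ℝ} (hu : ContDiff ℝ 2 u) (hc : HasCompactSupport u)
    {n : ℕ} (hn : n ≠ 0) : Integrable (fun x => hs u x ^ n) :=
  ((hs_continuous hu).pow n).integrable_of_hasCompactSupport
    ((hs_hasCompactSupport hc).comp_left (g := fun t => t ^ n) (zero_pow hn))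

lemma hs_pow_le (n : ℕ) (u : Euc d → ℝ) (x : Euc d) :
    hs u x ^ (n + 1) ≤ ((d : ℝ) * d) ^ n * ∑ i, ∑ j, |dd i (dd j u) x| ^ (n + 1) := by
  rcases Nat.eq_zero_or_pos d with rfl | hd
  · simp [hs]
  have key := pow_sum_div_card_le_sum_pow (s := Finset.univ ×ˢ Finset.univ)
    (f := fun q : Fin d × Fin d => |dd q.1 (dd q.2 u) x|) (fun _ _ => abs_nonneg _) n
  rw [div_le_iff₀' (by simpa using by positivity)] at key
  simpa [hs, Fintype.sum_prod_type] using key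

lemma calderon_zygmund_hs (d : ℕ) {n : ℕ} (hn : 3 ≤ n) : ∃ C : ℝ, 0 ≤ C ∧
    ∀ {u : Euc d → ℝ}, ContDiff ℝ 2 u → HasCompactSupport u →
      ∫ x, hs u x ^ n ≤ C * ∫ x, |lap u x| ^ n := by
  obtain ⟨C, hC, h⟩ := calderon_zygmund d hn
  refine ⟨((d : ℝ) * d) ^ (n - 1) * (d * (d * C)), by positivity, fun {u} hu hc => ?_⟩
  obtain ⟨k, rfl⟩ : ∃ k, n = k + 1 := ⟨n - 1, by omega⟩
  have hi : ∀ i j : Fin d, Integrable (fun x => |dd i (dd j u) x| ^ (k + 1)) := fun i j =>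
    ((dd_dd_continuous hu i j).abs.pow _).integrable_of_hasCompactSupport
      ((dd_hasCompactSupport (dd_hasCompactSupport hc j) i).comp_left
        (g := fun t => |t| ^ (k + 1)) (by simp))
  calc ∫ x, hs u x ^ (k + 1)
      ≤ ∫ x, ((d : ℝ) * d) ^ k * ∑ i, ∑ j, |dd i (dd j u) x| ^ (k + 1) := by
        refine integral_mono (hs_pow_integrable hu hc (by omega)) ?_ (fun x => hs_pow_le k u x)
        exact (integrable_finsetSum _ fun i _ => integrable_finsetSum _ fun j _ => hi i j).const_mul _
    _ = ((d : ℝ) * d) ^ k * ∑ i, ∑ j, ∫ x, |dd i (dd j u) x| ^ (k + 1) := by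
        rw [integral_const_mul, integral_finsetSum _ fun i _ =>
          integrable_finsetSum _ fun j _ => hi i j]
        congr 1
        refine Finset.sum_congr rfl fun i _ => ?_
        rw [integral_finsetSum _ fun j _ => hi i j]
    _ ≤ ((d : ℝ) * d) ^ k * ∑ _i : Fin d, ∑ _j : Fin d, C * ∫ x, |lap u x| ^ (k + 1) := by
        gcongr with i _ j _
        exact h hu hc i j
    _ = _ := by simp; ring

/-- Absorption of a small multiple of the Hessian on the right-hand side. -/
lemma integral_hs_pow_le_of_abs_lap_le (d : ℕ) {n : ℕ} (hn : 3 ≤ n) : ∃ δ C : ℝ, 0 < δ ∧ 0 < C ∧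
    ∀ {u : Euc d → ℝ} {H : ℝ}, ContDiff ℝ 2 u → HasCompactSupport u → tsupport u ⊆ ball 0 1 →
      0 ≤ H → (∀ x ∈ ball (0 : Euc d) 1, |lap u x| ≤ H + δ * hs u x) →
      ∫ x, hs u x ^ n ≤ C * H ^ n := by
  obtain ⟨C, hC, h⟩ := calderon_zygmund_hs d hn
  set D : ℝ := 2 * (C + 1) * 2 ^ (n - 1) with hD
  have hD1 : 1 ≤ D := by
    have : (1 : ℝ) ≤ 2 ^ (n - 1) := one_le_pow₀ (by norm_num)
    rw [hD]; nlinarith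
  have hD0 : 0 < D := by positivity
  refine ⟨1 / D, D * omg d, by positivity, mul_pos hD0 (omg_pos d), fun {u H} hu hc hs1 hH hl => ?_⟩
  have hb : Integrable (fun x => (ball (0 : Euc d) 1).indicator (fun _ => H ^ n) x) :=
    (integrable_indicator_iff measurableSet_ball).2 (integrableOn_const measure_ball_lt_top.ne)
  have hi := hs_pow_integrable hu hc (n := n) (by omega)
  have hlap : ∫ x, |lap u x| ^ n ≤
      2 ^ (n - 1) * (H ^ n * omg d + (1 / D) * ∫ x, hs u x ^ n) := by
    calc ∫ x, |lap u x| ^ n ≤ ∫ x, 2 ^ (n - 1) *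
          ((ball (0 : Euc d) 1).indicator (fun _ => H ^ n) x + (1 / D) * hs u x ^ n) := by
          refine integral_mono ?_ ((hb.add (hi.const_mul _)).const_mul _) fun x => ?_
          · exact ((lap_continuous hu).abs.pow n).integrable_of_hasCompactSupport
              ((lap_hasCompactSupport hc).comp_left (g := fun t => |t| ^ n)
                (by simp; omega))
          · by_cases hx : x ∈ ball (0 : Euc d) 1
            · simp only [Set.indicator_of_mem hx]
              have h0 := hs_nonneg u x
              have h1 : (1 / D) ^ n ≤ 1 / D := by
                apply pow_le_of_le_one (by positivity) ((div_le_one hD0).2 hD1) (by omega)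
              calc |lap u x| ^ n ≤ (H + 1 / D * hs u x) ^ n :=
                    pow_le_pow_left₀ (abs_nonneg _) (hl x hx) n
                _ ≤ 2 ^ (n - 1) * (H ^ n + (1 / D * hs u x) ^ n) :=
                    add_pow_le hH (by positivity) n
                _ ≤ _ := by
                    rw [mul_pow]; gcongr
            · have hx' : x ∉ tsupport u := fun h => hx (hs1 h)
              have : lap u x = 0 := Finset.sum_eq_zero fun k _ => dd_dd_eq_zero hx' k k
              simp only [this, Set.indicator_of_notMem hx, hs_eq_zero hx', abs_zero]
              rw [zero_pow (by omega)]; simp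
      _ = _ := by
          rw [integral_const_mul, integral_add hb (hi.const_mul _), integral_const_mul,
            integral_indicator measurableSet_ball, setIntegral_const, smul_eq_mul, mul_comm (H ^ n)]
          rfl
  have h1 := (h hu hc).trans (mul_le_mul_of_nonneg_left hlap hC)
  have hI : 0 ≤ ∫ x, hs u x ^ n := integral_nonneg fun x => pow_nonneg (hs_nonneg u x) n
  have h2 : C * 2 ^ (n - 1) ≤ D / 2 := by rw [hD]; nlinarith [pow_pos (two_pos (α := ℝ)) (n - 1)]
  have h3 : 0 ≤ H ^ n * omg d := mul_nonneg (pow_nonneg hH n) (omg_pos d).le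
  have h4 : C * (2 ^ (n - 1) * (H ^ n * omg d + 1 / D * ∫ x, hs u x ^ n)) ≤
      D / 2 * (H ^ n * omg d) + (1 / 2) * ∫ x, hs u x ^ n := by
    calc _ = C * 2 ^ (n - 1) * (H ^ n * omg d + 1 / D * ∫ x, hs u x ^ n) := by ring
      _ ≤ D / 2 * (H ^ n * omg d + 1 / D * ∫ x, hs u x ^ n) := by gcongr
      _ = _ := by field_simp
  nlinarith

lemma dd_add {f g : Euc d → ℝ} (hf : ContDiff ℝ 1 f) (hg : ContDiff ℝ 1 g) (i : Fin d)
    (x : Euc d) : dd i (fun y => f y + g y) x = dd i f x + dd i g x := by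
  unfold dd
  rw [fderiv_fun_add (hf.differentiable one_ne_zero x) (hg.differentiable one_ne_zero x)]
  simp

lemma dd_dd_mul {f g : Euc d → ℝ} (hf : ContDiff ℝ 2 f) (hg : ContDiff ℝ 2 g) (i j : Fin d)
    (x : Euc d) : dd i (dd j (fun y => f y * g y)) x =
      dd i (dd j f) x * g x + dd j f x * dd i g x + dd i f x * dd j g x + f x * dd i (dd j g) x := by
  have hf1 : ContDiff ℝ 1 f := hf.of_le (by norm_num)
  have hg1 : ContDiff ℝ 1 g := hg.of_le (by norm_num)
  have hfj : ContDiff ℝ 1 (dd j f) := dd_contDiff (n := 2) (m := 1) hf (by norm_num) j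
  have hgj : ContDiff ℝ 1 (dd j g) := dd_contDiff (n := 2) (m := 1) hg (by norm_num) j
  have h1 : dd j (fun y => f y * g y) = fun y => dd j f y * g y + f y * dd j g y :=
    funext fun y => dd_mul hf1 hg1 j y
  rw [h1, dd_add (hfj.mul hg1) (hf1.mul hgj), dd_mul hfj hg1, dd_mul hf1 hgj]
  ring

/-- Localised `L^n` bound of the Hessian for a nondivergence form operator which is close to the
Laplacian. -/
lemma exists_localization_of_close_laplacian (d : ℕ) {n : ℕ} (hn : 3 ≤ n) :
    ∃ δ C : ℝ, 0 < δ ∧ 0 < C ∧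
    ∀ {w : Euc d → ℝ} {a : Euc d → Fin d → Fin d → ℝ} {G N S : ℝ}, ContDiff ℝ 2 w →
      0 ≤ G → 0 ≤ N → 0 ≤ S →
      (∀ x ∈ ball (0 : Euc d) 1, ∀ i j, |a x i j - if i = j then 1 else 0| ≤ δ) →
      (∀ x ∈ ball (0 : Euc d) 1, |∑ i, ∑ j, a x i j * dd i (dd j w) x| ≤ G) →
      (∀ x ∈ ball (0 : Euc d) 1, |w x| ≤ N) →
      (∀ x ∈ ball (0 : Euc d) 1, ∀ i, |dd i w x| ≤ S) →
      ∃ u : Euc d → ℝ, ContDiff ℝ 2 u ∧ HasCompactSupport u ∧ (∀ x, |u x| ≤ N) ∧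
        (∀ x ∈ ball (0 : Euc d) (1 / 2), u x = w x) ∧
        ∫ x, hs u x ^ n ≤ C * (G + N + S) ^ n := by
  obtain ⟨δ₁, C₁, hδ₁, hC₁, h⟩ := integral_hs_pow_le_of_abs_lap_le d hn
  let η : ContDiffBump (0 : Euc d) := ⟨1 / 2, 3 / 4, by norm_num, by norm_num⟩
  have hη : ContDiff ℝ 2 η := η.contDiff
  have hη1 : ContDiff ℝ 1 η := η.contDiff
  have hηc : HasCompactSupport η := η.hasCompactSupport
  obtain ⟨K, hK⟩ : ∃ K : ℝ, ∀ x, ‖(∑ i, |dd i η x|) + hs η x‖ ≤ K := by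
    refine HasCompactSupport.exists_bound_of_continuous ?_ ?_
    · refine HasCompactSupport.intro hηc fun x hx => ?_
      simp [hs_eq_zero hx, dd_eq_zero hx]
    · exact (continuous_finsetSum _ fun i _ => (dd_continuous hη1 i).abs).add (hs_continuous hη)
  have hsum0 : ∀ x, 0 ≤ ∑ i, |dd i η x| := fun x => Finset.sum_nonneg fun _ _ => abs_nonneg _
  have hK1 : ∀ x i, |dd i η x| ≤ K := fun x i => by
    have h1 := Finset.single_le_sum (f := fun i => |dd i η x|) (fun _ _ => abs_nonneg _)
      (Finset.mem_univ i)
    have h2 := (le_abs_self _).trans (hK x)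
    have h3 := hs_nonneg η x
    linarith
  have hK2 : ∀ x i j, |dd i (dd j η) x| ≤ K := fun x i j => by
    have h1 := abs_dd_dd_le_hs η x i j
    have h2 := (le_abs_self _).trans (hK x)
    linarith [hsum0 x]
  have hK0 : 0 ≤ K := (norm_nonneg _).trans (hK 0)
  set D : ℝ := 1 + d * (d * (2 * (K + K))) with hD
  have hD1 : 1 ≤ D := by rw [hD]; exact le_add_of_nonneg_right (by positivity)
  refine ⟨min δ₁ 1, C₁ * D ^ n, by positivity, by positivity, ?_⟩
  intro w a G N S hw hG hN hS ha hPDE hwN hwS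
  have hu : ContDiff ℝ 2 (fun y => η y * w y) := hη.mul hw
  have hts : tsupport (fun y => η y * w y) ⊆ closedBall 0 (3 / 4) := by
    refine (tsupport_mul_subset_left (f := η) (g := w)).trans ?_
    rw [η.tsupport_eq]
  have hc : HasCompactSupport (fun y => η y * w y) := hηc.mul_right
  refine ⟨fun y => η y * w y, hu, hc, fun x => ?_, fun x hx => ?_, ?_⟩
  · by_cases hx : x ∈ ball (0 : Euc d) 1
    · rw [abs_mul, abs_of_nonneg η.nonneg]
      calc η x * |w x| ≤ 1 * N := mul_le_mul η.le_one (hwN x hx) (abs_nonneg _) zero_le_one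
        _ = N := one_mul N
    · have : η x = 0 := η.zero_of_le_dist (by
        rw [mem_ball, not_lt] at hx
        change (3 / 4 : ℝ) ≤ _
        linarith)
      simpa [this] using hN
  · have : η x = 1 := η.one_of_mem_closedBall (ball_subset_closedBall hx)
    simp [this]
  · have hH : 0 ≤ D * (G + N + S) := by positivity
    have := h hu hc (hts.trans (closedBall_subset_ball (by norm_num))) hH ?_
    · rwa [mul_pow, ← mul_assoc] at this
    intro x hx
    set u : Euc d → ℝ := fun y => η y * w y
    have hasm : ∀ i j, |a x i j - if i = j then 1 else 0| ≤ δ₁ :=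
      fun i j => (ha x hx i j).trans (min_le_left _ _)
    have ha2 : ∀ i j, |a x i j| ≤ 2 := fun i j => by
      have h1 := (ha x hx i j).trans (min_le_right _ _)
      have h2 : |(if i = j then (1 : ℝ) else 0)| ≤ 1 := by split_ifs <;> simp
      calc |a x i j| = |(a x i j - if i = j then 1 else 0) + if i = j then 1 else 0| := by
            congr 1; ring
        _ ≤ _ := (abs_add_le _ _).trans (by linarith)
    have hlap : lap u x = ∑ i, ∑ j, (if i = j then 1 else 0) * dd i (dd j u) x := by
      simp [lap]
    have e1 : lap u x = (∑ i, ∑ j, a x i j * dd i (dd j u) x)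
        - ∑ i, ∑ j, (a x i j - if i = j then 1 else 0) * dd i (dd j u) x := by
      rw [hlap, ← Finset.sum_sub_distrib]
      refine Finset.sum_congr rfl fun i _ => ?_
      rw [← Finset.sum_sub_distrib]
      exact Finset.sum_congr rfl fun j _ => by ring
    have e2 : ∑ i, ∑ j, a x i j * dd i (dd j u) x =
        η x * (∑ i, ∑ j, a x i j * dd i (dd j w) x) + ∑ i, ∑ j, a x i j *
          (dd i (dd j η) x * w x + (dd j η x * dd i w x + dd i η x * dd j w x)) := by
      rw [Finset.mul_sum, ← Finset.sum_add_distrib]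
      refine Finset.sum_congr rfl fun i _ => ?_
      rw [Finset.mul_sum, ← Finset.sum_add_distrib]
      refine Finset.sum_congr rfl fun j _ => ?_
      rw [dd_dd_mul hη hw]; ring
    have b1 : |∑ i, ∑ j, (a x i j - if i = j then 1 else 0) * dd i (dd j u) x| ≤ δ₁ * hs u x := by
      unfold hs
      rw [Finset.mul_sum]
      refine (Finset.abs_sum_le_sum_abs _ _).trans (Finset.sum_le_sum fun i _ => ?_)
      rw [Finset.mul_sum]
      refine (Finset.abs_sum_le_sum_abs _ _).trans (Finset.sum_le_sum fun j _ => ?_)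
      rw [abs_mul]
      exact mul_le_mul_of_nonneg_right (hasm i j) (abs_nonneg _)
    have b2 : |∑ i, ∑ j, a x i j *
          (dd i (dd j η) x * w x + (dd j η x * dd i w x + dd i η x * dd j w x))| ≤
        ∑ _i : Fin d, ∑ _j : Fin d, 2 * (K * N + (K * S + K * S)) := by
      refine (Finset.abs_sum_le_sum_abs _ _).trans (Finset.sum_le_sum fun i _ => ?_)
      refine (Finset.abs_sum_le_sum_abs _ _).trans (Finset.sum_le_sum fun j _ => ?_)
      rw [abs_mul]
      refine mul_le_mul (ha2 i j) ?_ (abs_nonneg _) (by norm_num)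
      refine (abs_add_le _ _).trans (add_le_add ?_ ((abs_add_le _ _).trans (add_le_add ?_ ?_)))
      · rw [abs_mul]; exact mul_le_mul (hK2 x i j) (hwN x hx) (abs_nonneg _) hK0
      · rw [abs_mul]; exact mul_le_mul (hK1 x j) (hwS x hx i) (abs_nonneg _) hK0
      · rw [abs_mul]; exact mul_le_mul (hK1 x i) (hwS x hx j) (abs_nonneg _) hK0
    have b3 : |η x * (∑ i, ∑ j, a x i j * dd i (dd j w) x)| ≤ G := by
      rw [abs_mul, abs_of_nonneg η.nonneg]
      calc _ ≤ 1 * G := mul_le_mul η.le_one (hPDE x hx) (abs_nonneg _) zero_le_one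
        _ = G := one_mul G
    rw [e1, e2]
    refine (abs_sub _ _).trans (add_le_add ((abs_add_le _ _).trans ((add_le_add b3 b2).trans ?_)) b1)
    simp only [Finset.sum_const, Finset.card_univ, Fintype.card_fin, nsmul_eq_mul]
    have hdd : (0 : ℝ) ≤ d * (d * 2) := by positivity
    have p1 : 0 ≤ K * N := by positivity
    have p2 : 0 ≤ d * (d * (2 * (K + K))) * G := by positivity
    have p3 := mul_nonneg hdd p1
    rw [hD]
    nlinarith

lemma le_pow_div_pow_add {h a : ℝ} (hh : 0 ≤ h) (ha : 0 < a) (n : ℕ) :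
    h ≤ h ^ (n + 1) / a ^ n + a := by
  rcases le_total h a with h1 | h1
  · have : 0 ≤ h ^ (n + 1) / a ^ n := by positivity
    linarith
  · have h2 : h ≤ h ^ (n + 1) / a ^ n := by
      rw [le_div_iff₀ (by positivity), pow_succ']
      gcongr
    linarith

lemma norm_fderiv_dd_le_hs (u : Euc d → ℝ) (i : Fin d) (x : Euc d) :
    ‖fderiv ℝ (dd i u) x‖ ≤ hs u x := by
  refine (norm_fderiv_le_sum (dd i u) x).trans ?_
  unfold hs
  exact Finset.sum_le_sum fun k _ =>
    Finset.single_le_sum (f := fun j => |dd k (dd j u) x|) (fun _ _ => abs_nonneg _)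
      (Finset.mem_univ i)

lemma hasDerivAt_integral_mul_comp_sq_smul {φ g : Euc d → ℝ} (hφ : Continuous φ)
    (hφc : HasCompactSupport φ) (hg : ContDiff ℝ 1 g) (hgc : HasCompactSupport g) (τ : ℝ) :
    HasDerivAt (fun s : ℝ => ∫ z, φ z * g (s ^ 2 • z))
      (∫ z, φ z * fderiv ℝ g (τ ^ 2 • z) ((2 * τ) • z)) τ := by
  obtain ⟨M, hM⟩ := (hgc.fderiv ℝ).exists_bound_of_continuous (hg.continuous_fderiv one_ne_zero)
  have hM0 : 0 ≤ M := (norm_nonneg _).trans (hM 0)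
  have hi : ∀ s : ℝ, Integrable (fun z => φ z * g (s ^ 2 • z)) := fun s =>
    (hφ.mul (hg.continuous.comp (by fun_prop))).integrable_of_hasCompactSupport hφc.mul_right
  refine (hasDerivAt_integral_of_dominated_loc_of_deriv_le
    (F := fun (s : ℝ) z => φ z * g (s ^ 2 • z))
    (F' := fun (s : ℝ) z => φ z * fderiv ℝ g (s ^ 2 • z) ((2 * s) • z))
    (bound := fun z => |φ z| * (M * (2 * (|τ| + 1) * ‖z‖)))
    (ball_mem_nhds τ one_pos) (Filter.Eventually.of_forall fun s => (hi s).aestronglyMeasurable)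
    (hi τ) ?_ ?_ ?_ ?_).2
  · refine Continuous.aestronglyMeasurable (hφ.mul ?_)
    exact ((hg.continuous_fderiv one_ne_zero).comp (by fun_prop)).clm_apply (by fun_prop)
  · refine Filter.Eventually.of_forall fun z s hs => ?_
    rw [norm_mul, Real.norm_eq_abs]
    refine mul_le_mul_of_nonneg_left ?_ (abs_nonneg _)
    refine (ContinuousLinearMap.le_opNorm _ _).trans ?_
    refine mul_le_mul (hM _) ?_ (norm_nonneg _) hM0
    rw [norm_smul]
    refine mul_le_mul_of_nonneg_right ?_ (norm_nonneg _)
    rw [norm_mul, Real.norm_eq_abs, Real.norm_eq_abs, abs_of_pos (two_pos : (0:ℝ) < 2)]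
    rw [mem_ball, Real.dist_eq] at hs
    have := abs_sub_abs_le_abs_sub s τ
    linarith
  · refine Continuous.integrable_of_hasCompactSupport (by fun_prop) ?_
    exact (hφc.comp_left (g := fun t => |t|) abs_zero).mul_right
  · refine Filter.Eventually.of_forall fun z s _ => ?_
    have h1 : HasDerivAt (fun s : ℝ => s ^ 2 • z) ((2 * s) • z) s := by
      have := (hasDerivAt_pow 2 s).smul_const z
      simpa using this
    exact ((hg.differentiable one_ne_zero _).hasFDerivAt.comp_hasDerivAt s h1).const_mul (φ z)

lemma dd_comp_smul (u : Euc d → ℝ) (hu : ContDiff ℝ 1 u) (c : ℝ) (i : Fin d) (x : Euc d) :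
    dd i (fun z => u (c • z)) x = c * dd i u (c • x) := by
  have h1 : HasFDerivAt (fun z : Euc d => c • z) (c • ContinuousLinearMap.id ℝ (Euc d)) x :=
    (hasFDerivAt_id x).const_smul c
  have h2 := ((hu.differentiable one_ne_zero (c • x)).hasFDerivAt).comp x h1
  unfold dd
  have h3 : fderiv ℝ (fun z => u (c • z)) x = _ := h2.fderiv
  rw [h3]
  simp

/-- Interpolated Morrey estimate of the gradient at the origin. -/
lemma abs_dd_zero_le (d : ℕ) {n : ℕ} (hn : 3 ≤ n) (hnd : 2 * d ≤ n) : ∃ C : ℝ, 0 < C ∧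
    ∀ {u : Euc d → ℝ} {K N t : ℝ}, ContDiff ℝ 2 u → HasCompactSupport u → 0 < K →
      ∫ x, hs u x ^ n ≤ K ^ n → (∀ x, |u x| ≤ N) → 0 < t → t ≤ 1 → ∀ i,
      |dd i u 0| ≤ C * (t * K + N / t ^ 2) := by
  let η : ContDiffBump (0 : Euc d) := ⟨1 / 2, 1, by norm_num, by norm_num⟩
  set φ : Euc d → ℝ := η.normed volume with hφdef
  have hφ : ContDiff ℝ 1 φ := η.contDiff_normed
  have hφc : HasCompactSupport φ := η.hasCompactSupport_normed
  have hφi : ∫ x, φ x = 1 := η.integral_normed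
  have hφs : ∀ x, x ∉ ball (0 : Euc d) 1 → φ x = 0 := fun x hx => by
    by_contra h
    have : x ∈ Function.support φ := h
    rw [hφdef, η.support_normed_eq] at this
    exact hx this
  obtain ⟨P, hP⟩ := hφc.exists_bound_of_continuous hφ.continuous
  have hP0 : 0 ≤ P := (norm_nonneg _).trans (hP 0)
  have hω := omg_pos d
  set J : ℝ := ∑ i, ∫ x, |dd i φ x| with hJ
  have hJi : ∀ i, ∫ x, |dd i φ x| ≤ J := fun i =>
    Finset.single_le_sum (f := fun i => ∫ x, |dd i φ x|)
      (fun _ _ => integral_nonneg fun _ => abs_nonneg _) (Finset.mem_univ i)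
  have hJ0 : 0 ≤ J := Finset.sum_nonneg fun _ _ => integral_nonneg fun _ => abs_nonneg _
  refine ⟨2 * (P * (1 + omg d)) + J + 1, by positivity, ?_⟩
  intro u K N t hu hc hK hKn hN ht ht1 i
  have hN0 : 0 ≤ N := (abs_nonneg _).trans (hN 0)
  have hu1 : ContDiff ℝ 1 u := hu.of_le (by norm_num)
  have hg : ContDiff ℝ 1 (dd i u) := dd_contDiff (n := 2) (m := 1) hu (by norm_num) i
  have hgc := dd_hasCompactSupport hc i
  have hder := hasDerivAt_integral_mul_comp_sq_smul hφ.continuous hφc hg hgc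
  set A : ℝ → ℝ := fun s : ℝ => ∫ z, φ z * dd i u (s ^ 2 • z) with hA
  have hA0 : A 0 = dd i u 0 := by
    simp only [hA]
    norm_num
    rw [integral_mul_const, hφi, one_mul]
  have hdb : ∀ τ ∈ Set.Icc (0 : ℝ) t,
      ‖∫ z, φ z * fderiv ℝ (dd i u) (τ ^ 2 • z) ((2 * τ) • z)‖ ≤ 2 * (P * (1 + omg d)) * K := by
    intro τ hτ
    rcases hτ.1.eq_or_lt with h0 | h0
    · subst h0
      simp only [mul_zero, zero_smul, map_zero, integral_zero, norm_zero]
      positivity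
    have hτ1 : τ ≤ 1 := hτ.2.trans ht1
    obtain ⟨k, rfl⟩ : ∃ k, n = k + 1 := ⟨n - 1, by omega⟩
    set a : ℝ := K / τ with ha
    have ha0 : 0 < a := by positivity
    have hi1 : Integrable (fun z => hs u (τ ^ 2 • z) ^ (k + 1)) :=
      (hs_pow_integrable hu hc (by omega)).comp_smul (by positivity)
    have hi2 : Integrable (fun z => (ball (0 : Euc d) 1).indicator (fun _ => a) z) :=
      (integrable_indicator_iff measurableSet_ball).2 (integrableOn_const measure_ball_lt_top.ne)
    have hpt : ∀ z, ‖φ z * fderiv ℝ (dd i u) (τ ^ 2 • z) ((2 * τ) • z)‖ ≤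
        2 * τ * P * (hs u (τ ^ 2 • z) ^ (k + 1) / a ^ k +
          (ball (0 : Euc d) 1).indicator (fun _ => a) z) := by
      intro z
      have hh := hs_nonneg u (τ ^ 2 • z)
      by_cases hz : z ∈ ball (0 : Euc d) 1
      · rw [Set.indicator_of_mem hz, norm_mul]
        have hz1 : ‖z‖ ≤ 1 := (mem_ball_zero_iff.1 hz).le
        have e1 : ‖fderiv ℝ (dd i u) (τ ^ 2 • z) ((2 * τ) • z)‖ ≤ hs u (τ ^ 2 • z) * (2 * τ) := by
          refine (ContinuousLinearMap.le_opNorm _ _).trans ?_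
          refine mul_le_mul (norm_fderiv_dd_le_hs u i _) ?_ (norm_nonneg _) hh
          rw [norm_smul, Real.norm_eq_abs, abs_of_pos (by positivity)]
          exact mul_le_of_le_one_right (by positivity) hz1
        calc _ ≤ P * (hs u (τ ^ 2 • z) * (2 * τ)) := mul_le_mul (hP z) e1 (norm_nonneg _) hP0
          _ = 2 * τ * P * hs u (τ ^ 2 • z) := by ring
          _ ≤ _ := by
            gcongr
            exact le_pow_div_pow_add hh ha0 k
      · rw [hφs z hz, Set.indicator_of_notMem hz]
        simp only [zero_mul, norm_zero]
        positivity
    refine (norm_integral_le_of_norm_le (((hi1.div_const _).add hi2).const_mul _)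
      (Filter.Eventually.of_forall hpt)).trans ?_
    rw [integral_const_mul, integral_add' (hi1.div_const _) hi2, integral_div,
      Measure.integral_comp_smul volume (fun z => hs u z ^ (k + 1)),
      integral_indicator measurableSet_ball, setIntegral_const, smul_eq_mul, smul_eq_mul,
      finrank_euclideanSpace_fin]
    change 2 * τ * P * (_ / a ^ k + omg d * a) ≤ _
    rw [abs_of_pos (by positivity), ← pow_mul]
    have e2 : (τ ^ (2 * d))⁻¹ * (∫ x, hs u x ^ (k + 1)) / a ^ k ≤ a := by
      rw [div_le_iff₀ (by positivity), inv_mul_le_iff₀ (by positivity), ← pow_succ']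
      refine hKn.trans ?_
      rw [ha, div_pow, ← mul_div_assoc, le_div_iff₀ (by positivity), mul_comm]
      exact mul_le_mul_of_nonneg_right (pow_le_pow_of_le_one h0.le hτ1 hnd) (by positivity)
    calc _ ≤ 2 * τ * P * (a + omg d * a) := by gcongr
      _ = _ := by rw [ha]; field_simp
  have hmv : ‖A t - A 0‖ ≤ 2 * (P * (1 + omg d)) * K * ‖t - 0‖ :=
    (convex_Icc (0 : ℝ) t).norm_image_sub_le_of_norm_hasDerivWithin_le
      (fun τ _ => (hder τ).hasDerivWithinAt) hdb ⟨le_rfl, ht.le⟩ ⟨ht.le, le_rfl⟩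
  have hAt : |A t| ≤ J * (N / t ^ 2) := by
    have hv : ContDiff ℝ 1 (fun z => u (t ^ 2 • z)) := hu1.comp (by fun_prop)
    have hdv : Continuous (dd i (fun z => u (t ^ 2 • z))) := dd_continuous hv i
    have hdφ : Continuous (dd i φ) := dd_continuous hφ i
    have e1 : A t = (t ^ 2)⁻¹ * ∫ z, φ z * dd i (fun z => u (t ^ 2 • z)) z := by
      rw [← integral_const_mul]
      refine integral_congr_ae (Filter.Eventually.of_forall fun z => ?_)
      simp only
      rw [dd_comp_smul u hu1]
      field_simp
    have hI : Integrable (fun z => dd i φ z * u (t ^ 2 • z)) :=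
      (hdφ.mul hv.continuous).integrable_of_hasCompactSupport
        (dd_hasCompactSupport hφc i).mul_right
    have hI' : Integrable (fun z => |dd i φ z|) :=
      (hdφ.integrable_of_hasCompactSupport (dd_hasCompactSupport hφc i)).abs
    rw [e1, integral_mul_dd hφ hv i hI
      ((hφ.continuous.mul hdv).integrable_of_hasCompactSupport hφc.mul_right)
      ((hφ.continuous.mul hv.continuous).integrable_of_hasCompactSupport hφc.mul_right),
      abs_mul, abs_of_pos (by positivity), abs_neg]
    have e2 : |∫ z, dd i φ z * u (t ^ 2 • z)| ≤ (∫ z, |dd i φ z|) * N := by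
      rw [← integral_mul_const, ← Real.norm_eq_abs]
      refine norm_integral_le_of_norm_le (hI'.mul_const _) (Filter.Eventually.of_forall fun z => ?_)
      rw [norm_mul, Real.norm_eq_abs, Real.norm_eq_abs]
      exact mul_le_mul_of_nonneg_left (hN _) (abs_nonneg _)
    calc _ ≤ (t ^ 2)⁻¹ * (J * N) := by
          gcongr
          exact e2.trans (mul_le_mul_of_nonneg_right (hJi i) hN0)
      _ = _ := by field_simp
  rw [sub_zero, Real.norm_eq_abs, Real.norm_eq_abs, abs_of_pos ht, hA0] at hmv
  have h5 : |dd i u 0| ≤ |A t| + |A t - dd i u 0| := by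
    have := abs_sub (A t) (A t - dd i u 0)
    simpa using this
  have p1 : 0 ≤ N / t ^ 2 := by positivity
  have p2 : 0 ≤ t * K := by positivity
  have p3 : 0 ≤ 2 * (P * (1 + omg d)) := by positivity
  nlinarith [mul_nonneg p3 p1, mul_nonneg hJ0 p2]

/-- The sum of the absolute values of the first-order partial derivatives. -/
def gs (u : Euc d → ℝ) (x : Euc d) : ℝ := ∑ i, |dd i u x|

lemma gs_nonneg (u : Euc d → ℝ) (x : Euc d) : 0 ≤ gs u x :=
  Finset.sum_nonneg fun _ _ => abs_nonneg _

lemma abs_dd_le_gs (u : Euc d → ℝ) (x : Euc d) (i : Fin d) : |dd i u x| ≤ gs u x :=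
  Finset.single_le_sum (f := fun i => |dd i u x|) (fun _ _ => abs_nonneg _) (Finset.mem_univ i)

lemma gs_continuous {u : Euc d → ℝ} (hu : ContDiff ℝ 1 u) : Continuous (gs u) :=
  continuous_finsetSum _ fun i _ => (dd_continuous hu i).abs

lemma dd_eq_of_eqOn {u w : Euc d → ℝ} {U : Set (Euc d)} (hU : IsOpen U) (h : Set.EqOn u w U)
    (i : Fin d) : Set.EqOn (dd i u) (dd i w) U := fun x hx => by
  unfold dd
  rw [(h.eventuallyEq_of_mem (hU.mem_nhds hx)).fderiv_eq]

lemma fderiv_eq_sum_dd (w : Euc d → ℝ) (x v : Euc d) :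
    fderiv ℝ w x v = ∑ k, v k * dd k w x := by
  conv_lhs => rw [← (EuclideanSpace.basisFun (Fin d) ℝ).sum_repr v]
  simp [map_sum, dd]

lemma dd_comp_affine {w : Euc d → ℝ} (hw : ContDiff ℝ 1 w) (x : Euc d) (T : Euc d →L[ℝ] Euc d)
    (i : Fin d) (y : Euc d) : dd i (fun y => w (x + T y)) y =
      ∑ k, (T (EuclideanSpace.single i 1)) k * dd k w (x + T y) := by
  have h1 : HasFDerivAt (fun y => x + T y) T y := T.hasFDerivAt.const_add x
  have h2 := ((hw.differentiable one_ne_zero (x + T y)).hasFDerivAt).comp y h1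
  have h3 : fderiv ℝ (fun y => w (x + T y)) y = _ := h2.fderiv
  unfold dd
  rw [h3, ContinuousLinearMap.comp_apply, fderiv_eq_sum_dd]
  rfl

lemma dd_finsetSum {ι : Type*} (s : Finset ι) {f : ι → Euc d → ℝ} (hf : ∀ k, ContDiff ℝ 1 (f k))
    (i : Fin d) (x : Euc d) : dd i (fun y => ∑ k ∈ s, f k y) x = ∑ k ∈ s, dd i (f k) x := by
  unfold dd
  rw [fderiv_fun_sum fun k _ => (hf k).differentiable one_ne_zero x]
  simp

lemma dd_dd_comp_affine {w : Euc d → ℝ} (hw : ContDiff ℝ 2 w) (x : Euc d)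
    (T : Euc d →L[ℝ] Euc d) (i j : Fin d) (y : Euc d) : dd i (dd j (fun y => w (x + T y))) y =
      ∑ l, ∑ k, (T (EuclideanSpace.single i 1)) k * (T (EuclideanSpace.single j 1)) l *
        dd k (dd l w) (x + T y) := by
  have hw1 : ContDiff ℝ 1 w := hw.of_le (by norm_num)
  have hl : ∀ l, ContDiff ℝ 1 (dd l w) := dd_contDiff (n := 2) (m := 1) hw (by norm_num)
  have hc : ∀ l, ContDiff ℝ 1 (fun y => dd l w (x + T y)) := fun l => (hl l).comp (by fun_prop)
  have h1 : dd j (fun y => w (x + T y)) = fun y =>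
      ∑ l, (T (EuclideanSpace.single j 1)) l * dd l w (x + T y) :=
    funext fun y => dd_comp_affine hw1 x T j y
  rw [h1, dd_finsetSum _ fun l => contDiff_const.mul (hc l)]
  refine Finset.sum_congr rfl fun l _ => ?_
  rw [dd_const_mul (hc l), dd_comp_affine (hl l), Finset.mul_sum]
  exact Finset.sum_congr rfl fun k _ => by ring

lemma dd_comp_scale {w : Euc d → ℝ} (hw : ContDiff ℝ 1 w) (x : Euc d) (s : ℝ) (i : Fin d)
    (y : Euc d) : dd i (fun y => w (x + s • y)) y = s * dd i w (x + s • y) := by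
  have := dd_comp_affine hw x (s • ContinuousLinearMap.id ℝ (Euc d)) i y
  simpa [Pi.single_apply] using this

lemma dd_dd_comp_scale {w : Euc d → ℝ} (hw : ContDiff ℝ 2 w) (x : Euc d) (s : ℝ) (i j : Fin d)
    (y : Euc d) : dd i (dd j (fun y => w (x + s • y))) y = s * s * dd i (dd j w) (x + s • y) := by
  have := dd_dd_comp_affine hw x (s • ContinuousLinearMap.id ℝ (Euc d)) i j y
  simpa [Pi.single_apply] using this

lemma gs_comp_scale {w : Euc d → ℝ} (hw : ContDiff ℝ 1 w) (x : Euc d) {s : ℝ} (hs : 0 ≤ s)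
    (y : Euc d) : gs (fun y => w (x + s • y)) y = s * gs w (x + s • y) := by
  unfold gs
  rw [Finset.mul_sum]
  exact Finset.sum_congr rfl fun i _ => by rw [dd_comp_scale hw, abs_mul, abs_of_nonneg hs]

lemma hs_comp_scale {w : Euc d → ℝ} (hw : ContDiff ℝ 2 w) (x : Euc d) (s : ℝ)
    (y : Euc d) : hs (fun y => w (x + s • y)) y = s * s * hs w (x + s • y) := by
  unfold hs
  simp only [Finset.mul_sum]
  exact Finset.sum_congr rfl fun i _ => Finset.sum_congr rfl fun j _ => by
    rw [dd_dd_comp_scale hw, abs_mul, abs_of_nonneg (mul_self_nonneg s)]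

/-- Interior estimate at unit scale for an operator close to the Laplacian, with a bounded
right-hand side and a gradient term. -/
lemma unit_scale_estimate (d : ℕ) {n : ℕ} (hn : 3 ≤ n) (hnd : 2 * d ≤ n) :
    ∃ δ C : ℝ, 0 < δ ∧ 0 < C ∧
    ∀ {w : Euc d → ℝ} {a : Euc d → Fin d → Fin d → ℝ} {F N : ℝ}, ContDiff ℝ 2 w → 0 < F → 0 ≤ N →
      (∀ x ∈ ball (0 : Euc d) 1, ∀ i j, |a x i j - if i = j then 1 else 0| ≤ δ) →
      (∀ x ∈ ball (0 : Euc d) 1, |∑ i, ∑ j, a x i j * dd i (dd j w) x| ≤ F + gs w x) →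
      (∀ x ∈ ball (0 : Euc d) 1, |w x| ≤ N) →
      gs w 0 ≤ C * (F + N) ∧
        ∫ y in ball (0 : Euc d) (1 / 2), hs w ((1 / 2 : ℝ) • y) ^ n ≤ C * (F + N) ^ n := by
  obtain ⟨δ, C₁, hδ, hC₁, h₁⟩ := exists_localization_of_close_laplacian d hn
  obtain ⟨C₂, hC₂, h₂⟩ := abs_dd_zero_le d hn hnd
  set D : ℝ := C₁ + 1 with hD
  set t : ℝ := 1 / (8 * (d * C₂ * D + 1)) with ht
  have hB0 : 0 < 8 * (d * C₂ * D + 1) := by positivity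
  have ht0 : 0 < t := by positivity
  have ht1 : t ≤ 1 := by
    rw [ht, div_le_one hB0]
    have : 0 ≤ d * C₂ * D := by positivity
    linarith
  have htB : d * C₂ * D * t ≤ 1 / 8 := by
    rw [ht, mul_one_div, div_le_iff₀ hB0]; linarith
  set C₃ : ℝ := 1 + 4 * (d * C₂ / t ^ 2) with hC₃
  have hC₃1 : 1 ≤ C₃ := le_add_of_nonneg_right (by positivity)
  refine ⟨δ, C₃ + 4 ^ n * (C₁ * (1 + 2 * C₃) ^ n), hδ, by positivity, ?_⟩
  intro w a F N hw hF hN ha hPDE hwN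
  have hw1 : ContDiff ℝ 1 w := hw.of_le (by norm_num)
  have hgc := gs_continuous hw1
  obtain ⟨x, hx, hmax⟩ := (isCompact_closedBall (0 : Euc d) 1).exists_isMaxOn
    ⟨0, mem_closedBall_self zero_le_one⟩
    (f := fun x => (1 - ‖x‖) * gs w x) (by fun_prop)
  set Q : ℝ := (1 - ‖x‖) * gs w x with hQ
  have hQle : ∀ y ∈ ball (0 : Euc d) 1, (1 - ‖y‖) * gs w y ≤ Q := fun y hy =>
    hmax (ball_subset_closedBall hy)
  have hx1 : ‖x‖ ≤ 1 := mem_closedBall_zero_iff.1 hx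
  have hQ0 : 0 ≤ Q := mul_nonneg (by linarith) (gs_nonneg w x)
  have loc : ∀ (z : Euc d) (s : ℝ), 0 < s → s ≤ 1 → (∀ y ∈ ball (0 : Euc d) 1,
      z + s • y ∈ ball (0 : Euc d) 1 ∧ s * gs w (z + s • y) ≤ Q) →
      ∃ u : Euc d → ℝ, ContDiff ℝ 2 u ∧ HasCompactSupport u ∧ (∀ x, |u x| ≤ N) ∧
        (∀ y ∈ ball (0 : Euc d) (1 / 2), u y = w (z + s • y)) ∧
        ∫ x, hs u x ^ n ≤ C₁ * (F + N + 2 * Q) ^ n := by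
    intro z s hs0 hs1 hz
    have := h₁ (w := fun y => w (z + s • y)) (a := fun y => a (z + s • y)) (G := F + Q) (N := N)
      (S := Q) (hw.comp (by fun_prop)) (by positivity) hN hQ0 (fun y hy => ha _ (hz y hy).1)
      (fun y hy => ?_) (fun y hy => hwN _ (hz y hy).1) (fun y hy i => ?_)
    · rwa [show F + Q + N + Q = F + N + 2 * Q by ring] at this
    · have h4 : ∑ i, ∑ j, a (z + s • y) i j * dd i (dd j (fun y => w (z + s • y))) y =
          s * s * ∑ i, ∑ j, a (z + s • y) i j * dd i (dd j w) (z + s • y) := by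
        simp only [Finset.mul_sum]
        refine Finset.sum_congr rfl fun i _ => Finset.sum_congr rfl fun j _ => ?_
        rw [dd_dd_comp_scale hw]; ring
      rw [h4, abs_mul, abs_of_pos (by positivity)]
      calc _ ≤ s * s * (F + gs w (z + s • y)) := by
            gcongr; exact hPDE _ (hz y hy).1
        _ = s * s * F + s * (s * gs w (z + s • y)) := by ring
        _ ≤ 1 * F + 1 * Q := by
            gcongr
            · nlinarith
            · exact mul_nonneg hs0.le (gs_nonneg _ _)
            · exact (hz y hy).2
        _ = F + Q := by ring
    · have h5 := abs_dd_le_gs (fun y => w (z + s • y)) y i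
      rw [gs_comp_scale hw1 z hs0.le] at h5
      exact h5.trans (hz y hy).2
  have hQ1 : Q ≤ C₃ * (F + N) := by
    rcases hx1.eq_or_lt with h | h
    · rw [hQ, h, sub_self, zero_mul]; positivity
    set s : ℝ := (1 - ‖x‖) / 2 with hsx
    have hs0 : 0 < s := by rw [hsx]; linarith
    obtain ⟨u, hu, huc, huN, huw, hui⟩ := loc x s hs0 (by rw [hsx]; linarith [norm_nonneg x]) (by
      intro y hy
      have hy1 := mem_ball_zero_iff.1 hy
      have h6 : ‖x + s • y‖ ≤ ‖x‖ + s := (norm_add_le _ _).trans (by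
        rw [norm_smul, Real.norm_eq_abs, abs_of_pos hs0]; nlinarith)
      have h7 : x + s • y ∈ ball (0 : Euc d) 1 := by
        rw [mem_ball_zero_iff]; linarith
      exact ⟨h7, (mul_le_mul_of_nonneg_right (by linarith) (gs_nonneg _ _)).trans (hQle _ h7)⟩)
    have hK : ∫ x, hs u x ^ n ≤ (D * (F + N + 2 * Q)) ^ n := by
      refine hui.trans ?_
      rw [mul_pow]
      refine mul_le_mul_of_nonneg_right ?_ (by positivity)
      calc C₁ ≤ D := by rw [hD]; linarith
        _ ≤ D ^ n := le_self_pow₀ (by rw [hD]; linarith) (by omega)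
    have h8 : ∀ i, |dd i u 0| = s * |dd i w x| := fun i => by
      have := dd_eq_of_eqOn isOpen_ball huw i (mem_ball_self (by norm_num))
      rw [this, dd_comp_scale hw1, abs_mul, abs_of_pos hs0]
      simp
    have h9 : s * gs w x ≤ d * (C₂ * (t * (D * (F + N + 2 * Q)) + N / t ^ 2)) := by
      unfold gs
      rw [Finset.mul_sum]
      calc _ ≤ ∑ _i : Fin d, C₂ * (t * (D * (F + N + 2 * Q)) + N / t ^ 2) := by
            refine Finset.sum_le_sum fun i _ => ?_
            rw [← h8]
            exact h₂ hu huc (by positivity) hK huN ht0 ht1 i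
        _ = _ := by simp
    have h10 : s * gs w x = Q / 2 := by rw [hsx, hQ]; ring
    rw [h10] at h9
    have h11 : d * (C₂ * (t * (D * (F + N + 2 * Q)) + N / t ^ 2)) =
        d * C₂ * D * t * (F + N + 2 * Q) + d * C₂ / t ^ 2 * N := by ring
    have h12 : d * C₂ * D * t * (F + N + 2 * Q) ≤ 1 / 8 * (F + N + 2 * Q) := by gcongr
    have h13 : 0 ≤ d * C₂ / t ^ 2 * F := by positivity
    rw [hC₃]
    nlinarith
  refine ⟨?_, ?_⟩
  · have := hQle 0 (mem_ball_self one_pos)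
    rw [norm_zero, sub_zero, one_mul] at this
    refine (this.trans hQ1).trans ?_
    gcongr
    exact le_add_of_nonneg_right (by positivity)
  · obtain ⟨u, hu, huc, huN, huw, hui⟩ := loc 0 (1 / 2) (by norm_num) (by norm_num) (by
      intro y hy
      have hy1 := mem_ball_zero_iff.1 hy
      have h6 : ‖0 + (1 / 2 : ℝ) • y‖ ≤ 1 / 2 := by
        rw [zero_add, norm_smul]; norm_num; linarith
      have h7 : 0 + (1 / 2 : ℝ) • y ∈ ball (0 : Euc d) 1 := by
        rw [mem_ball_zero_iff]; linarith
      exact ⟨h7, (mul_le_mul_of_nonneg_right (by linarith) (gs_nonneg _ _)).trans (hQle _ h7)⟩)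
    have h14 : ∀ y ∈ ball (0 : Euc d) (1 / 2), hs w ((1 / 2 : ℝ) • y) ^ n = 4 ^ n * hs u y ^ n := by
      intro y hy
      have e1 : hs u y = hs (fun y => w (0 + (1 / 2 : ℝ) • y)) y := by
        unfold hs
        refine Finset.sum_congr rfl fun i _ => Finset.sum_congr rfl fun j _ => ?_
        rw [dd_eq_of_eqOn isOpen_ball (dd_eq_of_eqOn isOpen_ball huw j) i hy]
      rw [e1, hs_comp_scale hw, zero_add, ← mul_pow]
      congr 1; ring
    rw [setIntegral_congr_fun measurableSet_ball h14, integral_const_mul]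
    have h15 : ∫ y in ball (0 : Euc d) (1 / 2), hs u y ^ n ≤ ∫ y, hs u y ^ n :=
      setIntegral_le_integral (hs_pow_integrable hu huc (by omega))
        (Filter.Eventually.of_forall fun y => pow_nonneg (hs_nonneg u y) n)
    calc _ ≤ 4 ^ n * (C₁ * (F + N + 2 * Q) ^ n) := by gcongr; exact h15.trans hui
      _ ≤ 4 ^ n * (C₁ * ((1 + 2 * C₃) * (F + N)) ^ n) := by gcongr; linarith
      _ = 4 ^ n * (C₁ * (1 + 2 * C₃) ^ n) * (F + N) ^ n := by rw [mul_pow]; ring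
      _ ≤ _ := by
        gcongr
        exact le_add_of_nonneg_left (by positivity)

open scoped MatrixOrder in
/-- Square factorisation of a uniformly elliptic symmetric matrix. -/
lemma exists_factorization {S : Matrix (Fin d) (Fin d) ℝ} (hS : S.transpose = S) {l : ℝ}
    (hl : 0 < l) (h : ∀ ξ : Fin d → ℝ, l * ∑ i, ξ i ^ 2 ≤ ∑ i, ∑ j, ξ i * S i j * ξ j) :
    ∃ L B : Matrix (Fin d) (Fin d) ℝ, L * L.transpose = S ∧ B * L = 1 ∧ L * B = 1 ∧
      (∀ i j, L i j ^ 2 ≤ S i i) ∧ ∀ i j, B i j ^ 2 ≤ 1 / l := by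
  have hq : ∀ ξ : Fin d → ℝ, ξ ⬝ᵥ S.mulVec ξ = ∑ i, ∑ j, ξ i * S i j * ξ j := fun ξ => by
    simp [dotProduct, Matrix.mulVec, Finset.mul_sum, mul_assoc]
  have hpd : S.PosDef := by
    refine Matrix.PosDef.of_dotProduct_mulVec_pos hS fun ξ hξ => ?_
    rw [star_trivial, hq]
    refine lt_of_lt_of_le (mul_pos hl ?_) (h ξ)
    obtain ⟨i, hi⟩ := Function.ne_iff.1 hξ
    exact Finset.sum_pos' (fun _ _ => sq_nonneg _) ⟨i, Finset.mem_univ i, by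
      have : ξ i ≠ 0 := hi
      positivity⟩
  set R : Matrix (Fin d) (Fin d) ℝ := CFC.sqrt S with hR
  have hRR : R * R = S := CFC.sqrt_mul_sqrt_self S hpd.posSemidef.nonneg
  have hRT : R.transpose = R := by
    have : R.IsHermitian := (Matrix.nonneg_iff_posSemidef.1 (CFC.sqrt_nonneg S)).1
    exact this
  have hdet : R.det ≠ 0 := fun h0 => by
    have := hpd.det_pos
    rw [← hRR, Matrix.det_mul, h0] at this
    simp at this
  have hu : IsUnit R.det := isUnit_iff_ne_zero.2 hdet
  refine ⟨R, R⁻¹, by rw [hRT, hRR], Matrix.nonsing_inv_mul R hu, Matrix.mul_nonsing_inv R hu,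
    fun i j => ?_, fun i j => ?_⟩
  · have : S i i = ∑ k, R i k ^ 2 := by
      conv_lhs => rw [← hRR, ← hRT]
      rw [hRT, Matrix.mul_apply]
      refine Finset.sum_congr rfl fun k _ => ?_
      rw [sq]
      congr 1
      exact congrFun (congrFun hRT i) k
    rw [this]
    exact Finset.single_le_sum (f := fun k => R i k ^ 2) (fun _ _ => sq_nonneg _)
      (Finset.mem_univ j)
  · set ξ : Fin d → ℝ := fun j => R⁻¹ i j with hξ
    have h1 : Matrix.vecMul ξ R = Pi.single i 1 := by
      have h2 := Matrix.nonsing_inv_mul R hu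
      ext k
      have h3 := congrFun (congrFun h2 i) k
      rw [Matrix.mul_apply] at h3
      simp only [Matrix.vecMul, dotProduct, hξ]
      rw [h3, Matrix.one_apply, Pi.single_apply]
      simp only [eq_comm]
    have h4 : ξ ⬝ᵥ S.mulVec ξ = 1 := by
      rw [← hRR, ← Matrix.mulVec_mulVec, Matrix.dotProduct_mulVec, h1]
      have : R.mulVec ξ = Pi.single i 1 := by
        rw [← h1, ← Matrix.mulVec_transpose, hRT]
      rw [this]; simp
    have h5 := h ξ
    rw [← hq, h4] at h5
    have h6 : ξ j ^ 2 ≤ ∑ k, ξ k ^ 2 :=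
      Finset.single_le_sum (f := fun k => ξ k ^ 2) (fun _ _ => sq_nonneg _) (Finset.mem_univ j)
    rw [le_div_iff₀ hl]
    change ξ j ^ 2 * l ≤ 1
    nlinarith

/-- If the averages of `f` over all translates of a set of small vectors are controlled on a ball,
so is the integral of `f` over a slightly smaller ball. -/
lemma mul_lintegral_ball_le_of_translates {f : Euc d → ENNReal} (hf : Measurable f)
    {Y : Set (Euc d)} (hY : MeasurableSet Y) {τ : Euc d → Euc d} (hτ : Continuous τ) {s : ℝ}
    (hs : ∀ y ∈ Y, ‖τ y‖ ≤ s) {z₀ : Euc d} {R : ℝ} {H : ENNReal}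
    (h : ∀ z ∈ ball z₀ (R + s), ∫⁻ y in Y, f (z + τ y) ≤ H) :
    volume Y * ∫⁻ z in ball z₀ R, f z ≤ volume (ball z₀ (R + s)) * H := by
  have key : ∀ y ∈ Y, ∫⁻ z in ball z₀ R, f z ≤ ∫⁻ z in ball z₀ (R + s), f (z + τ y) := by
    intro y hy
    rw [← lintegral_indicator measurableSet_ball, ← lintegral_indicator measurableSet_ball,
      ← lintegral_add_right_eq_self _ (τ y)]
    refine lintegral_mono fun z => ?_
    by_cases hz : z + τ y ∈ ball z₀ R
    · have : z ∈ ball z₀ (R + s) := by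
        rw [mem_ball, dist_eq_norm] at hz ⊢
        calc ‖z - z₀‖ = ‖(z + τ y - z₀) - τ y‖ := by congr 1; abel
          _ ≤ ‖z + τ y - z₀‖ + ‖τ y‖ := norm_sub_le _ _
          _ < R + s := add_lt_add_of_lt_of_le hz (hs y hy)
      simp [Set.indicator_of_mem hz, Set.indicator_of_mem this]
    · simp [Set.indicator_of_notMem hz]
  have hm : Measurable (fun q : Euc d × Euc d => f (q.2 + τ q.1)) :=
    hf.comp (by fun_prop)
  calc volume Y * ∫⁻ z in ball z₀ R, f z = ∫⁻ _y in Y, ∫⁻ z in ball z₀ R, f z := by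
        rw [setLIntegral_const, mul_comm]
    _ ≤ ∫⁻ y in Y, ∫⁻ z in ball z₀ (R + s), f (z + τ y) := setLIntegral_mono' hY key
    _ = ∫⁻ z in ball z₀ (R + s), ∫⁻ y in Y, f (z + τ y) :=
        lintegral_lintegral_swap hm.aemeasurable
    _ ≤ ∫⁻ _z in ball z₀ (R + s), H := setLIntegral_mono' measurableSet_ball h
    _ = _ := by rw [setLIntegral_const, mul_comm]

lemma abs_mul_mul_apply_le {X D Y : Matrix (Fin d) (Fin d) ℝ} {β : ℝ} (hX : ∀ i j, |X i j| ≤ β)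
    (hY : ∀ i j, |Y i j| ≤ β) (i j : Fin d) :
    |(X * D * Y) i j| ≤ β * β * ∑ k, ∑ l, |D k l| := by
  have hβ : 0 ≤ β := (abs_nonneg _).trans (hX i j)
  have h1 : (X * D * Y) i j = ∑ l, ∑ k, X i k * D k l * Y l j := by
    simp [Matrix.mul_apply, Finset.sum_mul]
  rw [h1, Finset.sum_comm, Finset.mul_sum]
  refine (Finset.abs_sum_le_sum_abs _ _).trans (Finset.sum_le_sum fun k _ => ?_)
  rw [Finset.mul_sum]
  refine (Finset.abs_sum_le_sum_abs _ _).trans (Finset.sum_le_sum fun l _ => ?_)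
  rw [abs_mul, abs_mul]
  calc _ ≤ β * |D k l| * β := by gcongr; exacts [hX i k, hY l j]
    _ = _ := by ring

lemma norm_le_sum_abs (v : Euc d) : ‖v‖ ≤ ∑ k, |v k| := by
  conv_lhs => rw [← (EuclideanSpace.basisFun (Fin d) ℝ).sum_repr v]
  refine (norm_sum_le _ _).trans (Finset.sum_le_sum fun k _ => ?_)
  rw [norm_smul]; simp

lemma norm_apply_le_of_entries {T : Euc d →L[ℝ] Euc d} {b : ℝ}
    (hT : ∀ i k, |(T (EuclideanSpace.single i 1)) k| ≤ b) (y : Euc d) :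
    ‖T y‖ ≤ d * (d * b) * ‖y‖ := by
  conv_lhs => rw [← (EuclideanSpace.basisFun (Fin d) ℝ).sum_repr y]
  rw [map_sum]
  calc _ ≤ ∑ i, ‖T ((EuclideanSpace.basisFun (Fin d) ℝ).repr y i •
        (EuclideanSpace.basisFun (Fin d) ℝ) i)‖ := norm_sum_le _ _
    _ ≤ ∑ _i : Fin d, ‖y‖ * (d * b) := by
      refine Finset.sum_le_sum fun i _ => ?_
      rw [map_smul, norm_smul]
      refine mul_le_mul ?_ ?_ (norm_nonneg _) (norm_nonneg _)
      · simpa using abs_coord_le y i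
      · rw [EuclideanSpace.basisFun_apply]
        calc _ ≤ _ := norm_le_sum_abs _
          _ ≤ ∑ _k : Fin d, b := Finset.sum_le_sum fun k _ => hT i k
          _ = d * b := by simp
    _ = _ := by simp; ring

/-- The matrix of second-order partial derivatives. -/
def hess (u : Euc d → ℝ) (x : Euc d) : Matrix (Fin d) (Fin d) ℝ := fun i j => dd i (dd j u) x

lemma sum_mul_hess (a : Matrix (Fin d) (Fin d) ℝ) (u : Euc d → ℝ) (x : Euc d) :
    ∑ i, ∑ j, a i j * dd i (dd j u) x = (a.transpose * hess u x).trace := by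
  simp only [Matrix.trace, Matrix.diag, Matrix.mul_apply, Matrix.transpose_apply, hess]
  exact Finset.sum_comm

section AffineChange

variable {V : Euc d → ℝ} {L B : Matrix (Fin d) (Fin d) ℝ} {r β : ℝ} {T : Euc d →L[ℝ] Euc d}
  (z y : Euc d)

lemma hess_comp_affine (hV : ContDiff ℝ 2 V)
    (hT : ∀ i k, (T (EuclideanSpace.single i 1)) k = r * L k i) :
    hess (fun y => V (z + T y)) y = (r * r) • (L.transpose * hess V (z + T y) * L) := by
  ext i j
  simp only [hess, dd_dd_comp_affine hV, hT, Matrix.smul_apply, Matrix.mul_apply, Finset.sum_mul,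
    Matrix.transpose_apply, smul_eq_mul, Finset.mul_sum]
  exact Finset.sum_congr rfl fun l _ => Finset.sum_congr rfl fun k _ => by ring

lemma hs_le_hs_comp_affine (hV : ContDiff ℝ 2 V) (hr : 0 < r)
    (hT : ∀ i k, (T (EuclideanSpace.single i 1)) k = r * L k i) (hLB : L * B = 1)
    (hB : ∀ i j, |B i j| ≤ β) :
    hs V (z + T y) ≤ d * (d * (β * β)) / (r * r) * hs (fun y => V (z + T y)) y := by
  have h1 : B.transpose * hess (fun y => V (z + T y)) y * B = (r * r) • hess V (z + T y) := by
    rw [hess_comp_affine z y hV hT, Matrix.mul_smul, Matrix.smul_mul]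
    congr 1
    have h2 : B.transpose * L.transpose = 1 := by rw [← Matrix.transpose_mul, hLB]; simp
    calc _ = (B.transpose * L.transpose) * hess V (z + T y) * (L * B) := by
          simp only [Matrix.mul_assoc]
      _ = _ := by rw [h2, hLB]; simp
  have h3 : ∀ i j, |dd i (dd j V) (z + T y)| ≤
      β * β / (r * r) * hs (fun y => V (z + T y)) y := fun i j => by
    have h4 := abs_mul_mul_apply_le (X := B.transpose) (D := hess (fun y => V (z + T y)) y) (Y := B)
      (fun i j => hB j i) hB i j
    rw [h1, Matrix.smul_apply, smul_eq_mul, abs_mul, abs_of_pos (by positivity)] at h4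
    rw [div_mul_eq_mul_div, le_div_iff₀ (by positivity), mul_comm]
    exact h4
  calc hs V (z + T y) ≤ ∑ _i : Fin d, ∑ _j : Fin d, β * β / (r * r) *
        hs (fun y => V (z + T y)) y := Finset.sum_le_sum fun i _ => Finset.sum_le_sum fun j _ => h3 i j
    _ = _ := by simp; ring

lemma gs_le_gs_comp_affine (hV : ContDiff ℝ 1 V) (hr : 0 < r)
    (hT : ∀ i k, (T (EuclideanSpace.single i 1)) k = r * L k i) (hLB : L * B = 1)
    (hB : ∀ i j, |B i j| ≤ β) :
    gs V (z + T y) ≤ d * β / r * gs (fun y => V (z + T y)) y := by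
  have h1 : ∀ l, ∑ i, B i l * dd i (fun y => V (z + T y)) y = r * dd l V (z + T y) := fun l => by
    simp only [dd_comp_affine hV, hT, Finset.mul_sum]
    rw [Finset.sum_comm]
    have h2 : ∀ k, ∑ i, B i l * (r * L k i * dd k V (z + T y)) =
        r * dd k V (z + T y) * (L * B) k l := fun k => by
      rw [Matrix.mul_apply, Finset.mul_sum]
      exact Finset.sum_congr rfl fun i _ => by ring
    simp only [h2, hLB, Matrix.one_apply]
    simp
  have h3 : ∀ l, |dd l V (z + T y)| ≤ β / r * gs (fun y => V (z + T y)) y := fun l => by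
    rw [div_mul_eq_mul_div, le_div_iff₀ hr, mul_comm]
    have h4 : r * |dd l V (z + T y)| = |r * dd l V (z + T y)| := by rw [abs_mul, abs_of_pos hr]
    rw [h4, ← h1]
    unfold gs
    rw [Finset.mul_sum]
    refine (Finset.abs_sum_le_sum_abs _ _).trans (Finset.sum_le_sum fun i _ => ?_)
    rw [abs_mul]
    exact mul_le_mul_of_nonneg_right (hB i l) (abs_nonneg _)
  calc gs V (z + T y) ≤ ∑ _l : Fin d, β / r * gs (fun y => V (z + T y)) y :=
        Finset.sum_le_sum fun l _ => h3 l
    _ = _ := by simp; ring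

lemma sum_conj_mul_hess (hV : ContDiff ℝ 2 V)
    (hT : ∀ i k, (T (EuclideanSpace.single i 1)) k = r * L k i) (hLB : L * B = 1)
    (A : Matrix (Fin d) (Fin d) ℝ) :
    ∑ i, ∑ j, (B * A * B.transpose) i j * dd i (dd j (fun y => V (z + T y))) y =
      r * r * ∑ i, ∑ j, A i j * dd i (dd j V) (z + T y) := by
  have h2 : B.transpose * L.transpose = 1 := by rw [← Matrix.transpose_mul, hLB]; simp
  rw [sum_mul_hess, sum_mul_hess, hess_comp_affine z y hV hT, Matrix.mul_smul, Matrix.trace_smul,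
    smul_eq_mul]
  congr 1
  simp only [Matrix.transpose_mul, Matrix.transpose_transpose]
  calc _ = (B * (A.transpose * (B.transpose * L.transpose) * hess V (z + T y) * L)).trace := by
        simp only [Matrix.mul_assoc]
    _ = (A.transpose * (B.transpose * L.transpose) * hess V (z + T y) * (L * B)).trace := by
        rw [Matrix.trace_mul_comm]; simp only [Matrix.mul_assoc]
    _ = _ := by rw [h2, hLB]; simp

end AffineChange

/-- Interior estimate for an elliptic operator whose leading coefficients are close to a constant
matrix, at the scale dictated by the size of the coefficients. -/
lemma frozen_estimate (d : ℕ) {n : ℕ} (hn : 3 ≤ n) (hnd : 2 * d ≤ n) :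
    ∃ δ C : ℝ, 0 < δ ∧ 0 < C ∧
    ∀ {V : Euc d → ℝ} {A : Euc d → Matrix (Fin d) (Fin d) ℝ} {L B : Matrix (Fin d) (Fin d) ℝ}
      {r β θ P b N : ℝ} {T : Euc d →L[ℝ] Euc d} {z : Euc d}, ContDiff ℝ 2 V → 0 < r → 0 < P →
      0 ≤ β → 0 ≤ b → 0 ≤ N →
      (∀ i k, (T (EuclideanSpace.single i 1)) k = r * L k i) → L * B = 1 → B * L = 1 →
      (∀ i j, |B i j| ≤ β) → β * β * (d * (d * θ)) ≤ δ → r * (b * (d * β)) ≤ 1 →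
      (∀ y ∈ ball (0 : Euc d) 1, ∀ k l, |A (z + T y) k l - (L * L.transpose) k l| ≤ θ) →
      (∀ y ∈ ball (0 : Euc d) 1, |∑ i, ∑ j, A (z + T y) i j * dd i (dd j V) (z + T y)| ≤
        P + b * gs V (z + T y)) →
      (∀ y ∈ ball (0 : Euc d) 1, |V (z + T y)| ≤ N) →
      gs V z ≤ d * β / r * (C * (r * r * P + N)) ∧
        ∫ y in ball (0 : Euc d) (1 / 2), hs V (z + T ((1 / 2 : ℝ) • y)) ^ n ≤
          (d * (d * (β * β)) / (r * r)) ^ n * (C * (r * r * P + N) ^ n) := by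
  obtain ⟨δ, C, hδ, hC, h⟩ := unit_scale_estimate d hn hnd
  refine ⟨δ, C, hδ, hC, ?_⟩
  intro V A L B r β θ P b N T z hV hr hP hβ hb hN hT hLB hBL hB hθ hrb hA hPDE hVN
  have hV1 : ContDiff ℝ 1 V := hV.of_le (by norm_num)
  set w : Euc d → ℝ := fun y => V (z + T y) with hwdef
  have hw : ContDiff ℝ 2 w := hV.comp (by fun_prop)
  have hBB : L.transpose * B.transpose = 1 := by rw [← Matrix.transpose_mul, hBL]; simp
  have h12 := h (w := w) (a := fun y => B * A (z + T y) * B.transpose) (F := r * r * P)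
    (N := N) hw (by positivity) hN (fun y hy i j => ?_) (fun y hy => ?_) hVN
  · obtain ⟨h1, h2⟩ := h12
    constructor
    · have h3 := gs_le_gs_comp_affine z 0 hV1 hr hT hLB hB
      rw [map_zero, add_zero] at h3
      refine h3.trans ?_
      gcongr
    · have hc1 : Continuous (fun y => hs V (z + T ((1 / 2 : ℝ) • y)) ^ n) :=
        ((hs_continuous hV).comp (by fun_prop)).pow n
      have hc2 : Continuous (fun y => hs w ((1 / 2 : ℝ) • y) ^ n) :=
        ((hs_continuous hw).comp (by fun_prop)).pow n
      calc _ ≤ ∫ y in ball (0 : Euc d) (1 / 2), (d * (d * (β * β)) / (r * r)) ^ n *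
            hs w ((1 / 2 : ℝ) • y) ^ n := by
            refine setIntegral_mono_on ?_ ?_ measurableSet_ball fun y _ => ?_
            · exact (hc1.integrableOn_closedBall 0 (1 / 2)).mono_set ball_subset_closedBall
            · exact ((hc2.integrableOn_closedBall 0 (1 / 2)).mono_set
                ball_subset_closedBall).const_mul _
            · rw [← mul_pow]
              exact pow_le_pow_left₀ (hs_nonneg _ _) (hs_le_hs_comp_affine z _ hV hr hT hLB hB) n
        _ ≤ _ := by
            rw [integral_const_mul]
            gcongr
  · have h3 : B * (A (z + T y) - L * L.transpose) * B.transpose =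
        B * A (z + T y) * B.transpose - 1 := by
      rw [Matrix.mul_sub, Matrix.sub_mul]
      congr 1
      calc _ = (B * L) * (L.transpose * B.transpose) := by simp only [Matrix.mul_assoc]
        _ = 1 := by rw [hBL, hBB, one_mul]
    have h4 : (B * A (z + T y) * B.transpose) i j - (if i = j then 1 else 0) =
        (B * (A (z + T y) - L * L.transpose) * B.transpose) i j := by
      rw [h3, Matrix.sub_apply, Matrix.one_apply]
    rw [h4]
    refine (abs_mul_mul_apply_le hB (fun i j => hB j i) i j).trans (le_trans ?_ hθ)
    refine mul_le_mul_of_nonneg_left ?_ (by positivity)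
    calc _ ≤ ∑ _k : Fin d, ∑ _l : Fin d, θ :=
          Finset.sum_le_sum fun k _ => Finset.sum_le_sum fun l _ => hA y hy k l
      _ = _ := by simp
  · have h3 := sum_conj_mul_hess z y hV hT hLB (A (z + T y))
    change |∑ i, ∑ j, (B * A (z + T y) * B.transpose) i j * dd i (dd j w) y| ≤ _
    rw [h3, abs_mul, abs_of_pos (by positivity)]
    have h5 := gs_le_gs_comp_affine z y hV1 hr hT hLB hB
    have h6 := gs_nonneg w y
    calc _ ≤ r * r * (P + b * gs V (z + T y)) := by gcongr; exact hPDE y hy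
      _ ≤ r * r * (P + b * (d * β / r * gs w y)) := by gcongr
      _ = r * r * P + r * (b * (d * β)) * gs w y := by field_simp
      _ ≤ r * r * P + 1 * gs w y := by gcongr
      _ = _ := by rw [one_mul]

lemma exists_contDiff_eqOn_ball {v : Euc d → ℝ} {x₀ : Euc d} {a b : ℝ} (ha : 0 < a) (hab : a < b)
    (hv : ContDiffOn ℝ 2 v (ball x₀ b)) :
    ∃ V : Euc d → ℝ, ContDiff ℝ 2 V ∧ Set.EqOn V v (ball x₀ a) := by
  let χ : ContDiffBump x₀ := ⟨a, (a + b) / 2, ha, by linarith⟩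
  refine ⟨fun x => χ x * v x, ?_, fun x hx => ?_⟩
  · refine contDiff_iff_contDiffAt.2 fun x => ?_
    by_cases hx : x ∈ tsupport fun x => χ x * v x
    swap
    · exact contDiffAt_const.congr_of_eventuallyEq (notMem_tsupport_iff_eventuallyEq.1 hx)
    have hx' : x ∈ ball x₀ b := by
      have h1 : x ∈ tsupport χ := tsupport_mul_subset_left hx
      rw [χ.tsupport_eq] at h1
      exact closedBall_subset_ball (by change (a + b) / 2 < b; linarith) h1
    exact χ.contDiff.contDiffAt.mul (hv.contDiffAt (isOpen_ball.mem_nhds hx'))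
  · simp [χ.one_of_mem_closedBall (ball_subset_closedBall hx)]

/-- The second derivative is controlled by the sum of the second-order partial derivatives. -/
lemma norm_iteratedFDeriv_two_le_hs {V : Euc d → ℝ} (hV : ContDiff ℝ 2 V) (x : Euc d) :
    ‖iteratedFDeriv ℝ 2 V x‖ ≤ hs V x := by
  have hd : ∀ m : Euc d, ∀ x, DifferentiableAt ℝ (fun y => fderiv ℝ V y m) x := fun m x =>
    ((hV.fderiv_right (m := 1) (by norm_num)).differentiable (by norm_num) x).clm_apply
      (differentiableAt_const m)
  have hdf : DifferentiableAt ℝ (fderiv ℝ V) x :=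
    (hV.fderiv_right (m := 1) (by norm_num)).differentiable (by norm_num) x
  have hexp : ∀ a b : Euc d, fderiv ℝ (fderiv ℝ V) x a b = ∑ i, ∑ j, a i * b j * dd i (dd j V) x := by
    intro a b
    have h1 : fderiv ℝ (fderiv ℝ V) x a b = fderiv ℝ (fun y => fderiv ℝ V y b) x a := by
      rw [fderiv_clm_apply hdf (differentiableAt_const b)]
      simp
    have h2 : (fun y => fderiv ℝ V y b) = fun y => ∑ j, b j * dd j V y := by
      funext y; exact fderiv_eq_sum_dd V y b
    rw [h1, fderiv_eq_sum_dd]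
    refine Finset.sum_congr rfl fun i _ => ?_
    have h3 : dd i (fun y => fderiv ℝ V y b) x = ∑ j, b j * dd i (dd j V) x := by
      unfold dd
      have h4 : (fun y => fderiv ℝ V y b) =
          fun y => ∑ j, b j * fderiv ℝ V y (EuclideanSpace.single j 1) := h2
      rw [h4, fderiv_fun_sum fun j _ => (hd _ x).const_mul _]
      simp only [_root_.sum_apply]
      refine Finset.sum_congr rfl fun j _ => ?_
      rw [fderiv_const_mul (hd _ x)]
      simp
    rw [h3, Finset.mul_sum]
    exact Finset.sum_congr rfl fun j _ => by ring
  refine ContinuousMultilinearMap.opNorm_le_bound (hs_nonneg V x) fun a => ?_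
  rw [iteratedFDeriv_two_apply, hexp, Fin.prod_univ_two, norm_eq_abs]
  unfold hs
  rw [Finset.sum_mul]
  refine (Finset.abs_sum_le_sum_abs _ _).trans (Finset.sum_le_sum fun i _ => ?_)
  rw [Finset.sum_mul]
  refine (Finset.abs_sum_le_sum_abs _ _).trans (Finset.sum_le_sum fun j _ => ?_)
  rw [abs_mul, abs_mul, mul_comm]
  have := abs_coord_le (a 0) i
  have := abs_coord_le (a 1) j
  gcongr

lemma ENNReal.le_ofReal_div {X : ENNReal} {a b : ℝ} (ha : 0 < a)
    (h : ENNReal.ofReal a * X ≤ ENNReal.ofReal b) : X ≤ ENNReal.ofReal (b / a) := by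
  rw [ENNReal.ofReal_div_of_pos ha,
    ENNReal.le_div_iff_mul_le (Or.inl (by simpa using ha)) (Or.inl ENNReal.ofReal_ne_top), mul_comm]
  exact h

lemma volume_ball_eq (x : Euc d) {r : ℝ} (hr : 0 < r) :
    volume (ball x r) = ENNReal.ofReal (r ^ d * omg d) := by
  rw [Measure.addHaar_ball_of_pos volume x hr, finrank_euclideanSpace_fin,
    ENNReal.ofReal_mul (by positivity), omg, ofReal_measureReal measure_ball_lt_top.ne]

/-- Integral bound on the unit ball from bounds for averages over small affine images of a ball,
whose shape may depend on the location. -/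
lemma lintegral_unit_ball_le_of_local {f : Euc d → ENNReal} (hf : Measurable f) {x₀ : Euc d}
    {ρ E : ℝ} (hρ : 0 < ρ) (hρ1 : ρ ≤ 1) (hE : 0 ≤ E)
    (h : ∀ z₀ ∈ ball x₀ (3 / 2), ∃ τ : Euc d → Euc d, Continuous τ ∧
      (∀ y ∈ ball (0 : Euc d) (1 / 2), ‖τ y‖ ≤ ρ / 2) ∧
      ∀ z ∈ ball z₀ ρ, ∫⁻ y in ball (0 : Euc d) (1 / 2), f (z + τ y) ≤ ENNReal.ofReal E) :
    ∫⁻ z in ball x₀ 1, f z ≤ ENNReal.ofReal (8 ^ d * E) := by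
  have hω := omg_pos d
  have h1 : ∀ z₀ ∈ ball x₀ (3 / 2), ∫⁻ z in ball z₀ (ρ / 2), f z ≤
      ENNReal.ofReal (ρ ^ d * omg d * E / ((1 / 2) ^ d * omg d)) := by
    intro z₀ hz₀
    obtain ⟨τ, hτ, hτs, hτf⟩ := h z₀ hz₀
    have h2 := mul_lintegral_ball_le_of_translates hf measurableSet_ball hτ hτs (z₀ := z₀)
      (R := ρ / 2) (H := ENNReal.ofReal E) (by simpa using hτf)
    rw [volume_ball_eq _ (by norm_num), volume_ball_eq _ (by linarith), add_halves,
      ← ENNReal.ofReal_mul (by positivity)] at h2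
    exact ENNReal.le_ofReal_div (by positivity) h2
  have h3 := mul_lintegral_ball_le_of_translates hf (Y := ball (0 : Euc d) (ρ / 2))
    measurableSet_ball continuous_id (s := 1 / 2) (z₀ := x₀) (R := 1)
    (H := ENNReal.ofReal (ρ ^ d * omg d * E / ((1 / 2) ^ d * omg d)))
    (fun y hy => by
      have : ‖y‖ < ρ / 2 := by simpa using hy
      change ‖y‖ ≤ _
      linarith)
    (fun z hz => by
      refine le_trans (le_of_eq (Eq.symm ?_)) (h1 z (by norm_num at hz ⊢; exact hz))
      rw [← lintegral_indicator measurableSet_ball, ← lintegral_indicator measurableSet_ball,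
        ← lintegral_add_left_eq_self _ z]
      refine lintegral_congr fun y => ?_
      have : z + y ∈ ball z (ρ / 2) ↔ y ∈ ball (0 : Euc d) (ρ / 2) := by simp [dist_eq_norm]
      by_cases hy : y ∈ ball (0 : Euc d) (ρ / 2)
      · rw [Set.indicator_of_mem hy, Set.indicator_of_mem (this.2 hy)]; rfl
      · rw [Set.indicator_of_notMem hy, Set.indicator_of_notMem (mt this.1 hy)])
  rw [volume_ball_eq _ (by linarith), volume_ball_eq _ (by norm_num),
    ← ENNReal.ofReal_mul (by positivity)] at h3
  refine (ENNReal.le_ofReal_div (by positivity) h3).trans (ENNReal.ofReal_le_ofReal ?_)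
  have h4 : ((1 : ℝ) + 1 / 2) ^ d ≤ 2 ^ d := pow_le_pow_left₀ (by norm_num) (by norm_num) d
  rw [div_le_iff₀ (by positivity), mul_div_assoc']
  rw [div_le_iff₀ (by positivity)]
  have h5 : (8 : ℝ) ^ d * (1 / 2) ^ d * (1 / 2) ^ d = 2 ^ d := by
    rw [← mul_pow, ← mul_pow]; norm_num
  have h6 : (8 : ℝ) ^ d * E * ((ρ / 2) ^ d * omg d) * ((1 / 2) ^ d * omg d) =
      2 ^ d * (omg d * (ρ ^ d * omg d * E)) := by
    rw [← h5, div_eq_mul_one_div ρ, mul_pow]; ring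
  rw [h6]
  calc _ = (1 + 1 / 2) ^ d * (omg d * (ρ ^ d * omg d * E)) := by ring
    _ ≤ _ := by gcongr

/-- Interior estimate on the unit ball for an elliptic operator with Lipschitz leading part, at
every scale `r` that is small compared to the coefficients. -/
lemma interior_estimate_at_scale (d : ℕ) {n : ℕ} (hn : 3 ≤ n) (hnd : 2 * d ≤ n) {l Λ : ℝ}
    (hl : 0 < l) (hΛ : 0 < Λ) :
    ∃ κ C : ℝ, 0 < κ ∧ κ ≤ 1 ∧ 0 < C ∧
    ∀ {V : Euc d → ℝ} {A : Euc d → Matrix (Fin d) (Fin d) ℝ} {x₀ : Euc d} {r Q P b N : ℝ},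
      ContDiff ℝ 2 V → 0 < r → 0 < P → 1 ≤ Q → 0 ≤ b → 0 ≤ N → r * b ≤ κ → r * Q ^ 2 ≤ κ →
      (∀ x, (A x).transpose = A x) →
      (∀ x (ξ : Fin d → ℝ), l * ∑ i, ξ i ^ 2 ≤ ∑ i, ∑ j, ξ i * A x i j * ξ j) →
      (∀ x ∈ ball x₀ 2, ∀ y ∈ ball x₀ 2, ∀ i j, |A x i j - A y i j| ≤ Λ * Q * dist x y) →
      (∀ x ∈ ball x₀ 2, ∀ i, A x i i ≤ Λ * Q ^ 2) →
      (∀ x ∈ ball x₀ (15 / 8), |∑ i, ∑ j, A x i j * dd i (dd j V) x| ≤ P + b * gs V x) →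
      (∀ x ∈ ball x₀ (15 / 8), |V x| ≤ N) →
      (∀ z ∈ ball x₀ 1, gs V z ≤ C / r * (r * r * P + N)) ∧
        ∫⁻ z in ball x₀ 1, ENNReal.ofReal (hs V z ^ n) ≤
          ENNReal.ofReal (C * ((r * r * P + N) / (r * r)) ^ n) := by
  obtain ⟨δ, C₁, hδ, hC₁, h⟩ := frozen_estimate d hn hnd
  set β := √(1 / l) with hβdef
  have hβ : 0 ≤ β := sqrt_nonneg _
  set c := min (1 / 16) (δ / (β * β * (d * (d * (2 * Λ))) + 1)) with hcdef
  have hc : 0 < c := by positivity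
  have hc16 : c ≤ 1 / 16 := min_le_left _ _
  have hcδ : β * β * (d * (d * (2 * Λ * c))) ≤ δ := by
    have h1 : c ≤ δ / (β * β * (d * (d * (2 * Λ))) + 1) := min_le_right _ _
    rw [le_div_iff₀ (by positivity)] at h1
    nlinarith
  set κ := min 1 (min (c / (d * d * √Λ + 1)) (1 / (d * β + 1))) with hκdef
  have hκ : 0 < κ := by positivity
  have hκ1 : κ ≤ 1 := min_le_left _ _
  have hκc : d * d * √Λ * κ ≤ c := by
    have h1 : κ ≤ c / (d * d * √Λ + 1) := (min_le_right _ _).trans (min_le_left _ _)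
    rw [le_div_iff₀ (by positivity)] at h1
    nlinarith
  have hκβ : κ * (d * β) ≤ 1 := by
    have h1 : κ ≤ 1 / (d * β + 1) := (min_le_right _ _).trans (min_le_right _ _)
    rw [le_div_iff₀ (by positivity)] at h1
    nlinarith
  set C := d * β * C₁ + 8 ^ d * ((d * (d * (β * β))) ^ n * C₁) + 1 with hCdef
  refine ⟨κ, C, hκ, hκ1, by positivity, ?_⟩
  intro V A x₀ r Q P b N hV hr hP hQ hb hN hrb hrQ hsym hell hLip hdiag hPDE hVN
  set ρ := c / Q with hρdef
  have hQ0 : 0 < Q := by linarith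
  have hρ : 0 < ρ := by positivity
  have hρ16 : ρ ≤ 1 / 16 := (div_le_self hc.le hQ).trans hc16
  set H := r * r * P + N with hHdef
  have hH : 0 < H := by positivity
  have loc : ∀ z₀ ∈ ball x₀ (3 / 2), ∃ T : Euc d →L[ℝ] Euc d, (∀ y, ‖T y‖ ≤ ρ * ‖y‖) ∧
      ∀ z ∈ ball z₀ ρ, gs V z ≤ d * β / r * (C₁ * H) ∧
        ∫ y in ball (0 : Euc d) (1 / 2), hs V (z + T ((1 / 2 : ℝ) • y)) ^ n ≤
          (d * (d * (β * β)) / (r * r)) ^ n * (C₁ * H ^ n) := by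
    intro z₀ hz₀
    have hz₀2 : z₀ ∈ ball x₀ 2 := ball_subset_ball (by norm_num) hz₀
    obtain ⟨L, B, hLL, hBL, hLB, hL, hB⟩ := exists_factorization (hsym z₀) hl (hell z₀)
    have hLe : ∀ k i, |L k i| ≤ √Λ * Q := fun k i => by
      refine abs_le_of_sq_le_sq ?_ (by positivity)
      rw [mul_pow, sq_sqrt hΛ.le]
      exact (hL k i).trans (hdiag z₀ hz₀2 k)
    have hBe : ∀ i j, |B i j| ≤ β := fun i j => by
      refine abs_le_of_sq_le_sq ?_ hβ
      rw [hβdef, sq_sqrt (by positivity)]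
      exact hB i j
    set T : Euc d →L[ℝ] Euc d := Matrix.toEuclideanCLM (𝕜 := ℝ) (r • L) with hTdef
    have hT : ∀ i k, (T (EuclideanSpace.single i 1)) k = r * L k i := fun i k => by
      rw [hTdef, Matrix.ofLp_toEuclideanCLM]
      simp
    have hTn : ∀ y, ‖T y‖ ≤ ρ * ‖y‖ := fun y => by
      have h1 := norm_apply_le_of_entries (T := T) (b := r * (√Λ * Q)) (fun i k => by
        rw [hT, abs_mul, abs_of_pos hr]
        exact mul_le_mul_of_nonneg_left (hLe k i) hr.le) y
      refine h1.trans (mul_le_mul_of_nonneg_right ?_ (norm_nonneg _))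
      rw [hρdef, le_div_iff₀ hQ0]
      calc _ = d * d * √Λ * (r * Q ^ 2) := by ring
        _ ≤ d * d * √Λ * κ := by gcongr
        _ ≤ c := hκc
    refine ⟨T, hTn, fun z hz => ?_⟩
    have hdist : ∀ y ∈ ball (0 : Euc d) 1, dist (z + T y) z₀ ≤ 2 * ρ := fun y hy => by
      have h1 : ‖y‖ < 1 := by simpa using hy
      have h2 : dist z z₀ < ρ := hz
      calc dist (z + T y) z₀ ≤ dist (z + T y) z + dist z z₀ := dist_triangle _ _ _
        _ ≤ ρ + ρ := by
          refine add_le_add ?_ h2.le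
          rw [dist_self_add_left]
          exact (hTn y).trans (by nlinarith)
        _ = _ := by ring
    have hmem : ∀ y ∈ ball (0 : Euc d) 1, z + T y ∈ ball x₀ (15 / 8) := fun y hy => by
      have h1 := hdist y hy
      have h2 : dist z₀ x₀ < 3 / 2 := hz₀
      rw [mem_ball]
      linarith [dist_triangle (z + T y) z₀ x₀]
    refine h hV hr hP hβ hb hN hT hLB hBL hBe hcδ ?_ (fun y hy k l' => ?_)
      (fun y hy => hPDE _ (hmem y hy)) fun y hy => hVN _ (hmem y hy)
    · calc _ = r * b * (d * β) := by ring
        _ ≤ κ * (d * β) := by gcongr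
        _ ≤ 1 := hκβ
    · rw [hLL]
      refine (hLip _ (ball_subset_ball (by norm_num) (hmem y hy)) _ hz₀2 k l').trans ?_
      calc _ ≤ Λ * Q * (2 * ρ) := by gcongr; exact hdist y hy
        _ = 2 * Λ * c := by rw [hρdef]; field_simp
  constructor
  · intro z hz
    obtain ⟨T, -, hT⟩ := loc z (ball_subset_ball (by norm_num) hz)
    refine (hT z (mem_ball_self hρ)).1.trans ?_
    have : d * β * C₁ ≤ C := by
      have : 0 ≤ (8 : ℝ) ^ d * ((d * (d * (β * β))) ^ n * C₁) := by positivity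
      linarith
    calc _ = d * β * C₁ / r * H := by ring
      _ ≤ _ := by gcongr
  · have hcont : Continuous fun z => hs V z ^ n := (hs_continuous hV).pow n
    have h1 := lintegral_unit_ball_le_of_local (f := fun z => ENNReal.ofReal (hs V z ^ n))
      hcont.measurable.ennreal_ofReal (x₀ := x₀) (ρ := ρ)
      (E := (d * (d * (β * β)) / (r * r)) ^ n * (C₁ * H ^ n)) hρ (by linarith) (by positivity)
      (fun z₀ hz₀ => by
        obtain ⟨T, hTn, hT⟩ := loc z₀ hz₀
        refine ⟨fun y => T ((1 / 2 : ℝ) • y), by fun_prop, fun y hy => ?_, fun z hz => ?_⟩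
        · have h2 : ‖y‖ < 1 / 2 := by simpa using hy
          refine (hTn _).trans ?_
          rw [norm_smul, norm_of_nonneg (by norm_num)]
          nlinarith
        · rw [← ofReal_integral_eq_lintegral_ofReal]
          · exact ENNReal.ofReal_le_ofReal (hT z hz).2
          · exact (Continuous.integrableOn_closedBall
              (f := fun y => hs V (z + T ((1 / 2 : ℝ) • y)) ^ n)
              (hcont.comp (by fun_prop)) 0 (1 / 2)).mono_set
              ball_subset_closedBall
          · exact Filter.Eventually.of_forall fun y => pow_nonneg (hs_nonneg _ _) n)
    refine h1.trans (ENNReal.ofReal_le_ofReal ?_)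
    have : (8 : ℝ) ^ d * ((d * (d * (β * β))) ^ n * C₁) ≤ C := by
      have : 0 ≤ d * β * C₁ := by positivity
      linarith
    calc _ = 8 ^ d * ((d * (d * (β * β))) ^ n * C₁) * (H / (r * r)) ^ n := by
          rw [div_pow, div_pow]; ring
      _ ≤ _ := by gcongr

lemma volume_real_ball_one (x : Euc d) : volume.real (ball x 1) = omg d := by
  rw [Measure.real, volume_ball_eq x one_pos, ENNReal.toReal_ofReal (by have := omg_pos d; positivity)]
  simp

lemma setIntegral_rpow_rpow_inv_le_of_le {g : Euc d → ℝ} {x₀ : Euc d} {p G : ℝ} (hp : 0 < p)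
    (hg0 : ∀ x, 0 ≤ g x) (hg : ∀ x ∈ ball x₀ 1, g x ≤ G) :
    (∫ x in ball x₀ 1, g x ^ p) ^ (1 / p) ≤ omg d ^ (1 / p) * G := by
  have hG : 0 ≤ G := (hg0 x₀).trans (hg x₀ (mem_ball_self one_pos))
  have h1 : ∫ x in ball x₀ 1, g x ^ p ≤ omg d * G ^ p := by
    refine (le_abs_self _).trans ?_
    rw [← norm_eq_abs, ← volume_real_ball_one x₀, mul_comm]
    refine norm_setIntegral_le_of_norm_le_const measure_ball_lt_top fun x hx => ?_
    rw [norm_of_nonneg (rpow_nonneg (hg0 x) p)]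
    exact rpow_le_rpow (hg0 x) (hg x hx) hp.le
  calc _ ≤ (omg d * G ^ p) ^ (1 / p) :=
        rpow_le_rpow (integral_nonneg fun x => rpow_nonneg (hg0 x) p) h1 (by positivity)
    _ = _ := by
        rw [mul_rpow (omg_pos d).le (by positivity), ← rpow_mul hG, mul_one_div_cancel hp.ne',
          rpow_one]

lemma rpow_le_rpow_add_pow_mul_rpow {h E p : ℝ} {n : ℕ} (hE : 0 < E) (hh : 0 ≤ h) (hp : 0 < p)
    (hpn : p ≤ n) : h ^ p ≤ E ^ p + h ^ n * E ^ (p - n) := by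
  rcases le_total h E with hle | hle
  · have := rpow_le_rpow hh hle hp.le
    have : 0 ≤ h ^ n * E ^ (p - n) := by positivity
    linarith
  · have hpos : 0 < h := hE.trans_le hle
    have h1 : h ^ p = h ^ n * h ^ (p - n) := by
      rw [← rpow_natCast, ← rpow_add hpos]; congr 1; ring
    have h2 := rpow_le_rpow_of_nonpos hE hle (sub_nonpos.2 hpn)
    have : 0 ≤ E ^ p := by positivity
    have : h ^ n * h ^ (p - n) ≤ h ^ n * E ^ (p - n) := by gcongr
    linarith

lemma setIntegral_rpow_rpow_inv_le_of_pow {g f : Euc d → ℝ} {x₀ : Euc d} {p E C : ℝ} {n : ℕ}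
    (hp : 0 < p) (hpn : p ≤ n) (hE : 0 < E) (hC : 0 ≤ C) (hg0 : ∀ x, 0 ≤ g x)
    (hf : Continuous f) (hgf : ∀ x ∈ ball x₀ 1, g x ≤ f x) (hf0 : ∀ x, 0 ≤ f x)
    (h : ∫⁻ x in ball x₀ 1, ENNReal.ofReal (f x ^ n) ≤ ENNReal.ofReal (C * E ^ n)) :
    (∫ x in ball x₀ 1, g x ^ p) ^ (1 / p) ≤ (omg d + C) ^ (1 / p) * E := by
  have hω := omg_pos d
  have : IsFiniteMeasure (volume.restrict (ball x₀ 1)) :=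
    isFiniteMeasure_restrict.2 measure_ball_lt_top.ne
  have hint : IntegrableOn (fun x => f x ^ n) (ball x₀ 1) :=
    (Continuous.integrableOn_closedBall (hf.pow n) x₀ 1).mono_set ball_subset_closedBall
  have h1 : ∫ x in ball x₀ 1, f x ^ n ≤ C * E ^ n := by
    rw [← ofReal_integral_eq_lintegral_ofReal hint
      (Filter.Eventually.of_forall fun x => pow_nonneg (hf0 x) n)] at h
    exact (ENNReal.ofReal_le_ofReal_iff (by positivity)).1 h
  have h2 : ∫ x in ball x₀ 1, g x ^ p ≤ ∫ x in ball x₀ 1, (E ^ p + f x ^ n * E ^ (p - n)) := by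
    refine integral_mono_of_nonneg (Filter.Eventually.of_forall fun x => rpow_nonneg (hg0 x) p)
      ((integrable_const _).add (hint.mul_const _)) ?_
    refine (ae_restrict_iff' measurableSet_ball).2 (Filter.Eventually.of_forall fun x hx => ?_)
    exact (rpow_le_rpow (hg0 x) (hgf x hx) hp.le).trans
      (rpow_le_rpow_add_pow_mul_rpow hE (hf0 x) hp hpn)
  rw [integral_add (integrable_const _) (hint.mul_const _), integral_mul_const, setIntegral_const,
    smul_eq_mul, volume_real_ball_one] at h2
  have h3 : E ^ n * E ^ (p - n) = E ^ p := by
    rw [← rpow_natCast, ← rpow_add hE]; congr 1; ring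
  have h4 : ∫ x in ball x₀ 1, g x ^ p ≤ (omg d + C) * E ^ p := by
    calc _ ≤ _ := h2
      _ ≤ omg d * E ^ p + C * E ^ n * E ^ (p - n) := by gcongr
      _ = _ := by rw [mul_assoc, h3]; ring
  calc _ ≤ ((omg d + C) * E ^ p) ^ (1 / p) :=
        rpow_le_rpow (integral_nonneg fun x => rpow_nonneg (hg0 x) p) h4 (by positivity)
    _ = _ := by
        rw [mul_rpow (by positivity) (by positivity), ← rpow_mul hE.le, mul_one_div_cancel hp.ne',
          rpow_one]

lemma abs_mul_transpose_sub_le {m : ℕ} {X Y : Matrix (Fin d) (Fin m) ℝ} {a e : ℝ}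
    (hX : ∀ i j, |X i j| ≤ a) (hY : ∀ i j, |Y i j| ≤ a) (hXY : ∀ i j, |X i j - Y i j| ≤ e)
    (i j : Fin d) : |(X * X.transpose) i j - (Y * Y.transpose) i j| ≤ m * (2 * a * e) := by
  simp only [Matrix.mul_apply, Matrix.transpose_apply]
  rw [← Finset.sum_sub_distrib]
  refine (Finset.abs_sum_le_sum_abs _ _).trans ?_
  calc _ ≤ ∑ _k : Fin m, 2 * a * e := Finset.sum_le_sum fun k _ => by
        have h1 : X i k * X j k - Y i k * Y j k =
          X i k * (X j k - Y j k) + (X i k - Y i k) * Y j k := by ring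
        rw [h1]
        refine (abs_add_le _ _).trans ?_
        rw [abs_mul, abs_mul]
        have h2 := mul_le_mul (hX i k) (hXY j k) (abs_nonneg _) ((abs_nonneg _).trans (hX i k))
        have h3 := mul_le_mul (hXY i k) (hY j k) (abs_nonneg _) ((abs_nonneg _).trans (hXY i k))
        linarith
    _ = _ := by simp

lemma mul_transpose_diag_le {m : ℕ} {X : Matrix (Fin d) (Fin m) ℝ} {a : ℝ}
    (hX : ∀ i j, |X i j| ≤ a) (i : Fin d) : (X * X.transpose) i i ≤ m * a ^ 2 := by
  simp only [Matrix.mul_apply, Matrix.transpose_apply]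
  calc _ ≤ ∑ _k : Fin m, a ^ 2 := Finset.sum_le_sum fun k _ => by
        rw [← sq, ← sq_abs]
        exact pow_le_pow_left₀ (abs_nonneg _) (hX i k) 2
    _ = _ := by simp

/-- Choice of the scale in terms of the size of the coefficients. -/
lemma exists_scale {κ ρ A₁ A₂ A₃ M q : ℝ} (hκ : 0 < κ) (hκ1 : κ ≤ 1) (hρ : 1 ≤ ρ) (hA₁ : 1 ≤ A₁)
    (hA₂ : 1 ≤ A₂) (hA₃ : 1 ≤ A₃) (hM : 0 ≤ M) (hq : 4 ≤ q) :
    ∃ r : ℝ, 0 < r ∧ r ≤ 1 ∧ r * A₂ ≤ κ ∧ r * A₃ ^ 2 ≤ κ ∧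
      (r * r * (ρ * M + A₁) + M) / (r * r) ≤
        7 / κ ^ 2 * (A₁ + (A₂ ^ 2 + A₃ ^ q + ρ) * M) := by
  set s := √ρ with hs
  have hss : s * s = ρ := mul_self_sqrt (by linarith)
  have hs0 : 0 ≤ s := sqrt_nonneg _
  set D := A₂ + A₃ ^ 2 + s with hD
  have hA32 : 1 ≤ A₃ ^ 2 := one_le_pow₀ hA₃
  have hD1 : 1 ≤ D := by linarith
  have hD0 : 0 < D := by linarith
  have hr : 0 < κ / D := by positivity
  refine ⟨κ / D, hr, (div_le_one hD0).2 (hκ1.trans hD1), ?_, ?_, ?_⟩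
  · rw [div_mul_eq_mul_div, div_le_iff₀ hD0]
    exact mul_le_mul_of_nonneg_left (by linarith) hκ.le
  · rw [div_mul_eq_mul_div, div_le_iff₀ hD0]
    exact mul_le_mul_of_nonneg_left (by linarith) hκ.le
  · have h4 : A₃ ^ 4 ≤ A₃ ^ q := by
      rw [← rpow_natCast]
      exact rpow_le_rpow_of_exponent_le hA₃ (by norm_num; exact hq)
    have hW : D ^ 2 ≤ 3 * (A₂ ^ 2 + A₃ ^ q + ρ) := by
      have : D ^ 2 ≤ 3 * (A₂ ^ 2 + A₃ ^ 4 + ρ) := by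
        rw [hD, ← hss]
        nlinarith [sq_nonneg (A₂ - A₃ ^ 2), sq_nonneg (A₂ - s), sq_nonneg (A₃ ^ 2 - s)]
      linarith
    set W := A₂ ^ 2 + A₃ ^ q + ρ with hWdef
    have hκ2 : 1 ≤ 1 / κ ^ 2 := by
      rw [le_div_iff₀ (by positivity), one_mul]
      exact pow_le_one₀ hκ.le hκ1
    have hρW : ρ ≤ W := by
      have : 0 ≤ A₃ ^ q := by positivity
      nlinarith
    have e1 : (κ / D * (κ / D) * (ρ * M + A₁) + M) / (κ / D * (κ / D)) =
        ρ * M + A₁ + D ^ 2 * M * (1 / κ ^ 2) := by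
      field_simp
    have e2 : 7 / κ ^ 2 * (A₁ + W * M) = 7 * (A₁ + W * M) * (1 / κ ^ 2) := by ring
    rw [e1, e2]
    have hWM : ρ * M ≤ W * M := by gcongr
    have hρM : 0 ≤ ρ * M := by positivity
    have f1 : D ^ 2 * M * (1 / κ ^ 2) ≤ 3 * W * M * (1 / κ ^ 2) := by gcongr
    have f2 : (ρ * M + A₁) * 1 ≤ (W * M + A₁) * (1 / κ ^ 2) := by gcongr
    have f3 : 0 ≤ (6 * A₁ + 3 * (W * M)) * (1 / κ ^ 2) := by
      have : 0 ≤ W * M := hρM.trans hWM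
      positivity
    linarith

end InteriorEstimate

/-- Lemma 5.1: interior `W^{2,p}` estimate with explicit dependence of the constant on the
size of the coefficients: if `ρṽ - r̃ - b̃·Dṽ - (1/2)tr(Σ̃D²ṽ) = 0` on `B₂(x₀)` with
`Σ̃ = σ̃σ̃ᵀ ≥ I/C̃₀`, `σ̃` Lipschitz with constant `C̃₀`, and sup bounds `Ã₁, Ã₂, Ã₃` on the
coefficients on `B₂(x₀)`, then
`‖ṽ‖_{W^{2,p}(B₁(x₀))} ≤ C[Ã₁ + (Ã₂² + Ã₃^{4+2d/p} + ρ)‖ṽ‖_{L^∞(B₂(x₀))}]`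
with `C = C(C̃₀, p, d)` independent of `Ã₁, Ã₂, Ã₃, ρ, x₀`. -/
theorem stmt15 (d m : ℕ) (p C₀' : ℝ) (hpd : (d : ℝ) < p) (hC₀' : 0 < C₀') :
    ∃ C : ℝ, 0 < C ∧
    ∀ (x₀ : EuclideanSpace ℝ (Fin d)) (ρ A₁ A₂ A₃ : ℝ)
      (rr : EuclideanSpace ℝ (Fin d) → ℝ)
      (bb : EuclideanSpace ℝ (Fin d) → Fin d → ℝ)
      (σ' : EuclideanSpace ℝ (Fin d) → Matrix (Fin d) (Fin m) ℝ)
      (v : EuclideanSpace ℝ (Fin d) → ℝ),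
      1 ≤ ρ → 1 ≤ A₁ → 1 ≤ A₂ → 1 ≤ A₃ →
      -- uniform ellipticity: Σ̃ = σ̃σ̃ᵀ ≥ I_d / C̃₀
      (∀ x (ξ : Fin d → ℝ), (1 / C₀') * ∑ i, ξ i ^ 2 ≤
        ∑ i, ∑ j, ξ i * (σ' x * Matrix.transpose (σ' x)) i j * ξ j) →
      -- σ̃ is Lipschitz with constant C̃₀
      (∀ x y i j, |σ' x i j - σ' y i j| ≤ C₀' * dist x y) →
      -- sup bounds of the coefficients on B₂(x₀)
      (∀ x ∈ Metric.ball x₀ 2, |rr x| ≤ A₁) →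
      (∀ x ∈ Metric.ball x₀ 2, ∀ i, |bb x i| ≤ A₂) →
      (∀ x ∈ Metric.ball x₀ 2, ∀ i j, |σ' x i j| ≤ A₃) →
      -- ṽ is a bounded classical solution on B₂(x₀)
      ContDiffOn ℝ 2 v (Metric.ball x₀ 2) →
      (∀ x ∈ Metric.ball x₀ 2,
        ρ * v x - rr x - (∑ i, bb x i * pd1 d v x i)
          - (1/2) * ∑ i, ∑ j, (σ' x * Matrix.transpose (σ' x)) i j * pd2 d v x j i = 0) →
      -- ‖ṽ‖_{L^∞(B₂(x₀))} ≤ M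
      ∀ M : ℝ, (∀ x ∈ Metric.ball x₀ 2, |v x| ≤ M) →
      -- conclusion: W^{2,p}(B₁(x₀)) bound
      (∫ x in Metric.ball x₀ 1, |v x| ^ p) ^ (1 / p) +
        (∫ x in Metric.ball x₀ 1, ‖fderiv ℝ v x‖ ^ p) ^ (1 / p) +
        (∫ x in Metric.ball x₀ 1, ‖iteratedFDeriv ℝ 2 v x‖ ^ p) ^ (1 / p) ≤
        C * (A₁ + (A₂ ^ 2 + A₃ ^ (4 + 2 * (d : ℝ) / p) + ρ) * M) := by
  have hp : 0 < p := (Nat.cast_nonneg d).trans_lt hpd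
  set n : ℕ := max 3 (max (2 * d) ⌈p⌉₊) with hndef
  have hn : 3 ≤ n := le_max_left _ _
  have hnd : 2 * d ≤ n := (le_max_left _ _).trans (le_max_right _ _)
  have hpn : p ≤ n := (Nat.le_ceil p).trans
    (Nat.cast_le.2 ((le_max_right _ _).trans (le_max_right _ _)))
  obtain ⟨κ, C₁, hκ, hκ1, hC₁, hmain⟩ := interior_estimate_at_scale d hn hnd
    (l := 1 / (2 * C₀')) (Λ := m * C₀' + m + 1) (by positivity) (by positivity)
  have hω := omg_pos d
  refine ⟨omg d ^ (1 / p) + omg d ^ (1 / p) * (C₁ * (7 / κ ^ 2)) +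
    (omg d + C₁) ^ (1 / p) * (7 / κ ^ 2), by positivity, ?_⟩
  intro x₀ ρ A₁ A₂ A₃ rr bb σ' v hρ hA₁ hA₂ hA₃ hell hLip hrr hbb hσ hv hPDE M hvM
  have hM : 0 ≤ M := (abs_nonneg _).trans (hvM x₀ (mem_ball_self two_pos))
  obtain ⟨V, hV, hVv⟩ := exists_contDiff_eqOn_ball (a := 15 / 8) (by norm_num) (by norm_num) hv
  have hq : (4 : ℝ) ≤ 4 + 2 * (d : ℝ) / p := by
    have : 0 ≤ 2 * (d : ℝ) / p := by positivity
    linarith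
  obtain ⟨r, hr, hr1, hrA₂, hrA₃, hrH⟩ := exists_scale hκ hκ1 hρ hA₁ hA₂ hA₃ hM hq
  set W := A₂ ^ 2 + A₃ ^ (4 + 2 * (d : ℝ) / p) + ρ with hW
  have hW1 : 1 ≤ W := by
    have : 0 ≤ A₃ ^ (4 + 2 * (d : ℝ) / p) := by positivity
    nlinarith
  set G := A₁ + W * M with hG
  have hMG : M ≤ G := by nlinarith
  have hG0 : 0 < G := by
    have : 0 ≤ W * M := by positivity
    linarith
  have hsub : ball x₀ (15 / 8 : ℝ) ⊆ ball x₀ 2 := ball_subset_ball (by norm_num)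
  have hdd1 : ∀ i, Set.EqOn (dd i V) (dd i v) (ball x₀ (15 / 8)) := fun i =>
    dd_eq_of_eqOn isOpen_ball hVv i
  have hdd2 : ∀ i j, Set.EqOn (dd i (dd j V)) (dd i (dd j v)) (ball x₀ (15 / 8)) := fun i j =>
    dd_eq_of_eqOn isOpen_ball (hdd1 j) i
  have key := hmain (V := V) (A := fun x => (1 / 2 : ℝ) • (σ' x * (σ' x).transpose)) (x₀ := x₀)
    (r := r) (Q := A₃) (P := ρ * M + A₁) (b := A₂) (N := M) hV hr (by positivity) hA₃
    (by linarith) hM hrA₂ hrA₃ (fun x => by simp [Matrix.transpose_mul])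
    (fun x ξ => by
      have h1 := hell x ξ
      have h2 : ∑ i, ∑ j, ξ i * ((1 / 2 : ℝ) • (σ' x * (σ' x).transpose)) i j * ξ j =
          1 / 2 * ∑ i, ∑ j, ξ i * (σ' x * (σ' x).transpose) i j * ξ j := by
        simp only [Finset.mul_sum, Matrix.smul_apply, smul_eq_mul]
        exact Finset.sum_congr rfl fun i _ => Finset.sum_congr rfl fun j _ => by ring
      rw [h2]
      calc _ = 1 / 2 * (1 / C₀' * ∑ i, ξ i ^ 2) := by field_simp
        _ ≤ _ := by gcongr)
    (fun x hx y hy i j => by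
      have h1 := abs_mul_transpose_sub_le (hσ x hx) (hσ y hy) (hLip x y) i j
      simp only [Matrix.smul_apply, smul_eq_mul]
      rw [← mul_sub, abs_mul, abs_of_pos (by norm_num)]
      have h2 : 0 ≤ (m + 1) * A₃ * dist x y := by positivity
      linarith)
    (fun x hx i => by
      have h1 := mul_transpose_diag_le (hσ x hx) i
      simp only [Matrix.smul_apply, smul_eq_mul]
      have h2 : 0 ≤ (m * C₀' + m / 2 + 1) * A₃ ^ 2 := by positivity
      linarith)
    (fun x hx => by
      have h1 := hPDE x (hsub hx)
      have h2 : ∑ i, ∑ j, ((1 / 2 : ℝ) • (σ' x * (σ' x).transpose)) i j * dd i (dd j V) x =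
          (1/2) * ∑ i, ∑ j, (σ' x * Matrix.transpose (σ' x)) i j * pd2 d v x j i := by
        simp only [Finset.mul_sum, Matrix.smul_apply, smul_eq_mul]
        refine Finset.sum_congr rfl fun i _ => Finset.sum_congr rfl fun j _ => ?_
        have h3 : pd2 d v x j i = dd i (dd j V) x := by
          rw [dd_comm hV, hdd2 j i hx]; rfl
        rw [h3]; ring
      have h4 : |∑ i, bb x i * pd1 d v x i| ≤ A₂ * gs V x := by
        unfold gs
        rw [Finset.mul_sum]
        refine (Finset.abs_sum_le_sum_abs _ _).trans (Finset.sum_le_sum fun i _ => ?_)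
        rw [abs_mul, hdd1 i hx]
        exact mul_le_mul_of_nonneg_right (hbb x (hsub hx) i) (abs_nonneg _)
      have h5 : |ρ * v x| ≤ ρ * M := by
        rw [abs_mul, abs_of_pos (by linarith)]
        exact mul_le_mul_of_nonneg_left (hvM x (hsub hx)) (by linarith)
      have h6 := abs_le.1 (hrr x (hsub hx))
      have h7 := abs_le.1 h4
      have h8 := abs_le.1 h5
      rw [h2, abs_le]
      constructor <;> linarith)
    (fun x hx => by rw [hVv hx]; exact hvM x (hsub hx))
  obtain ⟨hgs, hhs⟩ := key
  set H := r * r * (ρ * M + A₁) + M with hH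
  have hH0 : 0 ≤ H := by positivity
  have hev : ∀ x ∈ ball x₀ (1 : ℝ), v =ᶠ[nhds x] V := fun x hx =>
    Filter.eventually_of_mem (isOpen_ball.mem_nhds (ball_subset_ball (by norm_num) hx))
      fun y hy => (hVv hy).symm
  have b1 : (∫ x in ball x₀ 1, |v x| ^ p) ^ (1 / p) ≤ omg d ^ (1 / p) * G :=
    setIntegral_rpow_rpow_inv_le_of_le hp (fun x => abs_nonneg _) fun x hx =>
      (hvM x (ball_subset_ball (by norm_num) hx)).trans hMG
  have b2 : (∫ x in ball x₀ 1, ‖fderiv ℝ v x‖ ^ p) ^ (1 / p) ≤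
      omg d ^ (1 / p) * (C₁ * (7 / κ ^ 2) * G) := by
    refine setIntegral_rpow_rpow_inv_le_of_le hp (fun x => norm_nonneg _) fun x hx => ?_
    rw [(hev x hx).fderiv_eq]
    calc _ ≤ gs V x := norm_fderiv_le_sum V x
      _ ≤ C₁ / r * H := hgs x hx
      _ = C₁ * (H / r) := by ring
      _ ≤ C₁ * (H / (r * r)) := by
        have : r * r ≤ r := mul_le_of_le_one_left hr.le hr1
        gcongr
      _ ≤ C₁ * (7 / κ ^ 2 * G) := by gcongr
      _ = _ := by ring
  have b3 : (∫ x in ball x₀ 1, ‖iteratedFDeriv ℝ 2 v x‖ ^ p) ^ (1 / p) ≤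
      (omg d + C₁) ^ (1 / p) * (7 / κ ^ 2 * G) := by
    refine setIntegral_rpow_rpow_inv_le_of_pow hp hpn (by positivity) hC₁.le
      (fun x => norm_nonneg _) (hs_continuous hV) (fun x hx => ?_) (hs_nonneg V)
      (hhs.trans (ENNReal.ofReal_le_ofReal ?_))
    · rw [((hev x hx).iteratedFDeriv ℝ 2).eq_of_nhds]
      exact norm_iteratedFDeriv_two_le_hs hV x
    · gcongr
  calc _ ≤ omg d ^ (1 / p) * G + omg d ^ (1 / p) * (C₁ * (7 / κ ^ 2) * G) +
        (omg d + C₁) ^ (1 / p) * (7 / κ ^ 2 * G) := add_le_add (add_le_add b1 b2) b3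
    _ = _ := by ring
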